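/- arXiv:2305.17365 — 4 statements merged into one kernel-verified Lean document; each statement's English description precedes it below -/
import Mathlib

section
/- There exists an absolute constant C > 0 such that the following holds. Let Z_1 and Z_2 be centered Gaussian random vectors in ℝ^d, d ≥ 3, with covariance matrices Σ^{(1)} and Σ respectively. Suppose Σ_{jj} = 1 for all j and 1 − Σ_{jk}² ≥ α² > 0 for all j ≠ k. Set Δ := max_{1 ≤ j,k ≤ d} |Σ^{(1)}_{jk} − Σ_{jk}|. Then sup_{a,b ∈ ℝ^d} |P(a ≤ Z_1 ≤ b) − P(a ≤ Z_2 ≤ b)| ≤ (C/α²) Δ (log d) (|log Δ| ∨ 1). -/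
open MeasureTheory ProbabilityTheory Matrix Real

namespace GC

/-- `μ` is a centered Gaussian law with covariance `C`. -/
def IsG {d : ℕ} (μ : Measure (Fin d → ℝ)) (C : Matrix (Fin d) (Fin d) ℝ) : Prop :=
  ∀ t : Fin d → ℝ, μ.map (fun x => t ⬝ᵥ x) = gaussianReal 0 (Real.toNNReal (t ⬝ᵥ C.mulVec t))

variable {d : ℕ} {μ : Measure (Fin d → ℝ)} {C : Matrix (Fin d) (Fin d) ℝ}

lemma meas_dot (t : Fin d → ℝ) : Measurable (fun x : Fin d → ℝ => t ⬝ᵥ x) := by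
  unfold dotProduct; fun_prop

lemma quad_nonneg (hC : C.PosSemidef) (t : Fin d → ℝ) : 0 ≤ t ⬝ᵥ C.mulVec t := by
  have := hC.dotProduct_mulVec_nonneg t
  simpa using this

lemma IsG.integral_exp (hμ : IsG μ C) (hC : C.PosSemidef) (t : Fin d → ℝ) :
    ∫ x, exp (t ⬝ᵥ x) ∂μ = exp (t ⬝ᵥ C.mulVec t / 2) := by
  have h' : mgf (fun x => t ⬝ᵥ x) μ 1 = exp (t ⬝ᵥ C.mulVec t / 2) := by
    rw [mgf_gaussianReal (hμ t)]
    simp [Real.coe_toNNReal _ (quad_nonneg hC t)]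
  simpa [mgf] using h'

lemma IsG.integrable_exp (hμ : IsG μ C) (t : Fin d → ℝ) :
    Integrable (fun x => exp (t ⬝ᵥ x)) μ := by
  have h := integrable_exp_mul_gaussianReal (μ := 0) (v := Real.toNNReal (t ⬝ᵥ C.mulVec t)) 1
  rw [← hμ t] at h
  have := (integrable_map_measure (by fun_prop) (meas_dot t).aemeasurable).1 h
  simpa [Function.comp_def] using this

lemma quad_add (hC : C.PosSemidef) (s t : Fin d → ℝ) :
    (s + t) ⬝ᵥ C.mulVec (s + t) = s ⬝ᵥ C.mulVec s + 2 * (s ⬝ᵥ C.mulVec t) + t ⬝ᵥ C.mulVec t := by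
  have hs : t ⬝ᵥ C.mulVec s = s ⬝ᵥ C.mulVec t := by
    rw [dotProduct_comm, ← vecMul_transpose, ← dotProduct_mulVec]
    have := hC.isHermitian
    rw [Matrix.IsHermitian, conjTranspose_eq_transpose_of_trivial] at this
    rw [this]
  rw [mulVec_add, dotProduct_add, add_dotProduct, add_dotProduct, hs]; ring

/-- Cramer-Wold via moment generating functions. -/
lemma ext_of_mgf {μ ν : Measure (Fin d → ℝ)} [IsProbabilityMeasure μ] [IsProbabilityMeasure ν]
    (hintg : ∀ t : Fin d → ℝ, Integrable (fun x => exp (t ⬝ᵥ x)) μ)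
    (h : ∀ t : Fin d → ℝ, ∫ x, exp (t ⬝ᵥ x) ∂μ = ∫ x, exp (t ⬝ᵥ x) ∂ν) : μ = ν := by
  apply Measure.ext_of_charFunDual
  ext L
  obtain ⟨t, ht⟩ : ∃ t : Fin d → ℝ, ∀ x, L x = t ⬝ᵥ x := by
    refine ⟨fun i => L (Pi.single i 1), fun x => ?_⟩
    conv_lhs => rw [← Finset.univ_sum_single x]
    rw [map_sum, dotProduct]
    refine Finset.sum_congr rfl fun i _ => ?_
    have : (Pi.single i (x i) : Fin d → ℝ) = x i • Pi.single i 1 := by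
      rw [← Pi.single_smul]; simp
    rw [this, map_smul]; simp [mul_comm]
  have hm : mgf (fun x => t ⬝ᵥ x) μ = mgf (fun x => t ⬝ᵥ x) ν := by
    ext s
    have := h (s • t)
    simpa [mgf] using this
  have hu : integrableExpSet (fun x => t ⬝ᵥ x) μ = Set.univ := by
    ext s
    have := hintg (s • t)
    simpa [integrableExpSet] using this
  have := eqOn_complexMGF_of_mgf hm (x := Complex.I) (by simp [hu])
  rw [charFunDual_apply, charFunDual_apply]
  simp only [ht]
  simp only [complexMGF] at this
  simp_rw [mul_comm _ Complex.I]
  exact this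

/-- Cameron-Martin for centered Gaussian vectors. -/
lemma IsG.cameron_martin [IsProbabilityMeasure μ] (hμ : IsG μ C) (hC : C.PosSemidef)
    (h : Fin d → ℝ) :
    μ.withDensity (fun x => ENNReal.ofReal (exp (h ⬝ᵥ x - h ⬝ᵥ C.mulVec h / 2)))
      = μ.map (fun x => x + C.mulVec h) := by
  have hm : Measurable (fun x : Fin d → ℝ => exp (h ⬝ᵥ x - h ⬝ᵥ C.mulVec h / 2)) :=
    ((meas_dot h).sub_const _).exp
  have hI : ∀ t : Fin d → ℝ, (fun x : Fin d → ℝ =>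
      exp (h ⬝ᵥ x - h ⬝ᵥ C.mulVec h / 2) * exp (t ⬝ᵥ x))
      = fun x => exp (- (h ⬝ᵥ C.mulVec h / 2)) * exp ((h + t) ⬝ᵥ x) := by
    intro t; ext x; rw [← exp_add, ← exp_add, add_dotProduct]; ring_nf
  have hp1 : IsProbabilityMeasure (μ.withDensity
      (fun x => ENNReal.ofReal (exp (h ⬝ᵥ x - h ⬝ᵥ C.mulVec h / 2)))) := by
    constructor
    rw [withDensity_apply _ MeasurableSet.univ, Measure.restrict_univ,
      ← ofReal_integral_eq_lintegral_ofReal]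
    · have := hI 0
      simp only [zero_dotProduct, exp_zero, mul_one, add_zero] at this
      rw [this, integral_const_mul, hμ.integral_exp hC, ← exp_add]; simp
    · have := hI 0
      simp only [zero_dotProduct, exp_zero, mul_one, add_zero] at this
      rw [this]; exact (hμ.integrable_exp h).const_mul _
    · filter_upwards with x using (exp_pos _).le
  have hmadd : Measurable (fun x : Fin d → ℝ => x + C.mulVec h) := by fun_prop
  have hp2 : IsProbabilityMeasure (μ.map (fun x => x + C.mulVec h)) :=
    Measure.isProbabilityMeasure_map hmadd.aemeasurable
  apply ext_of_mgf
  · intro t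
    rw [integrable_withDensity_iff_integrable_smul' (by fun_prop) (by simp)]
    simp only [ENNReal.toReal_ofReal (exp_pos _).le, smul_eq_mul]
    rw [hI t]
    exact (hμ.integrable_exp _).const_mul _
  · intro t
    rw [integral_withDensity_eq_integral_toReal_smul (by fun_prop) (by simp)]
    simp only [ENNReal.toReal_ofReal (exp_pos _).le, smul_eq_mul]
    rw [hI t, integral_const_mul, hμ.integral_exp hC, integral_map hmadd.aemeasurable
      ((meas_dot t).exp.aestronglyMeasurable)]
    simp only [dotProduct_add, exp_add]
    rw [integral_mul_const, hμ.integral_exp hC, ← exp_add, ← exp_add, quad_add hC]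
    congr 1
    have hs : t ⬝ᵥ C.mulVec h = h ⬝ᵥ C.mulVec t := by
      have h1 := quad_add hC t h
      have h2 := quad_add hC h t
      rw [add_comm h t] at h2
      linarith
    rw [hs]; ring

lemma IsG.lintegral_shift [IsProbabilityMeasure μ] (hμ : IsG μ C) (hC : C.PosSemidef)
    (h : Fin d → ℝ) (F : (Fin d → ℝ) → ENNReal) (hF : Measurable F) :
    ∫⁻ x, F (x - C.mulVec h) ∂μ =
      ∫⁻ x, ENNReal.ofReal (exp (- (h ⬝ᵥ x) - h ⬝ᵥ C.mulVec h / 2)) * F x ∂μ := by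
  have := hμ.cameron_martin hC (-h)
  have hmadd : Measurable (fun x : Fin d → ℝ => x + C.mulVec (-h)) := by fun_prop
  have e : ∫⁻ x, F (x - C.mulVec h) ∂μ = ∫⁻ x, F x ∂(μ.map (fun x => x + C.mulVec (-h))) := by
    rw [lintegral_map hF hmadd]
    simp [mulVec_neg, sub_eq_add_neg]
  rw [e, ← this, lintegral_withDensity_eq_lintegral_mul _ _ hF]
  · simp [mulVec_neg]
  · exact (((meas_dot _).sub_const _).exp).ennreal_ofReal

lemma IsG.integral_shift [IsProbabilityMeasure μ] (hμ : IsG μ C) (hC : C.PosSemidef)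
    (h : Fin d → ℝ) (F : (Fin d → ℝ) → ℝ) (hF : Measurable F) :
    ∫ x, F (x + C.mulVec h) ∂μ =
      ∫ x, exp (h ⬝ᵥ x - h ⬝ᵥ C.mulVec h / 2) * F x ∂μ := by
  have := hμ.cameron_martin hC h
  have hmadd : Measurable (fun x : Fin d → ℝ => x + C.mulVec h) := by fun_prop
  rw [← integral_map (f := F) hmadd.aemeasurable hF.aestronglyMeasurable, ← this,
    integral_withDensity_eq_integral_toReal_smul _ (by simp)]
  · simp only [ENNReal.toReal_ofReal (exp_pos _).le, smul_eq_mul]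
  · exact (((meas_dot _).sub_const _).exp).ennreal_ofReal

/-- Mixtures of independent Gaussians. -/
lemma IsG.mix {μ1 μ2 : Measure (Fin d → ℝ)} {C1 C2 : Matrix (Fin d) (Fin d) ℝ}
    [IsProbabilityMeasure μ1] [IsProbabilityMeasure μ2]
    (h1 : IsG μ1 C1) (h2 : IsG μ2 C2) (hC1 : C1.PosSemidef) (hC2 : C2.PosSemidef) (u v : ℝ) :
    IsG ((μ1.prod μ2).map (fun p => u • p.1 + v • p.2)) (u ^ 2 • C1 + v ^ 2 • C2) := by
  intro t
  have hmm : Measurable (fun p : (Fin d → ℝ) × (Fin d → ℝ) => u • p.1 + v • p.2) := by fun_prop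
  rw [Measure.map_map (meas_dot t) hmm]
  have hX : (μ1.prod μ2).map (fun p => (u • t) ⬝ᵥ p.1)
      = gaussianReal 0 (Real.toNNReal ((u • t) ⬝ᵥ C1.mulVec (u • t))) := by
    rw [← h1 (u • t)]
    have : (fun p : (Fin d → ℝ) × (Fin d → ℝ) => (u • t) ⬝ᵥ p.1)
      = (fun x => (u • t) ⬝ᵥ x) ∘ Prod.fst := rfl
    rw [this, ← Measure.map_map (meas_dot _) measurable_fst, Measure.map_fst_prod]; simp
  have hY : (μ1.prod μ2).map (fun p => (v • t) ⬝ᵥ p.2)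
      = gaussianReal 0 (Real.toNNReal ((v • t) ⬝ᵥ C2.mulVec (v • t))) := by
    rw [← h2 (v • t)]
    have : (fun p : (Fin d → ℝ) × (Fin d → ℝ) => (v • t) ⬝ᵥ p.2)
      = (fun x => (v • t) ⬝ᵥ x) ∘ Prod.snd := rfl
    rw [this, ← Measure.map_map (meas_dot _) measurable_snd, Measure.map_snd_prod]; simp
  have hind : IndepFun (fun p : (Fin d → ℝ) × (Fin d → ℝ) => (u • t) ⬝ᵥ p.1)
      (fun p => (v • t) ⬝ᵥ p.2) (μ1.prod μ2) :=
    indepFun_prod (X := fun x => (u • t) ⬝ᵥ x) (Y := fun x => (v • t) ⬝ᵥ x)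
      (meas_dot _) (meas_dot _)
  have := gaussianReal_add_gaussianReal_of_indepFun hind hX hY
  have e : ((fun x => t ⬝ᵥ x) ∘ fun p : (Fin d → ℝ) × (Fin d → ℝ) => u • p.1 + v • p.2)
      = (fun p => (u • t) ⬝ᵥ p.1) + (fun p => (v • t) ⬝ᵥ p.2) := by
    ext p; simp [dotProduct_add]
  rw [e, this]
  congr 1
  · simp
  · rw [← Real.toNNReal_add (quad_nonneg hC1 _) (quad_nonneg hC2 _)]
    congr 1
    simp only [mulVec_smul, dotProduct_smul, smul_dotProduct, add_mulVec, smul_mulVec,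
      dotProduct_add, smul_eq_mul]
    ring

end GC

namespace GC
variable {d : ℕ} {μ : Measure (Fin d → ℝ)} {C : Matrix (Fin d) (Fin d) ℝ}

/-- A mollifier supported in `[-1,1]`. -/
structure IsKer (κ : ℝ → ℝ) : Prop where
  smooth : ContDiff ℝ 2 κ
  nonneg : ∀ u, 0 ≤ κ u
  supp : ∀ u, κ u ≠ 0 → |u| ≤ 1
  int : Integrable κ
  one : ∫ u, κ u = 1

lemma IsKer.cont {κ : ℝ → ℝ} (hκ : IsKer κ) : Continuous κ := hκ.smooth.continuous

/-- dual vector part -/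
def hv (J : Finset (Fin d)) (v : Fin d → ℝ) : Fin d → ℝ := fun l => if l ∈ J then v l else 0
/-- base point part -/
def xv (J : Finset (Fin d)) (c v : Fin d → ℝ) : Fin d → ℝ := fun l => if l ∈ J then c l else v l
/-- wedge map -/
def wedge (C : Matrix (Fin d) (Fin d) ℝ) (J : Finset (Fin d)) (c v : Fin d → ℝ) : Fin d → ℝ :=
  xv J c v + C.mulVec (hv J v)
/-- linear part of the wedge map -/
def wmat (C : Matrix (Fin d) (Fin d) ℝ) (J : Finset (Fin d)) : Matrix (Fin d) (Fin d) ℝ :=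
  fun l m => if m ∈ J then C l m else (if l = m then 1 else 0)

/-- product kernel -/
noncomputable def Kd (κ : ℝ → ℝ) (x : Fin d → ℝ) : ℝ := ∏ l, κ (x l)

/-- density of the smoothed law -/
noncomputable def qd (κ : ℝ → ℝ) (μ : Measure (Fin d → ℝ)) (y : Fin d → ℝ) : ENNReal :=
  ∫⁻ w, ENNReal.ofReal (Kd κ (y - w)) ∂μ

/-- smoothed law -/
noncomputable def Qm (κ : ℝ → ℝ) (μ : Measure (Fin d → ℝ)) : Measure (Fin d → ℝ) :=
  volume.withDensity (qd κ μ)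

lemma wedge_eq (J : Finset (Fin d)) (c v : Fin d → ℝ) :
    wedge C J c v = hv J c + (wmat C J).mulVec v := by
  ext l
  simp only [wedge, xv, hv, Pi.add_apply, mulVec, dotProduct, wmat]
  have : ∀ m, (if m ∈ J then C l m else if l = m then 1 else 0) * v m
      = C l m * (if m ∈ J then v m else 0) + (if l = m then (if m ∈ J then 0 else v m) else 0) := by
    intro m; split_ifs <;> simp
  simp_rw [this, Finset.sum_add_distrib, Finset.sum_ite_eq]
  simp
  split_ifs <;> ring

lemma Kd_nonneg {κ : ℝ → ℝ} (hκ : IsKer κ) (x : Fin d → ℝ) : 0 ≤ Kd κ x :=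
  Finset.prod_nonneg fun _ _ => hκ.nonneg _

lemma Kd_cont {κ : ℝ → ℝ} (hκ : IsKer κ) : Continuous (Kd κ : (Fin d → ℝ) → ℝ) := by
  unfold Kd
  exact continuous_finsetProd _ fun l _ => hκ.cont.comp (continuous_apply l)

lemma Kd_meas2 {κ : ℝ → ℝ} (hκ : IsKer κ) :
    Measurable (fun p : (Fin d → ℝ) × (Fin d → ℝ) => ENNReal.ofReal (Kd κ (p.1 - p.2))) :=
  ((Kd_cont hκ).comp (continuous_fst.sub continuous_snd)).measurable.ennreal_ofReal

lemma lint_Kd {κ : ℝ → ℝ} (hκ : IsKer κ) (w : Fin d → ℝ) :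
    ∫⁻ y, ENNReal.ofReal (Kd κ (y - w)) = 1 := by
  have h1 : ∫⁻ y : Fin d → ℝ, ENNReal.ofReal (Kd κ (y - w)) = ∫⁻ y : Fin d → ℝ, ENNReal.ofReal (Kd κ y) :=
    lintegral_sub_right_eq_self (fun y : Fin d → ℝ => ENNReal.ofReal (Kd κ y)) w
  rw [h1, ← ofReal_integral_eq_lintegral_ofReal]
  · unfold Kd
    rw [integral_fintype_prod_volume_eq_prod (fun _ : Fin d => κ)]
    simp [hκ.one]
  · exact Integrable.fintype_prod (f := fun _ : Fin d => κ) (fun _ => hκ.int)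
  · filter_upwards with x using Kd_nonneg hκ x

lemma qd_meas [IsProbabilityMeasure μ] {κ : ℝ → ℝ} (hκ : IsKer κ) : Measurable (qd κ μ) :=
  (Kd_meas2 hκ).lintegral_prod_right'

lemma Qm_prob [IsProbabilityMeasure μ] {κ : ℝ → ℝ} (hκ : IsKer κ) :
    IsProbabilityMeasure (Qm κ μ) := by
  constructor
  rw [Qm, withDensity_apply _ MeasurableSet.univ, Measure.restrict_univ]
  unfold qd
  rw [lintegral_lintegral_swap (Kd_meas2 hκ).aemeasurable]
  simp [lint_Kd hκ]

lemma box_prod {κ : ℝ → ℝ} (hκ : IsKer κ) (J : Finset (Fin d)) (c w : Fin d → ℝ)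
    (I : Fin d → Set ℝ) (r : ℝ) (hr : 0 ≤ r)
    (hvol : ∀ l ∈ J, volume (I l) = ENNReal.ofReal r)
    (G : Fin d → ℝ → ℝ) (hG1 : ∀ l ∈ J, ∀ u, G l u = κ (c l - u))
    (hG2 : ∀ l ∉ J, ∀ u, G l u = ∫ v in I l, κ (v - u)) :
    ∫⁻ v in Set.univ.pi I, ENNReal.ofReal (Kd κ (xv J c v - w))
      = ENNReal.ofReal (r ^ J.card * ∏ l, G l (w l)) := by
  rw [volume_pi, Measure.restrict_pi_pi]
  let f : Fin d → ℝ → ℝ := fun l x => if l ∈ J then κ (c l - w l) else κ (x - w l)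
  have e : ∀ v, Kd κ (xv J c v - w) = ∏ l, f l (v l) := by
    intro v
    refine Finset.prod_congr rfl fun l _ => ?_
    simp only [f, xv, Pi.sub_apply]; split_ifs <;> rfl
  simp_rw [e]
  have hfi : ∀ l, Integrable (f l) (volume.restrict (I l)) := by
    intro l
    by_cases hl : l ∈ J
    · simp only [f, hl, if_true]
      have : IsFiniteMeasure (volume.restrict (I l)) := ⟨by simp [hvol l hl]⟩
      exact integrable_const _
    · simp only [f, hl, if_false]
      exact (hκ.int.comp_sub_right (w l)).restrict
  rw [← ofReal_integral_eq_lintegral_ofReal (Integrable.fintype_prod hfi)]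
  · congr 1
    rw [integral_fintype_prod_eq_prod]
    have : ∀ l, ∫ x in I l, f l x = (if l ∈ J then r else 1) * G l (w l) := by
      intro l
      by_cases hl : l ∈ J
      · simp [f, hl, hG1 l hl, measureReal_def, hvol l hl, ENNReal.toReal_ofReal hr]
      · simp [f, hl, hG2 l hl]
    simp_rw [this, Finset.prod_mul_distrib]
    congr 1
    simp
  · filter_upwards with v
    refine Finset.prod_nonneg fun l _ => ?_
    simp only [f]; split_ifs <;> exact hκ.nonneg _

lemma wedge_image {J : Finset (Fin d)} (hdet : (wmat C J).det ≠ 0)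
    (c : Fin d → ℝ) (B : Set (Fin d → ℝ)) (hB : MeasurableSet B) (g : (Fin d → ℝ) → ENNReal) :
    ∫⁻ y in wedge C J c '' B, g y
      = ENNReal.ofReal |(wmat C J).det| * ∫⁻ v in B, g (wedge C J c v) := by
  have hd : ∀ x ∈ B, HasFDerivWithinAt (wedge C J c)
      (LinearMap.toContinuousLinearMap (Matrix.toLin' (wmat C J))) B x := by
    intro x _
    have : wedge C J c = fun v => hv J c + (LinearMap.toContinuousLinearMap (Matrix.toLin' (wmat C J))) v := by
      ext v : 1; rw [wedge_eq]; simp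
    rw [this]
    exact ((ContinuousLinearMap.hasFDerivWithinAt _).const_add _)
  have hinj : Set.InjOn (wedge C J c) B := by
    intro x _ y _ hxy
    rw [wedge_eq, wedge_eq] at hxy
    have := add_left_cancel hxy
    exact Matrix.mulVec_injective_iff_isUnit.2 ((Matrix.isUnit_iff_isUnit_det _).2 (isUnit_iff_ne_zero.2 hdet)) this
  rw [lintegral_image_eq_lintegral_abs_det_fderiv_mul volume hB hd hinj]
  rw [lintegral_const_mul' _ _ ENNReal.ofReal_ne_top]
  congr 2
  simp [ContinuousLinearMap.det]

lemma wedge_meas {J : Finset (Fin d)} (hdet : (wmat C J).det ≠ 0)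
    (c : Fin d → ℝ) (B : Set (Fin d → ℝ)) (hB : MeasurableSet B) :
    MeasurableSet (wedge C J c '' B) := by
  have hinj : Function.Injective (wedge C J c) := by
    intro x y hxy
    rw [wedge_eq, wedge_eq] at hxy
    have := add_left_cancel hxy
    exact Matrix.mulVec_injective_iff_isUnit.2 ((Matrix.isUnit_iff_isUnit_det _).2 (isUnit_iff_ne_zero.2 hdet)) this
  have hc : Continuous (wedge C J c) := by
    have : wedge C J c = fun v => hv J c + (wmat C J).mulVec v := by
      ext v : 1; rw [wedge_eq]
    rw [this]; fun_prop
  exact hB.image_of_continuousOn_injOn hc.continuousOn hinj.injOn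

lemma single_config [IsProbabilityMeasure μ] (hμ : IsG μ C) (hC : C.PosSemidef)
    {κ : ℝ → ℝ} (hκ : IsKer κ) (J : Finset (Fin d)) (c : Fin d → ℝ)
    (I : Fin d → Set ℝ) (hI : ∀ l, MeasurableSet (I l)) (r : ℝ) (hr : 0 ≤ r)
    (hvol : ∀ l ∈ J, volume (I l) = ENNReal.ofReal r)
    (G : Fin d → ℝ → ℝ) (hG1 : ∀ l ∈ J, ∀ u, G l u = κ (c l - u))
    (hG2 : ∀ l ∉ J, ∀ u, G l u = ∫ v in I l, κ (v - u))
    (hGm : ∀ l, Measurable (G l))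
    (hdet : (wmat C J).det ≠ 0) (m : ℝ) (hm0 : 0 ≤ m)
    (hm : ∀ v ∈ Set.univ.pi I, ∀ w : Fin d → ℝ, (∀ j ∈ J, |c j - w j| ≤ 1) →
      m ≤ exp (- (hv J v ⬝ᵥ w) - hv J v ⬝ᵥ C.mulVec (hv J v) / 2)) :
    ENNReal.ofReal (|(wmat C J).det| * m * r ^ J.card) *
        ∫⁻ w, ENNReal.ofReal (∏ l, G l (w l)) ∂μ
      ≤ Qm κ μ (wedge C J c '' Set.univ.pi I) := by
  have hB : MeasurableSet (Set.univ.pi I) := MeasurableSet.univ_pi hI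
  have hxc : Continuous (fun v => xv J c v) := by
    refine continuous_pi fun l => ?_
    unfold xv; split_ifs <;> fun_prop
  have hwc : Continuous (wedge C J c) := by
    have : wedge C J c = fun v => hv J c + (wmat C J).mulVec v := by
      ext v : 1; rw [wedge_eq]
    rw [this]; fun_prop
  have hhc : Continuous (fun v => hv J v) := by
    refine continuous_pi fun l => ?_
    unfold hv; split_ifs <;> fun_prop
  rw [Qm, withDensity_apply _ (wedge_meas hdet c _ hB), wedge_image hdet c _ hB]
  rw [mul_assoc, ENNReal.ofReal_mul (abs_nonneg _), mul_assoc]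
  gcongr
  -- the inner comparison
  have key : ∀ v ∈ Set.univ.pi I,
      ENNReal.ofReal m * ∫⁻ w, ENNReal.ofReal (Kd κ (xv J c v - w)) ∂μ ≤ qd κ μ (wedge C J c v) := by
    intro v hvI
    have hF : Measurable (fun w : Fin d → ℝ => ENNReal.ofReal (Kd κ (xv J c v - w))) :=
      ((Kd_cont hκ).comp (continuous_const.sub continuous_id)).measurable.ennreal_ofReal
    have h1 := hμ.lintegral_shift hC (hv J v) _ hF
    have e : qd κ μ (wedge C J c v)
        = ∫⁻ x, ENNReal.ofReal (Kd κ (xv J c v - (x - C.mulVec (hv J v)))) ∂μ := by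
      unfold qd wedge
      congr 1; ext w; congr 2; abel
    rw [e, h1, ← lintegral_const_mul _ hF]
    refine lintegral_mono fun w => ?_
    by_cases hw : ∀ j ∈ J, |c j - w j| ≤ 1
    · gcongr
      exact hm v hvI w hw
    · push Not at hw
      obtain ⟨j, hj, hjw⟩ := hw
      have : Kd κ (xv J c v - w) = 0 := by
        refine Finset.prod_eq_zero (Finset.mem_univ j) ?_
        by_contra hne
        have := hκ.supp _ hne
        simp [xv, hj] at this
        linarith
      simp [this]
  have hK2 : Measurable (fun p : (Fin d → ℝ) × (Fin d → ℝ) =>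
      ENNReal.ofReal (Kd κ (xv J c p.1 - p.2))) :=
    ((Kd_cont hκ).comp ((hxc.comp continuous_fst).sub continuous_snd)).measurable.ennreal_ofReal
  calc ENNReal.ofReal (m * r ^ J.card) * ∫⁻ w, ENNReal.ofReal (∏ l, G l (w l)) ∂μ
      = ENNReal.ofReal m * ∫⁻ w, ENNReal.ofReal (r ^ J.card * ∏ l, G l (w l)) ∂μ := by
        rw [ENNReal.ofReal_mul hm0, mul_assoc]
        congr 1
        rw [← lintegral_const_mul]
        · simp_rw [ENNReal.ofReal_mul (pow_nonneg hr _)]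
        · exact (Finset.measurable_prod _ fun l _ =>
            (hGm l).comp (measurable_pi_apply l)).ennreal_ofReal
    _ = ENNReal.ofReal m * ∫⁻ w, (∫⁻ v in Set.univ.pi I, ENNReal.ofReal (Kd κ (xv J c v - w))) ∂μ := by
        congr 2; ext w
        rw [box_prod hκ J c w I r hr hvol G hG1 hG2]
    _ = ENNReal.ofReal m * ∫⁻ v in Set.univ.pi I, (∫⁻ w, ENNReal.ofReal (Kd κ (xv J c v - w)) ∂μ) := by
        congr 1
        exact (lintegral_lintegral_swap hK2.aemeasurable).symm
    _ = ∫⁻ v in Set.univ.pi I, ENNReal.ofReal m * ∫⁻ w, ENNReal.ofReal (Kd κ (xv J c v - w)) ∂μ := by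
        rw [lintegral_const_mul]
        exact hK2.lintegral_prod_right'
    _ ≤ ∫⁻ v in Set.univ.pi I, qd κ μ (wedge C J c v) := by
        exact setLIntegral_mono' hB key

end GC

namespace GC
variable {d : ℕ} {μ : Measure (Fin d → ℝ)} {C : Matrix (Fin d) (Fin d) ℝ}

lemma det_wmat_one (j : Fin d) : (wmat C {j}).det = C j j := by
  have : wmat C {j} = (1 : Matrix (Fin d) (Fin d) ℝ).updateCol j (fun l => C l j) := by
    ext l m
    by_cases h : m = j
    · subst h; simp [wmat]
    · simp [wmat, h, Matrix.updateCol_ne h, Matrix.one_apply]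
  rw [this, ← Matrix.cramer_apply, Matrix.cramer_one]; rfl

lemma det_wmat_two {j k : Fin d} (hjk : j ≠ k) :
    (wmat C {j, k}).det = C j j * C k k - C j k * C k j := by
  obtain ⟨U, hU⟩ : ∃ U : Matrix (Fin d) (Fin 2) ℝ, ∀ l i, U l i =
    if i = 0 then C l j - (if l = j then 1 else 0) else C l k - (if l = k then 1 else 0) :=
    ⟨fun l i => if i = 0 then C l j - (if l = j then 1 else 0)
      else C l k - (if l = k then 1 else 0), fun _ _ => rfl⟩
  obtain ⟨V, hV⟩ : ∃ V : Matrix (Fin 2) (Fin d) ℝ, ∀ i m, V i m =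
    if i = 0 then (if m = j then 1 else 0) else (if m = k then 1 else 0) :=
    ⟨fun i m => if i = 0 then (if m = j then 1 else 0) else (if m = k then 1 else 0),
      fun _ _ => rfl⟩
  have : wmat C {j, k} = 1 + U * V := by
    ext l m
    simp only [wmat, Matrix.add_apply, Matrix.mul_apply, Fin.sum_univ_two, hU, hV, Matrix.one_apply,
      Finset.mem_insert, Finset.mem_singleton]
    by_cases h1 : m = j
    · subst h1; simp [hjk]
    · by_cases h2 : m = k
      · subst h2; simp [h1]
      · simp [h1, h2]
  rw [this, Matrix.det_one_add_mul_comm, Matrix.det_fin_two]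
  simp [Matrix.add_apply, Matrix.mul_apply, hU, hV, hjk, hjk.symm]

/-- threshold on a side -/
def thr (a b : Fin d → ℝ) (σ : Fin d → Bool) (l : Fin d) : ℝ := if σ l then b l else a l

/-- normal boxes -/
def nbox (a b : Fin d → ℝ) (r : ℝ) (J : Finset (Fin d)) (σ : Fin d → Bool) (l : Fin d) : Set ℝ :=
  if l ∈ J then (if σ l then Set.Icc 0 r else Set.Icc (-r) 0) else Set.Ioo (a l) (b l)

lemma wedge_disjoint (hC : C.PosSemidef) {a b : Fin d → ℝ} (hab : ∀ l, a l < b l)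
    {r : ℝ} {J J' : Finset (Fin d)} (σ σ' : Fin d → Bool) (hJ : J ≠ J') :
    Disjoint (wedge C J (thr a b σ) '' Set.univ.pi (nbox a b r J σ))
      (wedge C J' (thr a b σ') '' Set.univ.pi (nbox a b r J' σ')) := by
  rw [Set.disjoint_left]
  rintro y ⟨v, hv1, rfl⟩ ⟨v', hv2, hy⟩
  apply hJ
  have gen : ∀ (J : Finset (Fin d)) (σ : Fin d → Bool) (v : Fin d → ℝ),
      v ∈ Set.univ.pi (nbox a b r J σ) →
      (∀ l, a l ≤ xv J (thr a b σ) v l ∧ xv J (thr a b σ) v l ≤ b l) ∧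
      (∀ l, l ∈ J ↔ ¬ (a l < xv J (thr a b σ) v l ∧ xv J (thr a b σ) v l < b l)) ∧
      (∀ z : Fin d → ℝ, (∀ l, a l ≤ z l ∧ z l ≤ b l) →
        hv J v ⬝ᵥ (z - xv J (thr a b σ) v) ≤ 0) := by
    intro J σ v hvb
    have hvb' : ∀ l, v l ∈ nbox a b r J σ l := fun l => hvb l (Set.mem_univ l)
    clear hv1 hv2 hy hvb
    refine ⟨fun l => ?_, fun l => ?_, fun z hz => ?_⟩
    · have h3 := hvb' l; have h4 := hab l
      by_cases h1 : l ∈ J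
      · by_cases h2 : σ l
        · simp [xv, thr, h1, h2, h4.le]
        · simp [xv, thr, h1, h2, h4.le]
      · simp [nbox, h1] at h3
        simp [xv, h1, h3.1.le, h3.2.le]
    · have h3 := hvb' l; have h4 := hab l
      by_cases h1 : l ∈ J
      · by_cases h2 : σ l
        · simp [xv, thr, h1, h2]
        · simp [xv, thr, h1, h2]
      · simp [nbox, h1] at h3
        simp [xv, h1, h3.1, h3.2]
    · refine Finset.sum_nonpos fun l _ => ?_
      have h3 := hvb' l; have h4 := hab l; have h5 := hz l
      by_cases h1 : l ∈ J
      · by_cases h2 : σ l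
        · simp only [nbox, h1, h2, if_true, Set.mem_Icc] at h3
          simp only [hv, xv, thr, h1, h2, if_true, Pi.sub_apply]
          exact mul_nonpos_of_nonneg_of_nonpos h3.1 (by linarith)
        · simp [nbox, h1, h2] at h3
          simp [hv, xv, thr, h1, h2]
          exact mul_nonpos_of_nonpos_of_nonneg h3.2 (by linarith)
      · simp [hv, h1]
  obtain ⟨p1, p2, p3⟩ := gen J σ v hv1
  obtain ⟨q1, q2, q3⟩ := gen J' σ' v' hv2
  set x := xv J (thr a b σ) v with hx
  set x' := xv J' (thr a b σ') v' with hx'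
  have hd : C.mulVec (hv J v - hv J' v') = x' - x := by
    rw [mulVec_sub]
    have : x' + C.mulVec (hv J' v') = x + C.mulVec (hv J v) := hy
    have h2 := congrArg (fun t => t - x - C.mulVec (hv J' v')) this
    rw [show x' + C *ᵥ hv J' v' - x - C *ᵥ hv J' v' = x' - x by abel] at h2
    rw [h2]; abel
  have h0 : (hv J v - hv J' v') ⬝ᵥ C.mulVec (hv J v - hv J' v') = 0 := by
    apply le_antisymm _ (quad_nonneg hC _)
    rw [hd, sub_dotProduct]
    have h1 := p3 x' q1
    have h2 := q3 x p1
    have h3 : hv J' v' ⬝ᵥ (x' - x) = - (hv J' v' ⬝ᵥ (x - x')) := by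
      rw [← dotProduct_neg, neg_sub]
    rw [h3]; linarith
  have h1 : C.mulVec (hv J v - hv J' v') = 0 := by
    have := (hC.dotProduct_mulVec_zero_iff (hv J v - hv J' v')).1 (by simpa using h0)
    exact this
  have hxx : x' = x := by
    rw [h1] at hd
    exact (sub_eq_zero.1 hd.symm)
  ext l
  rw [p2, q2, hxx]

/-- smoothed indicator -/
noncomputable def gs (κ : ℝ → ℝ) (a b : ℝ) (u : ℝ) : ℝ := ∫ v in Set.Ioo a b, κ (v - u)

/-- the factors of a boundary functional -/
noncomputable def Gf (κ : ℝ → ℝ) (a b : Fin d → ℝ) (J : Finset (Fin d)) (σ : Fin d → Bool)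
    (l : Fin d) : ℝ → ℝ :=
  if l ∈ J then (fun u => κ (thr a b σ l - u)) else gs κ (a l) (b l)

/-- boundary functional -/
noncomputable def FJ (κ : ℝ → ℝ) (a b : Fin d → ℝ) (J : Finset (Fin d)) (σ : Fin d → Bool)
    (w : Fin d → ℝ) : ℝ := ∏ l, Gf κ a b J σ l (w l)

lemma gs_nonneg {κ : ℝ → ℝ} (hκ : IsKer κ) (a b u : ℝ) : 0 ≤ gs κ a b u :=
  integral_nonneg fun _ => hκ.nonneg _

lemma gs_le_one {κ : ℝ → ℝ} (hκ : IsKer κ) (a b u : ℝ) : gs κ a b u ≤ 1 := by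
  have h1 : ∫ v, κ (v - u) = 1 := by rw [integral_sub_right_eq_self κ u]; exact hκ.one
  rw [← h1]
  exact setIntegral_le_integral (hκ.int.comp_sub_right u)
    (by filter_upwards with v using hκ.nonneg _)

lemma gs_eq {κ : ℝ → ℝ} {a b : ℝ} (hab : a ≤ b) (u : ℝ) :
    gs κ a b u = ∫ v in (a - u)..(b - u), κ v := by
  rw [gs, ← integral_Ioc_eq_integral_Ioo, ← intervalIntegral.integral_of_le hab,
    intervalIntegral.integral_comp_sub_right]

lemma gs_deriv {κ : ℝ → ℝ} (hκ : IsKer κ) {a b : ℝ} (hab : a ≤ b) (u : ℝ) :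
    HasDerivAt (gs κ a b) (κ (a - u) - κ (b - u)) u := by
  have e : gs κ a b = fun u => (∫ v in (0:ℝ)..(b - u), κ v) - ∫ v in (0:ℝ)..(a - u), κ v := by
    ext u
    rw [gs_eq hab, intervalIntegral.integral_interval_sub_left] <;>
      exact hκ.cont.intervalIntegrable _ _
  rw [e]
  have h : ∀ c : ℝ, HasDerivAt (fun u => ∫ v in (0:ℝ)..(c - u), κ v) (- κ (c - u)) u := by
    intro c
    have h1 : HasDerivAt (fun t => ∫ v in (0:ℝ)..t, κ v) (κ (c - u)) (c - u) :=
      intervalIntegral.integral_hasDerivAt_right (hκ.cont.intervalIntegrable _ _)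
        (hκ.cont.stronglyMeasurableAtFilter _ _) hκ.cont.continuousAt
    have h2 : HasDerivAt (fun u => c - u) (-1) u := by
      simpa using (hasDerivAt_id u).const_sub c
    have h3 := h1.comp u h2
    rw [mul_neg_one] at h3
    exact h3
  have h3 := (h b).sub (h a)
  rw [show κ (a - u) - κ (b - u) = -κ (b - u) - -κ (a - u) by ring]
  exact h3

lemma gs_cont {κ : ℝ → ℝ} (hκ : IsKer κ) {a b : ℝ} (hab : a ≤ b) : Continuous (gs κ a b) :=
  continuous_iff_continuousAt.2 fun u => (gs_deriv hκ hab u).continuousAt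

lemma IsKer.bdd {κ : ℝ → ℝ} (hκ : IsKer κ) : ∃ M, 0 ≤ M ∧ ∀ u, κ u ≤ M := by
  have hcs : HasCompactSupport κ := by
    refine HasCompactSupport.intro (isCompact_Icc (a := (-1:ℝ)) (b := 1)) fun u hu => ?_
    by_contra hne
    exact hu (abs_le.1 (hκ.supp u hne))
  obtain ⟨M, hM⟩ := hcs.exists_bound_of_continuous hκ.cont
  exact ⟨M, le_trans (norm_nonneg _) (hM 0), fun u => le_trans (le_abs_self _) (hM u)⟩

lemma Gf_nonneg {κ : ℝ → ℝ} (hκ : IsKer κ) (a b : Fin d → ℝ) (J : Finset (Fin d))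
    (σ : Fin d → Bool) (l : Fin d) (u : ℝ) : 0 ≤ Gf κ a b J σ l u := by
  unfold Gf; split_ifs
  · exact hκ.nonneg _
  · exact gs_nonneg hκ _ _ _

lemma Gf_cont {κ : ℝ → ℝ} (hκ : IsKer κ) {a b : Fin d → ℝ} (hab : ∀ l, a l < b l)
    (J : Finset (Fin d)) (σ : Fin d → Bool) (l : Fin d) : Continuous (Gf κ a b J σ l) := by
  unfold Gf; split_ifs
  · exact hκ.cont.comp (by fun_prop)
  · exact gs_cont hκ (hab l).le

lemma FJ_nonneg {κ : ℝ → ℝ} (hκ : IsKer κ) (a b : Fin d → ℝ) (J : Finset (Fin d))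
    (σ : Fin d → Bool) (w : Fin d → ℝ) : 0 ≤ FJ κ a b J σ w :=
  Finset.prod_nonneg fun _ _ => Gf_nonneg hκ _ _ _ _ _ _

lemma FJ_cont {κ : ℝ → ℝ} (hκ : IsKer κ) {a b : Fin d → ℝ} (hab : ∀ l, a l < b l)
    (J : Finset (Fin d)) (σ : Fin d → Bool) : Continuous (FJ κ a b J σ) := by
  unfold FJ
  exact continuous_finsetProd _ fun l _ => (Gf_cont hκ hab J σ l).comp (continuous_apply l)

lemma FJ_integrable [IsProbabilityMeasure μ] {κ : ℝ → ℝ} (hκ : IsKer κ) {a b : Fin d → ℝ}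
    (hab : ∀ l, a l < b l) (J : Finset (Fin d)) (σ : Fin d → Bool) :
    Integrable (FJ κ a b J σ) μ := by
  obtain ⟨M, hM0, hM⟩ := hκ.bdd
  refine Integrable.of_bound (C := ∏ _l : Fin d, (M + 1))
    (FJ_cont hκ hab J σ).aestronglyMeasurable ?_
  filter_upwards with w
  rw [Real.norm_of_nonneg (FJ_nonneg hκ a b J σ w)]
  refine Finset.prod_le_prod (fun _ _ => Gf_nonneg hκ _ _ _ _ _ _) fun l _ => ?_
  unfold Gf; split_ifs
  · linarith [hM (thr a b σ l - w l)]
  · linarith [gs_le_one hκ (a l) (b l) (w l)]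

end GC

namespace GC
variable {d : ℕ} {μ : Measure (Fin d → ℝ)} {C : Matrix (Fin d) (Fin d) ℝ}

lemma hv_dot (J : Finset (Fin d)) (v w : Fin d → ℝ) : hv J v ⬝ᵥ w = ∑ l ∈ J, v l * w l := by
  simp [hv, dotProduct, ite_mul, Finset.sum_ite_mem]

lemma quad_le (hC2 : ∀ j k, |C j k| ≤ 2) (J : Finset (Fin d)) (hJ : J.card ≤ 2) (v : Fin d → ℝ) :
    hv J v ⬝ᵥ C.mulVec (hv J v) / 2 ≤ 2 * ∑ l ∈ J, |v l| ^ 2 := by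
  have h1 : hv J v ⬝ᵥ C.mulVec (hv J v) = ∑ l ∈ J, ∑ m ∈ J, v l * v m * C l m := by
    rw [hv_dot]
    refine Finset.sum_congr rfl fun l _ => ?_
    rw [mulVec, dotProduct_comm, hv_dot, Finset.mul_sum]
    exact Finset.sum_congr rfl fun m _ => by ring
  have h2 : ∑ l ∈ J, ∑ m ∈ J, v l * v m * C l m ≤ ∑ l ∈ J, ∑ m ∈ J, |v l| * |v m| * 2 := by
    refine Finset.sum_le_sum fun l _ => Finset.sum_le_sum fun m _ => ?_
    calc v l * v m * C l m ≤ |v l * v m * C l m| := le_abs_self _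
      _ = |v l| * |v m| * |C l m| := by rw [abs_mul, abs_mul]
      _ ≤ _ := by gcongr; exact hC2 l m
  have h3 : ∑ l ∈ J, ∑ m ∈ J, |v l| * |v m| * 2 = 2 * (∑ l ∈ J, |v l|) ^ 2 := by
    rw [sq, Finset.sum_mul_sum, Finset.mul_sum]
    refine Finset.sum_congr rfl fun l _ => ?_
    rw [Finset.mul_sum]
    exact Finset.sum_congr rfl fun m _ => by ring
  have h4 : (∑ l ∈ J, |v l|) ^ 2 ≤ J.card * ∑ l ∈ J, |v l| ^ 2 := sq_sum_le_card_mul_sum_sq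
  have h5 : (J.card : ℝ) * ∑ l ∈ J, |v l| ^ 2 ≤ 2 * ∑ l ∈ J, |v l| ^ 2 := by
    gcongr
    · exact_mod_cast hJ
  rw [h1]; linarith

lemma lint_FJ [IsProbabilityMeasure μ] {κ : ℝ → ℝ} (hκ : IsKer κ) {a b : Fin d → ℝ}
    (hab : ∀ l, a l < b l) (J : Finset (Fin d)) (σ : Fin d → Bool) :
    ∫⁻ w, ENNReal.ofReal (∏ l, Gf κ a b J σ l (w l)) ∂μ = ENNReal.ofReal (∫ w, FJ κ a b J σ w ∂μ) := by
  rw [ofReal_integral_eq_lintegral_ofReal (FJ_integrable hκ hab J σ)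
    (by filter_upwards with w using FJ_nonneg hκ a b J σ w)]
  rfl

/-- near configurations -/
lemma near_sum [IsProbabilityMeasure μ] (hμ : IsG μ C) (hC : C.PosSemidef)
    (hC2 : ∀ j k, |C j k| ≤ 2) {κ : ℝ → ℝ} (hκ : IsKer κ) {a b : Fin d → ℝ}
    (hab : ∀ l, a l < b l) {ι : Type*} (s : Finset ι) (J : ι → Finset (Fin d))
    (hinj : Set.InjOn J s) (σ : ι → Fin d → Bool) (n : ℕ) (hn : n ≤ 2)
    (hcard : ∀ i ∈ s, (J i).card = n) {D : ℝ} (hD : 0 < D)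
    (hdet : ∀ i ∈ s, D ≤ |(wmat C (J i)).det|) {B : ℝ} (hB : 1 ≤ B)
    (hthr : ∀ i ∈ s, ∀ l ∈ J i, |thr a b (σ i) l| ≤ B) :
    ∑ i ∈ s, ∫ w, FJ κ a b (J i) (σ i) w ∂μ ≤ exp 8 * B ^ n / D := by
  have hB0 : 0 < B := by linarith
  have hr0 : (0:ℝ) ≤ 1 / B := by positivity
  have hr1 : 1 / B ≤ 1 := by rw [div_le_one hB0]; exact hB
  have key : ∀ i ∈ s, ENNReal.ofReal (D * exp (-8) * (1 / B) ^ n) *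
      ENNReal.ofReal (∫ w, FJ κ a b (J i) (σ i) w ∂μ)
      ≤ Qm κ μ (wedge C (J i) (thr a b (σ i)) '' Set.univ.pi (nbox a b (1 / B) (J i) (σ i))) := by
    intro i hi
    have hvb : ∀ v ∈ Set.univ.pi (nbox a b (1 / B) (J i) (σ i)), ∀ l ∈ J i, |v l| ≤ 1 / B := by
      intro v hv l hl
      have h3 := hv l (Set.mem_univ l)
      simp only [nbox, hl, if_true] at h3
      split_ifs at h3
      · rw [abs_le]; exact ⟨by linarith [h3.1], h3.2⟩
      · rw [abs_le]; exact ⟨h3.1, by linarith [h3.2]⟩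
    have h1 := single_config hμ hC hκ (J i) (thr a b (σ i)) (nbox a b (1 / B) (J i) (σ i))
      (fun l => by
        unfold nbox
        split_ifs <;> measurability) (1 / B) hr0
      (fun l hl => by
        simp only [nbox, hl, if_true]
        split_ifs <;> simp)
      (Gf κ a b (J i) (σ i)) (fun l hl u => by simp [Gf, hl])
      (fun l hl u => by simp [Gf, nbox, hl, gs])
      (fun l => (Gf_cont hκ hab _ _ l).measurable)
      (by
        have := hdet i hi
        intro h0; rw [h0, abs_zero] at this; linarith)
      (exp (-8)) (exp_pos _).le
      (by
        intro v hvv w hw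
        rw [exp_le_exp]
        have e1 := quad_le hC2 (J i) (by rw [hcard i hi]; exact hn) v
        have e2 : ∑ l ∈ J i, |v l| ^ 2 ≤ ∑ l ∈ J i, (1:ℝ) := by
          refine Finset.sum_le_sum fun l hl => ?_
          have := hvb v hvv l hl
          have h0 := abs_nonneg (v l)
          nlinarith
        have e3 : hv (J i) v ⬝ᵥ w ≤ ∑ l ∈ J i, (2:ℝ) := by
          rw [hv_dot]
          refine Finset.sum_le_sum fun l hl => ?_
          have h1 := hvb v hvv l hl
          have h2 := hthr i hi l hl
          have h3 := hw l hl
          have h4 : |w l| ≤ B + 1 := by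
            rw [abs_le] at *
            constructor <;> linarith
          calc v l * w l ≤ |v l * w l| := le_abs_self _
            _ = |v l| * |w l| := abs_mul _ _
            _ ≤ 1 / B * (B + 1) := by gcongr
            _ = 1 + 1 / B := by field_simp
            _ ≤ 2 := by linarith
        have e4 : ((J i).card : ℝ) ≤ 2 := by rw [hcard i hi]; exact_mod_cast hn
        rw [Finset.sum_const, nsmul_eq_mul] at e2 e3
        linarith)
    rw [lint_FJ hκ hab] at h1
    refine le_trans ?_ h1
    rw [hcard i hi]
    gcongr
    exact hdet i hi
  have hdisj := sum_measure_le_measure_univ (μ := Qm κ μ) (s := s)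
    (t := fun i => wedge C (J i) (thr a b (σ i)) '' Set.univ.pi (nbox a b (1 / B) (J i) (σ i)))
    (fun i hi => (wedge_meas (by
        have := hdet i hi
        intro h0; rw [h0, abs_zero] at this; linarith) _ _ (MeasurableSet.univ_pi fun l => by
          unfold nbox
          split_ifs <;> measurability)).nullMeasurableSet)
    (fun i hi j hj hij => (wedge_disjoint hC hab (σ i) (σ j)
      (fun h => hij (hinj hi hj h))).aedisjoint)
  haveI := Qm_prob (μ := μ) hκ
  rw [measure_univ] at hdisj
  have h2 := (Finset.sum_le_sum key).trans hdisj
  rw [← Finset.mul_sum, ← ENNReal.ofReal_sum_of_nonneg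
    (fun i _ => integral_nonneg fun w => FJ_nonneg hκ a b _ _ w),
    ← ENNReal.ofReal_mul (by positivity), ENNReal.ofReal_le_one] at h2
  set T := ∑ i ∈ s, ∫ w, FJ κ a b (J i) (σ i) w ∂μ
  rw [le_div_iff₀ hD]
  have h3 : exp 8 * B ^ n * (D * exp (-8) * (1 / B) ^ n * T) ≤ exp 8 * B ^ n * 1 := by gcongr
  have h4 : exp 8 * B ^ n * (D * exp (-8) * (1 / B) ^ n * T) = (exp 8 * exp (-8)) * (B * (1 / B)) ^ n * (T * D) := by
    rw [mul_pow]; ring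
  rw [h4, ← exp_add, mul_one_div_cancel hB0.ne'] at h3
  simpa using h3

/-- far configurations -/
lemma far_bound [IsProbabilityMeasure μ] (hμ : IsG μ C) (hC : C.PosSemidef)
    (hC2 : ∀ j k, |C j k| ≤ 2) {κ : ℝ → ℝ} (hκ : IsKer κ) {a b : Fin d → ℝ}
    (hab : ∀ l, a l < b l) (J : Finset (Fin d)) (σ : Fin d → Bool)
    (hcard : J.card ≤ 2) {D : ℝ} (hD : 0 < D)
    (hdet : D ≤ |(wmat C J).det|) (j : Fin d) (hj : j ∈ J) (hthr : 2 ≤ |thr a b σ j|) :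
    ∫ w, FJ κ a b J σ w ∂μ ≤ exp 6 * exp (- (thr a b σ j ^ 2 / 32)) / D := by
  set c := thr a b σ with hc
  let lam : Fin d → ℝ := fun l => max 0 ((|c l| - 1) / 4)
  have hl0 : ∀ l, 0 ≤ lam l := fun l => le_max_left _ _
  let I : Fin d → Set ℝ := fun l => if l ∈ J then
    (if 0 ≤ c l then Set.Icc (-(lam l + 1)) (-lam l) else Set.Icc (lam l) (lam l + 1))
    else Set.Ioo (a l) (b l)
  have h1 := single_config hμ hC hκ J c I
      (fun l => by
        simp only [I]
        split_ifs <;> measurability) 1 zero_le_one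
      (fun l hl => by
        simp only [I, hl, if_true]
        split_ifs <;> simp)
      (Gf κ a b J σ) (fun l hl u => by simp [Gf, hl, hc])
      (fun l hl u => by simp [Gf, I, hl, gs])
      (fun l => (Gf_cont hκ hab _ _ l).measurable)
      (by
        intro h0; rw [h0, abs_zero] at hdet; linarith)
      (exp (2 * lam j ^ 2 - 6)) (exp_pos _).le
      (by
        intro v hvv w hw
        rw [exp_le_exp]
        have e1 := quad_le hC2 J hcard v
        have e3 : ∀ l ∈ J, v l * w l + 2 * |v l| ^ 2 ≤ 3 - 2 * lam l ^ 2 := by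
          intro l hl
          have h3 := hvv l (Set.mem_univ l)
          simp only [I, hl, if_true] at h3
          have h4 := hw l hl
          rw [abs_le] at h4
          have h5 : lam l = 0 ∧ |c l| ≤ 1 ∨ 4 * lam l = |c l| - 1 := by
            by_cases h : |c l| ≤ 1
            · left; exact ⟨max_eq_left (by linarith), h⟩
            · right; simp only [lam]; rw [max_eq_right (by linarith)]; ring
          have h6 := hl0 l
          split_ifs at h3 with h7
          · rw [abs_of_nonneg h7] at h5
            have h8 : |v l| = - v l := abs_of_nonpos (by linarith [h3.2])
            rw [h8]
            obtain ⟨y1, y2⟩ := h3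
            rcases h5 with ⟨h5, h9⟩ | h5
            · rw [h5] at y1 y2 ⊢
              nlinarith [mul_nonneg (show 0 ≤ - v l by linarith) (show 0 ≤ w l + 1 by linarith),
                mul_nonneg (show 0 ≤ - v l by linarith) (show 0 ≤ 1 + v l by linarith)]
            · nlinarith [mul_nonneg (show 0 ≤ - v l by linarith) (show 0 ≤ w l - 4 * lam l by linarith)]
          · rw [abs_of_neg (not_le.1 h7)] at h5
            have h8 : |v l| = v l := abs_of_nonneg (by linarith [h3.1])
            rw [h8]
            obtain ⟨y1, y2⟩ := h3
            rcases h5 with ⟨h5, h9⟩ | h5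
            · rw [h5] at y1 y2 ⊢
              nlinarith [mul_nonneg (show 0 ≤ v l by linarith) (show 0 ≤ 1 - w l by linarith),
                mul_nonneg (show 0 ≤ v l by linarith) (show 0 ≤ 1 - v l by linarith)]
            · nlinarith [mul_nonneg (show 0 ≤ v l by linarith) (show 0 ≤ - w l - 4 * lam l by linarith)]
        have e4 := Finset.sum_le_sum e3
        rw [Finset.sum_add_distrib, ← hv_dot, ← Finset.mul_sum, Finset.sum_sub_distrib,
          Finset.sum_const, nsmul_eq_mul] at e4
        have e5 : (J.card : ℝ) ≤ 2 := by exact_mod_cast hcard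
        have e6 : 2 * lam j ^ 2 ≤ ∑ l ∈ J, 2 * lam l ^ 2 :=
          Finset.single_le_sum (f := fun l => 2 * lam l ^ 2) (fun l _ => by positivity) hj
        linarith)
  rw [lint_FJ hκ hab] at h1
  haveI := Qm_prob (μ := μ) hκ
  have h2 := h1.trans prob_le_one
  rw [one_pow, mul_one, ← ENNReal.ofReal_mul (by positivity), ENNReal.ofReal_le_one] at h2
  have hT0 : 0 ≤ ∫ w, FJ κ a b J σ w ∂μ := integral_nonneg fun w => FJ_nonneg hκ a b _ _ w
  set T := ∫ w, FJ κ a b J σ w ∂μ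
  have h3 : D * exp (2 * lam j ^ 2 - 6) * T ≤ 1 := le_trans (by gcongr) h2
  rw [le_div_iff₀ hD]
  have h4 : T * D ≤ exp (-(2 * lam j ^ 2 - 6)) := by
    rw [Real.exp_neg, ← one_div, le_div_iff₀ (exp_pos _)]
    linarith [h3]
  refine h4.trans ?_
  rw [← exp_add, exp_le_exp]
  have h5 : lam j = (|c j| - 1) / 4 := max_eq_right (by linarith)
  have h6 : |c j| ^ 2 = c j ^ 2 := sq_abs _
  rw [h5, ← h6]
  nlinarith
end GC

namespace GC
variable {d : ℕ} {μ : Measure (Fin d → ℝ)} {C : Matrix (Fin d) (Fin d) ℝ}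

lemma one_le_log {d : ℕ} (hd : 3 ≤ d) : 1 ≤ Real.log d := by
  rw [Real.le_log_iff_exp_le (by positivity)]
  have h := Real.exp_one_lt_d9
  have h2 : (3:ℝ) ≤ d := by exact_mod_cast hd
  linarith

/-- standing assumptions on a covariance matrix -/
structure Good (C : Matrix (Fin d) (Fin d) ℝ) (β : ℝ) : Prop where
  psd : C.PosSemidef
  le2 : ∀ j k, |C j k| ≤ 2
  diag : ∀ j, 1 / 2 ≤ C j j
  pos : 0 < β
  minor : ∀ j k, j ≠ k → β ≤ C j j * C k k - C j k * C k j

lemma pair_sum [IsProbabilityMeasure μ] (hd : 3 ≤ d) (hμ : IsG μ C) {β : ℝ} (hC : Good C β)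
    {κ : ℝ → ℝ} (hκ : IsKer κ) {a b : Fin d → ℝ}
    (hab : ∀ l, a l < b l) (s : Finset (Fin d × Fin d)) (hs : ∀ p ∈ s, p.1 ≠ p.2)
    (hinj : Set.InjOn (fun p : Fin d × Fin d => ({p.1, p.2} : Finset (Fin d))) s)
    (σ : Fin d × Fin d → Fin d → Bool) :
    ∑ p ∈ s, ∫ w, FJ κ a b {p.1, p.2} (σ p) w ∂μ ≤ 65 * exp 8 * Real.log d / β := by
  have hL := one_le_log hd
  have hβ := hC.pos
  have hd0 : (0:ℝ) < d := by positivity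
  set L := Real.log d with hLdef
  set B := 8 * √L with hBdef
  have hsq : √L ^ 2 = L := Real.sq_sqrt (by linarith)
  have hs1 : 1 ≤ √L := Real.one_le_sqrt.2 hL
  have hB1 : 1 ≤ B := by rw [hBdef]; linarith
  have hB2 : B ^ 2 = 64 * L := by rw [hBdef, mul_pow, hsq]; norm_num
  have hdet : ∀ p ∈ s, β ≤ |(wmat C {p.1, p.2}).det| := fun p hp => by
    rw [det_wmat_two (hs p hp)]
    exact (hC.minor _ _ (hs p hp)).trans (le_abs_self _)
  rw [← Finset.sum_filter_add_sum_filter_not s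
    (fun p => ∀ l ∈ ({p.1, p.2} : Finset (Fin d)), |thr a b (σ p) l| ≤ B)]
  have h1 := near_sum hμ hC.psd hC.le2 hκ hab
    (s.filter (fun p => ∀ l ∈ ({p.1, p.2} : Finset (Fin d)), |thr a b (σ p) l| ≤ B))
    (fun p => {p.1, p.2}) (hinj.mono (Finset.coe_subset.2 (Finset.filter_subset _ _))) σ 2 le_rfl
    (fun p hp => Finset.card_pair (hs p (Finset.mem_filter.1 hp).1)) hβ
    (fun p hp => hdet p (Finset.mem_filter.1 hp).1) hB1
    (fun p hp => (Finset.mem_filter.1 hp).2)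
  have h2 : ∀ p ∈ s.filter (fun p => ¬ ∀ l ∈ ({p.1, p.2} : Finset (Fin d)), |thr a b (σ p) l| ≤ B),
      ∫ w, FJ κ a b {p.1, p.2} (σ p) w ∂μ ≤ exp 6 / β / d ^ 2 := by
    intro p hp
    obtain ⟨hps, hp⟩ := Finset.mem_filter.1 hp
    push Not at hp
    obtain ⟨l, hl, hlB⟩ := hp
    refine (far_bound hμ hC.psd hC.le2 hκ hab {p.1, p.2} (σ p)
      (Finset.card_pair (hs p hps)).le hβ (hdet p hps) l hl (by linarith)).trans ?_
    have e1 : exp (- (thr a b (σ p) l ^ 2 / 32)) ≤ 1 / d ^ 2 := by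
      have : (1:ℝ) / d ^ 2 = exp (- (2 * L)) := by
        rw [Real.exp_neg, two_mul, Real.exp_add, hLdef, Real.exp_log hd0, one_div, sq]
      rw [this, exp_le_exp]
      have := sq_abs (thr a b (σ p) l)
      nlinarith
    calc _ ≤ exp 6 * (1 / d ^ 2) / β := by gcongr
      _ = _ := by ring
  have h3 := Finset.sum_le_card_nsmul _ _ _ h2
  have h4 : ((s.filter (fun p => ¬ ∀ l ∈ ({p.1, p.2} : Finset (Fin d)), |thr a b (σ p) l| ≤ B)).card : ℝ)
      ≤ d ^ 2 := by
    have : (s.filter (fun p => ¬ ∀ l ∈ ({p.1, p.2} : Finset (Fin d)), |thr a b (σ p) l| ≤ B)).card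
      ≤ (Finset.univ : Finset (Fin d × Fin d)).card := Finset.card_le_card (Finset.subset_univ _)
    rw [Finset.card_univ, Fintype.card_prod, Fintype.card_fin] at this
    rw [sq]; exact_mod_cast this
  rw [nsmul_eq_mul] at h3
  have h5 : ((s.filter (fun p => ¬ ∀ l ∈ ({p.1, p.2} : Finset (Fin d)), |thr a b (σ p) l| ≤ B)).card : ℝ)
      * (exp 6 / β / d ^ 2) ≤ d ^ 2 * (exp 6 / β / d ^ 2) := by gcongr
  have h6 : (d:ℝ) ^ 2 * (exp 6 / β / d ^ 2) = exp 6 / β := by field_simp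
  have h7 : exp 6 / β ≤ exp 8 * L / β := by
    gcongr
    have : exp 6 ≤ exp 8 := by rw [exp_le_exp]; norm_num
    have := exp_pos 8
    nlinarith
  rw [hB2] at h1
  have h8 : exp 8 * (64 * L) / β + exp 8 * L / β = 65 * exp 8 * L / β := by ring
  linarith

lemma single_sum [IsProbabilityMeasure μ] (hd : 3 ≤ d) (hμ : IsG μ C) {β : ℝ} (hC : Good C β)
    {κ : ℝ → ℝ} (hκ : IsKer κ) {a b : Fin d → ℝ}
    (hab : ∀ l, a l < b l) (σ : Fin d → Fin d → Bool) :
    ∑ j, (|thr a b (σ j) j| + 1) * ∫ w, FJ κ a b {j} (σ j) w ∂μ ≤ 272 * exp 8 * Real.log d := by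
  have hL := one_le_log hd
  have hd0 : (0:ℝ) < d := by positivity
  set L := Real.log d with hLdef
  set B := 8 * √L with hBdef
  have hsq : √L ^ 2 = L := Real.sq_sqrt (by linarith)
  have hs1 : 1 ≤ √L := Real.one_le_sqrt.2 hL
  have hB1 : 1 ≤ B := by rw [hBdef]; linarith
  have hB8 : 8 ≤ B := by rw [hBdef]; linarith
  have hB2 : B ^ 2 = 64 * L := by rw [hBdef, mul_pow, hsq]; norm_num
  have hdet : ∀ j, 1 / 2 ≤ |(wmat C {j}).det| := fun j => by
    rw [det_wmat_one]
    exact (hC.diag j).trans (le_abs_self _)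
  have hT0 : ∀ j, 0 ≤ ∫ w, FJ κ a b {j} (σ j) w ∂μ :=
    fun j => integral_nonneg fun w => FJ_nonneg hκ a b _ _ w
  rw [← Finset.sum_filter_add_sum_filter_not Finset.univ (fun j => |thr a b (σ j) j| ≤ B)]
  have h1 := near_sum hμ hC.psd hC.le2 hκ hab
    (Finset.univ.filter (fun j => |thr a b (σ j) j| ≤ B))
    (fun j => {j}) (fun i _ j _ h => by simpa using h) σ 1 one_le_two
    (fun p hp => by simp) (D := 1 / 2) (by norm_num)
    (fun p hp => hdet p) hB1
    (fun p hp => by simpa using hp)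
  have h1' : ∑ j ∈ Finset.univ.filter (fun j => |thr a b (σ j) j| ≤ B),
      (|thr a b (σ j) j| + 1) * ∫ w, FJ κ a b {j} (σ j) w ∂μ
      ≤ (2 * B) * ∑ j ∈ Finset.univ.filter (fun j => |thr a b (σ j) j| ≤ B),
        ∫ w, FJ κ a b {j} (σ j) w ∂μ := by
    rw [Finset.mul_sum]
    refine Finset.sum_le_sum fun j hj => ?_
    have := (Finset.mem_filter.1 hj).2
    exact mul_le_mul_of_nonneg_right (by linarith) (hT0 j)
  have h1'' := h1'.trans (mul_le_mul_of_nonneg_left h1 (by linarith))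
  have h2 : ∀ j ∈ Finset.univ.filter (fun j => ¬ |thr a b (σ j) j| ≤ B),
      (|thr a b (σ j) j| + 1) * ∫ w, FJ κ a b {j} (σ j) w ∂μ ≤ 16 * exp 6 / d := by
    intro j hp
    have hp := (Finset.mem_filter.1 hp).2
    push Not at hp
    have e0 := far_bound hμ hC.psd hC.le2 hκ hab {j} (σ j)
      (by simp) (D := 1 / 2) (by norm_num) (hdet j) j (by simp) (by linarith)
    have hsqa := sq_abs (thr a b (σ j) j)
    set t := |thr a b (σ j) j| with ht
    rw [← hsqa] at e0
    have e1 : exp (- (t ^ 2 / 64)) ≤ 1 / d := by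
      have : (1:ℝ) / d = exp (- L) := by
        rw [Real.exp_neg, hLdef, Real.exp_log hd0, one_div]
      rw [this, exp_le_exp]
      nlinarith
    have e2 : t * exp (- (t ^ 2 / 64)) ≤ 4 := by
      rw [Real.exp_neg, ← div_eq_mul_inv, div_le_iff₀ (exp_pos _)]
      have := Real.add_one_le_exp (t ^ 2 / 64)
      nlinarith [sq_nonneg (t / 8 - 1)]
    have e3 : exp (- (t ^ 2 / 32)) = exp (- (t ^ 2 / 64)) * exp (- (t ^ 2 / 64)) := by
      rw [← Real.exp_add]; ring_nf
    calc _ ≤ (2 * t) * (exp 6 * exp (- (t ^ 2 / 32)) / (1 / 2)) := by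
          exact mul_le_mul (by linarith) e0 (hT0 j) (by linarith)
      _ = 4 * exp 6 * ((t * exp (- (t ^ 2 / 64))) * exp (- (t ^ 2 / 64))) := by rw [e3]; ring
      _ ≤ 4 * exp 6 * (4 * (1 / d)) := by gcongr
      _ = _ := by ring
  have h3 := Finset.sum_le_card_nsmul _ _ _ h2
  have h4 : ((Finset.univ.filter (fun j => ¬ |thr a b (σ j) j| ≤ B)).card : ℝ) ≤ d := by
    have : (Finset.univ.filter (fun j => ¬ |thr a b (σ j) j| ≤ B)).card
      ≤ (Finset.univ : Finset (Fin d)).card := Finset.card_le_card (Finset.subset_univ _)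
    rw [Finset.card_univ, Fintype.card_fin] at this
    exact_mod_cast this
  rw [nsmul_eq_mul] at h3
  have h5 : ((Finset.univ.filter (fun j => ¬ |thr a b (σ j) j| ≤ B)).card : ℝ)
      * (16 * exp 6 / d) ≤ d * (16 * exp 6 / d) := by gcongr
  have h6 : (d:ℝ) * (16 * exp 6 / d) = 16 * exp 6 := by field_simp
  have h7 : 16 * exp 6 ≤ 16 * exp 8 * L := by
    have : exp 6 ≤ exp 8 := by rw [exp_le_exp]; norm_num
    have := exp_pos 8
    nlinarith
  have h8 : 2 * B * (exp 8 * B ^ 1 / (1 / 2)) = 256 * exp 8 * L := by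
    calc _ = 4 * exp 8 * B ^ 2 := by ring
      _ = _ := by rw [hB2]; ring
  linarith
end GC

namespace GC
variable {d : ℕ} {μ : Measure (Fin d → ℝ)} {C : Matrix (Fin d) (Fin d) ℝ}

lemma IsG.integrable_coord [IsProbabilityMeasure μ] (hμ : IsG μ C) (i : Fin d) :
    Integrable (fun x => x i) μ := by
  have h1 := hμ.integrable_exp (Pi.single i 1)
  have h2 := hμ.integrable_exp (Pi.single i (-1))
  simp only [single_dotProduct, one_mul, neg_one_mul] at h1 h2
  refine (h1.add h2).mono' (continuous_apply i).aestronglyMeasurable ?_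
  filter_upwards with x
  simp only [Pi.add_apply, Real.norm_eq_abs]
  have e1 := Real.add_one_le_exp (x i)
  have e2 := Real.add_one_le_exp (-x i)
  have e3 := Real.exp_pos (x i)
  have e4 := Real.exp_pos (-x i)
  rw [abs_le]; constructor <;> linarith

lemma stein [IsProbabilityMeasure μ] (hμ : IsG μ C) (hC : C.PosSemidef) (i : Fin d)
    (F F' : (Fin d → ℝ) → ℝ) (M : ℝ) (hF : Continuous F) (hFb : ∀ x, |F x| ≤ M)
    (hF' : Continuous F') (hFb' : ∀ x, |F' x| ≤ M)
    (hder : ∀ x, ∀ s : ℝ, HasDerivAt (fun s : ℝ => F (x + s • C.mulVec (Pi.single i 1)))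
      (F' (x + s • C.mulVec (Pi.single i 1))) s) :
    ∫ x, x i * F x ∂μ = ∫ x, F' x ∂μ := by
  set y := C.mulVec (Pi.single i 1) with hy
  have hM0 : 0 ≤ M := le_trans (abs_nonneg _) (hFb 0)
  have hA : HasDerivAt (fun s : ℝ => ∫ x, F (x + s • y) ∂μ)
      (∫ x, F' (x + (0:ℝ) • y) ∂μ) 0 := by
    refine (hasDerivAt_integral_of_dominated_loc_of_deriv_le (bound := fun _ => M)
      (F := fun s x => F (x + s • y)) (F' := fun s x => F' (x + s • y))
      (s := Set.univ) Filter.univ_mem ?_ ?_ ?_ ?_ (integrable_const _) ?_).2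
    · filter_upwards with s
      exact (hF.comp (by fun_prop)).aestronglyMeasurable
    · refine Integrable.of_bound (C := M) (hF.comp (by fun_prop)).aestronglyMeasurable ?_
      filter_upwards with x using hFb _
    · exact (hF'.comp (by fun_prop)).aestronglyMeasurable
    · filter_upwards with x s _ using hFb' _
    · filter_upwards with x s _ using hder x s
  set q := C i i with hq
  have hq0 : 0 ≤ q := by
    have := quad_nonneg hC (Pi.single i 1)
    simpa [mulVec_single_one, single_dotProduct] using this
  have hsh : ∀ s : ℝ, ∫ x, F (x + s • y) ∂μ = ∫ x, exp (s * x i - s ^ 2 * q / 2) * F x ∂μ := by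
    intro s
    have h := hμ.integral_shift hC (s • Pi.single i 1) F hF.measurable
    have e1 : C.mulVec (s • Pi.single i 1) = s • y := by rw [mulVec_smul]
    have e2 : (s • Pi.single i (1:ℝ) : Fin d → ℝ) ⬝ᵥ (s • y) = s ^ 2 * q := by
      rw [smul_dotProduct, dotProduct_smul, hy, mulVec_single_one, single_dotProduct]
      simp [hq]; ring
    rw [e1] at h
    rw [h]
    refine integral_congr_ae ?_
    filter_upwards with x
    rw [e2, smul_dotProduct, single_dotProduct]
    simp
  have hB : HasDerivAt (fun s : ℝ => ∫ x, exp (s * x i - s ^ 2 * q / 2) * F x ∂μ)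
      (∫ x, exp (0 * x i - 0 ^ 2 * q / 2) * (x i - 0 * q) * F x ∂μ) 0 := by
    have h1 := hμ.integrable_exp (Pi.single i 2)
    have h2 := hμ.integrable_exp (Pi.single i (-2))
    simp only [single_dotProduct] at h1 h2
    have hbound : Integrable (fun x : Fin d → ℝ =>
        M * (1 + q) * (exp (2 * x i) + exp (-2 * x i) + 2)) μ :=
      ((h1.add h2).add (integrable_const _)).const_mul _
    have hE : ∀ t : ℝ, |t| ≤ exp t + exp (-t) ∧ exp |t| ≤ exp t + exp (-t) ∧ 2 ≤ exp t + exp (-t) := by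
      intro t
      have e1 := Real.add_one_le_exp t
      have e2 := Real.add_one_le_exp (-t)
      have e3 := Real.exp_pos t
      have e4 := Real.exp_pos (-t)
      refine ⟨by rw [abs_le]; constructor <;> linarith, ?_, by linarith⟩
      rcases abs_cases t with ⟨h, _⟩ | ⟨h, _⟩ <;> rw [h] <;> linarith
    have hexp : ∀ (s : ℝ) (t : ℝ), |s| ≤ 1 → exp (s * t - s ^ 2 * q / 2) ≤ exp t + exp (-t) := by
      intro s t hs
      refine le_trans (exp_le_exp.2 ?_) (hE t).2.1
      have : s * t ≤ |s| * |t| := by rw [← abs_mul]; exact le_abs_self _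
      have : |s| * |t| ≤ |t| := mul_le_of_le_one_left (abs_nonneg _) hs
      have : 0 ≤ s ^ 2 * q := by positivity
      linarith
    refine (hasDerivAt_integral_of_dominated_loc_of_deriv_le
      (bound := fun x => M * (1 + q) * (exp (2 * x i) + exp (-2 * x i) + 2))
      (F := fun s x => exp (s * x i - s ^ 2 * q / 2) * F x)
      (F' := fun s x => exp (s * x i - s ^ 2 * q / 2) * (x i - s * q) * F x)
      (s := Metric.ball 0 1) (Metric.ball_mem_nhds _ one_pos) ?_ ?_ ?_ ?_ hbound ?_).2
    · filter_upwards with s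
      exact Continuous.aestronglyMeasurable (by fun_prop)
    · simp only [zero_mul, ne_eq, OfNat.ofNat_ne_zero, not_false_eq_true, zero_pow, zero_div, sub_zero, exp_zero, one_mul]
      refine Integrable.of_bound (C := M) hF.aestronglyMeasurable ?_
      filter_upwards with x using hFb _
    · exact Continuous.aestronglyMeasurable (by fun_prop)
    · filter_upwards with x s hs
      have hs1 : |s| ≤ 1 := by
        rw [mem_ball_zero_iff, Real.norm_eq_abs] at hs; exact hs.le
      rw [Real.norm_eq_abs, abs_mul, abs_mul, abs_of_pos (exp_pos _)]
      obtain ⟨e1, e2, e3⟩ := hE (x i)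
      have e4 := hexp s (x i) hs1
      have e5 : |x i - s * q| ≤ (1 + q) * (exp (x i) + exp (-x i)) := by
        have : |x i - s * q| ≤ |x i| + |s| * |q| := by rw [← abs_mul]; exact abs_sub _ _
        rw [abs_of_nonneg hq0] at this
        have : |s| * q ≤ q := mul_le_of_le_one_left hq0 hs1
        nlinarith
      set E := exp (x i) + exp (-x i) with hEdef
      calc _ ≤ E * ((1 + q) * E) * M := by
            gcongr
            exact hFb x
        _ = M * (1 + q) * (E * E) := by ring
        _ = _ := by
          congr 1
          rw [hEdef, show 2 * x i = x i + x i by ring, show -2 * x i = -x i + -x i by ring, Real.exp_add, Real.exp_add]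
          have : exp (x i) * exp (- x i) = 1 := by rw [← Real.exp_add]; simp
          linear_combination 2 * this
    · filter_upwards with x s _
      have h : HasDerivAt (fun s : ℝ => s * x i - s ^ 2 * q / 2) (x i - s * q) s := by
        have := ((hasDerivAt_id s).mul_const (x i)).sub ((((hasDerivAt_id s).pow 2).mul_const q).div_const 2)
        refine HasDerivAt.congr_deriv (f := fun s : ℝ => s * x i - s ^ 2 * q / 2) this ?_
        simp; ring
      exact h.exp.mul_const _
  have hA' := hA
  rw [funext hsh] at hA'
  have := hB.unique hA'
  simp at this
  simpa using this

/-- product function -/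
def PG (G : Fin d → ℝ → ℝ) (x : Fin d → ℝ) : ℝ := ∏ l, G l (x l)

lemma PG_cont {G : Fin d → ℝ → ℝ} (hG : ∀ l, Continuous (G l)) : Continuous (PG G) := by
  unfold PG
  exact continuous_finsetProd _ fun l _ => (hG l).comp (continuous_apply l)

lemma PG_bdd {G : Fin d → ℝ → ℝ} {M : ℝ} (hG : ∀ l u, |G l u| ≤ M) (x : Fin d → ℝ) :
    |PG G x| ≤ M ^ d := by
  unfold PG
  rw [Finset.abs_prod]
  calc _ ≤ ∏ _l : Fin d, M := Finset.prod_le_prod (fun _ _ => abs_nonneg _) fun l _ => hG l _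
    _ = _ := by simp

lemma PG_deriv {G G' : Fin d → ℝ → ℝ} (hG : ∀ l u, HasDerivAt (G l) (G' l u) u)
    (z : ℝ → Fin d → ℝ) (z' : Fin d → ℝ) (s : ℝ) (hz : ∀ l, HasDerivAt (fun t => z t l) (z' l) s) :
    HasDerivAt (fun s => PG G (z s)) (∑ k, z' k * PG (Function.update G k (G' k)) (z s)) s := by
  unfold PG
  have h := HasDerivAt.fun_finsetProd (u := Finset.univ) (f := fun l t => G l (z t l)) (x := s)
    (f' := fun l => G' l (z s l) * z' l) (fun l _ => (hG l (z s l)).comp s (hz l))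
  refine h.congr_deriv (Eq.symm ?_)
  apply Finset.sum_congr rfl
  intro k _
  rw [← Finset.mul_prod_erase Finset.univ _ (Finset.mem_univ k), Function.update_self, smul_eq_mul]
  have : ∏ x ∈ Finset.univ.erase k, Function.update G k (G' k) x (z s x)
      = ∏ j ∈ Finset.univ.erase k, G j (z s j) :=
    Finset.prod_congr rfl fun l hl => by rw [Function.update_of_ne (Finset.ne_of_mem_erase hl)]
  rw [this]; ring

end GC

namespace GC
variable {d : ℕ} {μ : Measure (Fin d → ℝ)} {C : Matrix (Fin d) (Fin d) ℝ}

/-- twice differentiable families with bounds -/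
structure G3 (g g1 g2 : Fin d → ℝ → ℝ) (M : ℝ) : Prop where
  d1 : ∀ l u, HasDerivAt (g l) (g1 l u) u
  d2 : ∀ l u, HasDerivAt (g1 l) (g2 l u) u
  c2 : ∀ l, Continuous (g2 l)
  b0 : ∀ l u, |g l u| ≤ M
  b1 : ∀ l u, |g1 l u| ≤ M
  b2 : ∀ l u, |g2 l u| ≤ M

/-- first partial derivative -/
def D1 (g g1 : Fin d → ℝ → ℝ) (j : Fin d) : (Fin d → ℝ) → ℝ := PG (Function.update g j (g1 j))
/-- second partial derivative -/
def D2 (g g1 g2 : Fin d → ℝ → ℝ) (j k : Fin d) : (Fin d → ℝ) → ℝ :=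
  PG (Function.update (Function.update g j (g1 j)) k (Function.update g1 j (g2 j) k))

section
variable {g g1 g2 : Fin d → ℝ → ℝ} {M : ℝ}

lemma G3.c0 (h : G3 g g1 g2 M) (l) : Continuous (g l) :=
  continuous_iff_continuousAt.2 fun u => (h.d1 l u).continuousAt
lemma G3.c1 (h : G3 g g1 g2 M) (l) : Continuous (g1 l) :=
  continuous_iff_continuousAt.2 fun u => (h.d2 l u).continuousAt

lemma upd_all {P : (ℝ → ℝ) → Prop} {f : Fin d → ℝ → ℝ} {j : Fin d} {e : ℝ → ℝ}
    (hf : ∀ l, P (f l)) (he : P e) (l : Fin d) : P (Function.update f j e l) := by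
  by_cases hl : l = j
  · subst hl; simpa using he
  · simpa [hl] using hf l

lemma G3.D1_cont (h : G3 g g1 g2 M) (j) : Continuous (D1 g g1 j) :=
  PG_cont (upd_all (P := fun f => Continuous f) h.c0 (h.c1 j))
lemma G3.D1_bdd (h : G3 g g1 g2 M) (j) (x) : |D1 g g1 j x| ≤ M ^ d :=
  PG_bdd (upd_all (P := fun f => ∀ u, |f u| ≤ M) h.b0 (h.b1 j)) x
lemma G3.D2_cont (h : G3 g g1 g2 M) (j k) : Continuous (D2 g g1 g2 j k) :=
  PG_cont (upd_all (P := fun f => Continuous f) (upd_all (P := fun f => Continuous f) h.c0 (h.c1 j))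
    (upd_all (P := fun f => Continuous f) h.c1 (h.c2 j) k))
lemma G3.D2_bdd (h : G3 g g1 g2 M) (j k) (x) : |D2 g g1 g2 j k x| ≤ M ^ d :=
  PG_bdd (upd_all (P := fun f => ∀ u, |f u| ≤ M) (upd_all (P := fun f => ∀ u, |f u| ≤ M) h.b0 (h.b1 j))
    (upd_all (P := fun f => ∀ u, |f u| ≤ M) h.b1 (h.b2 j) k)) x

lemma G3.D2_integrable (h : G3 g g1 g2 M) [IsProbabilityMeasure μ] (j k) :
    Integrable (D2 g g1 g2 j k) μ :=
  Integrable.of_bound (C := M ^ d) (h.D2_cont j k).aestronglyMeasurable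
    (by filter_upwards with x using h.D2_bdd j k x)

lemma G3.D1_deriv (h : G3 g g1 g2 M) (j : Fin d) (z : ℝ → Fin d → ℝ) (z' : Fin d → ℝ) (s : ℝ)
    (hz : ∀ l, HasDerivAt (fun t => z t l) (z' l) s) :
    HasDerivAt (fun s => D1 g g1 j (z s)) (∑ k, z' k * D2 g g1 g2 j k (z s)) s := by
  refine PG_deriv (G := Function.update g j (g1 j)) (G' := Function.update g1 j (g2 j)) ?_ z z' s hz
  intro l u
  by_cases hl : l = j
  · subst hl; simpa using h.d2 l u
  · simpa [hl] using h.d1 l u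

lemma G3.stein_D1 (h : G3 g g1 g2 M) [IsProbabilityMeasure μ] (hμ : IsG μ C) (hC : C.PosSemidef)
    (u : ℝ) (z : Fin d → ℝ) (j : Fin d) :
    ∫ x, x j * D1 g g1 j (u • x + z) ∂μ
      = u * ∑ k, C k j * ∫ x, D2 g g1 g2 j k (u • x + z) ∂μ := by
  have hM0 : 0 ≤ M := le_trans (abs_nonneg _) (h.b0 j 0)
  have hy : ∀ k, C.mulVec (Pi.single j 1) k = C k j := by
    intro k; rw [mulVec_single_one]; rfl
  rw [stein hμ hC j (fun x => D1 g g1 j (u • x + z))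
    (fun x => ∑ k, (u * C k j) * D2 g g1 g2 j k (u • x + z))
    (M ^ d + ∑ k, |u * C k j| * M ^ d)
    ((h.D1_cont j).comp (by fun_prop))
    (fun x => (h.D1_bdd j _).trans (le_add_of_nonneg_right (by positivity)))
    (continuous_finsetSum _ fun k _ => ((h.D2_cont j k).comp (by fun_prop)).const_mul _)
    (fun x => by
      refine le_trans (Finset.abs_sum_le_sum_abs _ _) (le_trans ?_ (le_add_of_nonneg_left (by positivity)))
      refine Finset.sum_le_sum fun k _ => ?_
      rw [abs_mul]
      gcongr
      exact h.D2_bdd j k _)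
    (fun x s => by
      refine h.D1_deriv j (fun s => u • (x + s • C.mulVec (Pi.single j 1)) + z)
        (fun k => u * C k j) s fun l => ?_
      simp only [Pi.add_apply, Pi.smul_apply, smul_eq_mul, hy]
      have := ((((hasDerivAt_id s).mul_const (C l j)).const_add (x l)).const_mul u).add_const (z l)
      rw [one_mul] at this
      exact this)]
  rw [integral_finsetSum, Finset.mul_sum]
  · refine Finset.sum_congr rfl fun k _ => ?_
    rw [integral_const_mul]; ring
  · intro k _
    refine Integrable.const_mul ?_ _
    exact Integrable.of_bound (C := M ^ d) ((h.D2_cont j k).comp (by fun_prop)).aestronglyMeasurable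
      (by filter_upwards with x using h.D2_bdd j k _)
end

section
variable {κ : ℝ → ℝ} {a b : Fin d → ℝ}

/-- first derivative of the smoothed indicator -/
def gs1 (κ : ℝ → ℝ) (a b : Fin d → ℝ) (l : Fin d) (u : ℝ) : ℝ := κ (a l - u) - κ (b l - u)

lemma gs1_abs (hκ : IsKer κ) (l : Fin d) (u : ℝ) (τ : Bool → Fin d → Bool) (hτ : ∀ e, τ e l = e) :
    |gs1 κ a b l u| ≤ ∑ e : Bool, κ (thr a b (τ e) l - u) := by
  have h1 := hκ.nonneg (a l - u)
  have h2 := hκ.nonneg (b l - u)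
  simp only [Fintype.sum_bool, thr, hτ, gs1]
  simp only [if_true, Bool.false_eq_true, if_false]
  rw [abs_le]; constructor <;> linarith

lemma D1_abs (hκ : IsKer κ) (j : Fin d) (w : Fin d → ℝ) :
    |D1 (fun l => gs κ (a l) (b l)) (gs1 κ a b) j w| ≤ ∑ e : Bool, FJ κ a b {j} (fun _ => e) w := by
  set P := ∏ l ∈ Finset.univ.erase j, gs κ (a l) (b l) (w l) with hP
  have hP0 : 0 ≤ P := Finset.prod_nonneg fun l _ => gs_nonneg hκ _ _ _
  have e1 : D1 (fun l => gs κ (a l) (b l)) (gs1 κ a b) j w = gs1 κ a b j (w j) * P := by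
    unfold D1 PG
    rw [← Finset.mul_prod_erase _ _ (Finset.mem_univ j), Function.update_self]
    congr 1
    exact Finset.prod_congr rfl fun l hl => by rw [Function.update_of_ne (Finset.ne_of_mem_erase hl)]
  have e2 : ∀ e : Bool, FJ κ a b {j} (fun _ => e) w = κ (thr a b (fun _ => e) j - w j) * P := by
    intro e
    unfold FJ
    rw [← Finset.mul_prod_erase _ _ (Finset.mem_univ j)]
    congr 1
    · simp [Gf]
    · exact Finset.prod_congr rfl fun l hl => by simp [Gf, Finset.ne_of_mem_erase hl]
  simp_rw [e1, e2]
  rw [← Finset.sum_mul, abs_mul, abs_of_nonneg hP0]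
  gcongr
  exact gs1_abs hκ j (w j) (fun e _ => e) (fun _ => rfl)

/-- side pattern -/
def pat (j : Fin d) (e e' : Bool) : Fin d → Bool := fun l => if l = j then e else e'

lemma D2_abs (hκ : IsKer κ) (g2 : Fin d → ℝ → ℝ) {j k : Fin d} (hjk : j ≠ k) (w : Fin d → ℝ) :
    |D2 (fun l => gs κ (a l) (b l)) (gs1 κ a b) g2 j k w|
      ≤ ∑ e : Bool, ∑ e' : Bool, FJ κ a b {j, k} (pat j e e') w := by
  set P := ∏ l ∈ (Finset.univ.erase j).erase k, gs κ (a l) (b l) (w l) with hP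
  have hP0 : 0 ≤ P := Finset.prod_nonneg fun l _ => gs_nonneg hκ _ _ _
  have hk : k ∈ Finset.univ.erase j := by simp [hjk.symm]
  have e1 : D2 (fun l => gs κ (a l) (b l)) (gs1 κ a b) g2 j k w
      = gs1 κ a b j (w j) * (gs1 κ a b k (w k) * P) := by
    unfold D2 PG
    rw [← Finset.mul_prod_erase _ _ (Finset.mem_univ j), ← Finset.mul_prod_erase _ _ hk]
    congr 1
    · simp [hjk]
    congr 1
    · simp [hjk.symm]
    refine Finset.prod_congr rfl fun l hl => ?_
    have h1 := Finset.ne_of_mem_erase hl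
    have h2 := Finset.ne_of_mem_erase (Finset.mem_of_mem_erase hl)
    simp [h1, h2]
  have e2 : ∀ e e' : Bool, FJ κ a b {j, k} (pat j e e') w
      = κ (thr a b (fun _ => e) j - w j) * (κ (thr a b (fun _ => e') k - w k) * P) := by
    intro e e'
    unfold FJ
    rw [← Finset.mul_prod_erase _ _ (Finset.mem_univ j), ← Finset.mul_prod_erase _ _ hk]
    congr 1
    · simp [Gf, thr, pat]
    congr 1
    · simp [Gf, thr, pat, hjk.symm]
    refine Finset.prod_congr rfl fun l hl => ?_
    have h1 := Finset.ne_of_mem_erase hl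
    have h2 := Finset.ne_of_mem_erase (Finset.mem_of_mem_erase hl)
    simp [Gf, h1, h2]
  simp_rw [e1, e2, ← Finset.mul_sum, ← Finset.sum_mul]
  rw [abs_mul, abs_mul, abs_of_nonneg hP0]
  have h1 := gs1_abs (a := a) (b := b) hκ j (w j) (fun e _ => e) (fun _ => rfl)
  have h2 := gs1_abs (a := a) (b := b) hκ k (w k) (fun e _ => e) (fun _ => rfl)
  gcongr
  exact le_trans (abs_nonneg _) h1

lemma off_sum [IsProbabilityMeasure μ] (hd : 3 ≤ d) (hμ : IsG μ C) {β : ℝ} (hC : Good C β)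
    (hκ : IsKer κ) (hab : ∀ l, a l < b l) {g2 : Fin d → ℝ → ℝ} {M : ℝ}
    (h3 : G3 (fun l => gs κ (a l) (b l)) (gs1 κ a b) g2 M) :
    ∑ p : Fin d × Fin d with p.1 ≠ p.2,
      |∫ w, D2 (fun l => gs κ (a l) (b l)) (gs1 κ a b) g2 p.1 p.2 w ∂μ|
      ≤ 520 * exp 8 * Real.log d / β := by
  have h1 : ∀ p ∈ Finset.univ.filter (fun p : Fin d × Fin d => p.1 ≠ p.2),
      |∫ w, D2 (fun l => gs κ (a l) (b l)) (gs1 κ a b) g2 p.1 p.2 w ∂μ|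
      ≤ ∑ e : Bool, ∑ e' : Bool, ∫ w, FJ κ a b {p.1, p.2} (pat p.1 e e') w ∂μ := by
    intro p hp
    have hp := (Finset.mem_filter.1 hp).2
    have hi : ∀ e e', Integrable (FJ κ a b {p.1, p.2} (pat p.1 e e')) μ := fun e e' =>
      FJ_integrable hκ hab _ _
    have e1 : ∑ e : Bool, ∑ e' : Bool, ∫ w, FJ κ a b {p.1, p.2} (pat p.1 e e') w ∂μ
        = ∫ w, ∑ e : Bool, ∑ e' : Bool, FJ κ a b {p.1, p.2} (pat p.1 e e') w ∂μ := by
      rw [integral_finsetSum _ fun e _ => integrable_finsetSum _ fun e' _ => hi e e']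
      refine Finset.sum_congr rfl fun e _ => ?_
      rw [integral_finsetSum _ fun e' _ => hi e e']
    rw [e1]
    refine abs_integral_le_integral_abs.trans ?_
    refine integral_mono (h3.D2_integrable _ _).abs
      (integrable_finsetSum _ fun e _ => integrable_finsetSum _ fun e' _ => hi e e') fun w => ?_
    exact D2_abs hκ g2 hp w
  refine (Finset.sum_le_sum h1).trans ?_
  rw [Finset.sum_comm]
  have hcomm : ∀ e : Bool, ∑ p : Fin d × Fin d with p.1 ≠ p.2,
      ∑ e' : Bool, ∫ w, FJ κ a b {p.1, p.2} (pat p.1 e e') w ∂μ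
      = ∑ e' : Bool, ∑ p : Fin d × Fin d with p.1 ≠ p.2,
        ∫ w, FJ κ a b {p.1, p.2} (pat p.1 e e') w ∂μ := fun e => Finset.sum_comm
  rw [Finset.sum_congr rfl fun e _ => hcomm e]
  have h2 : ∀ e e' : Bool, ∑ p : Fin d × Fin d with p.1 ≠ p.2,
      ∫ w, FJ κ a b {p.1, p.2} (pat p.1 e e') w ∂μ ≤ 130 * exp 8 * Real.log d / β := by
    intro e e'
    have hsplit : Finset.univ.filter (fun p : Fin d × Fin d => p.1 ≠ p.2)
        = Finset.univ.filter (fun p : Fin d × Fin d => p.1 < p.2)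
          ∪ Finset.univ.filter (fun p : Fin d × Fin d => p.2 < p.1) := by
      ext p; simp [lt_or_lt_iff_ne]
    have hdisj : Disjoint (Finset.univ.filter (fun p : Fin d × Fin d => p.1 < p.2))
        (Finset.univ.filter (fun p : Fin d × Fin d => p.2 < p.1)) := by
      rw [Finset.disjoint_filter]
      intro p _ h; exact h.asymm
    rw [hsplit, Finset.sum_union hdisj]
    have q1 := pair_sum hd hμ hC hκ hab (Finset.univ.filter (fun p : Fin d × Fin d => p.1 < p.2))
      (fun p hp => (Finset.mem_filter.1 hp).2.ne)
      (fun p hp q hq h => by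
        simp at hp hq
        simp only at h
        have i1 : p.1 ∈ ({q.1, q.2} : Finset (Fin d)) := h ▸ (by simp)
        have i2 : p.2 ∈ ({q.1, q.2} : Finset (Fin d)) := h ▸ (by simp)
        simp at i1 i2
        ext <;> rcases i1 with i1 | i1 <;> rcases i2 with i2 | i2 <;> omega) (fun p => pat p.1 e e')
    have q2 := pair_sum hd hμ hC hκ hab (Finset.univ.filter (fun p : Fin d × Fin d => p.2 < p.1))
      (fun p hp => (Finset.mem_filter.1 hp).2.ne')
      (fun p hp q hq h => by
        simp at hp hq
        simp only at h
        have i1 : p.1 ∈ ({q.1, q.2} : Finset (Fin d)) := h ▸ (by simp)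
        have i2 : p.2 ∈ ({q.1, q.2} : Finset (Fin d)) := h ▸ (by simp)
        simp at i1 i2
        ext <;> rcases i1 with i1 | i1 <;> rcases i2 with i2 | i2 <;> omega) (fun p => pat p.1 e e')
    have : 130 * exp 8 * Real.log d / β = 65 * exp 8 * Real.log d / β + 65 * exp 8 * Real.log d / β := by
      ring
    linarith
  have h4 := Finset.sum_le_sum fun e (_ : e ∈ (Finset.univ : Finset Bool)) =>
    Finset.sum_le_sum fun e' (_ : e' ∈ (Finset.univ : Finset Bool)) => h2 e e'
  refine h4.trans (le_of_eq ?_)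
  simp; ring

lemma ord1_sum [IsProbabilityMeasure μ] (hd : 3 ≤ d) (hμ : IsG μ C) {β : ℝ} (hC : Good C β)
    (hκ : IsKer κ) (hab : ∀ l, a l < b l) {g2 : Fin d → ℝ → ℝ} {M : ℝ}
    (h3 : G3 (fun l => gs κ (a l) (b l)) (gs1 κ a b) g2 M) :
    ∑ j, |∫ w, w j * D1 (fun l => gs κ (a l) (b l)) (gs1 κ a b) j w ∂μ|
      ≤ 544 * exp 8 * Real.log d := by
  have h1 : ∀ j : Fin d, |∫ w, w j * D1 (fun l => gs κ (a l) (b l)) (gs1 κ a b) j w ∂μ|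
      ≤ ∑ e : Bool, (|thr a b (fun _ => e) j| + 1) * ∫ w, FJ κ a b {j} (fun _ => e) w ∂μ := by
    intro j
    have hi : ∀ e : Bool, Integrable (fun w => (|thr a b (fun _ => e) j| + 1) * FJ κ a b {j} (fun _ => e) w) μ :=
      fun e => (FJ_integrable hκ hab _ _).const_mul _
    have e1 : ∑ e : Bool, (|thr a b (fun _ => e) j| + 1) * ∫ w, FJ κ a b {j} (fun _ => e) w ∂μ
        = ∫ w, ∑ e : Bool, (|thr a b (fun _ => e) j| + 1) * FJ κ a b {j} (fun _ => e) w ∂μ := by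
      rw [integral_finsetSum _ fun e _ => hi e]
      exact Finset.sum_congr rfl fun e _ => (integral_const_mul _ _).symm
    rw [e1]
    refine abs_integral_le_integral_abs.trans ?_
    refine integral_mono_of_nonneg (by filter_upwards with w using abs_nonneg _)
      (integrable_finsetSum _ fun e _ => hi e) ?_
    filter_upwards with w
    rw [abs_mul]
    calc _ ≤ |w j| * ∑ e : Bool, FJ κ a b {j} (fun _ => e) w := by
          gcongr; exact D1_abs hκ j w
      _ = ∑ e : Bool, |w j| * FJ κ a b {j} (fun _ => e) w := Finset.mul_sum _ _ _
      _ ≤ _ := by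
        refine Finset.sum_le_sum fun e _ => ?_
        by_cases h0 : κ (thr a b (fun _ => e) j - w j) = 0
        · have : FJ κ a b {j} (fun _ => e) w = 0 :=
            Finset.prod_eq_zero (Finset.mem_univ j) (by simp [Gf, h0])
          simp [this]
        · have := hκ.supp _ h0
          refine mul_le_mul_of_nonneg_right ?_ (FJ_nonneg hκ _ _ _ _ _)
          have h5 := abs_sub_abs_le_abs_sub (w j) (thr a b (fun _ => e) j)
          rw [abs_sub_comm] at h5
          linarith
  refine (Finset.sum_le_sum fun j _ => h1 j).trans ?_
  rw [Finset.sum_comm, Fintype.sum_bool]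
  have q1 := single_sum hd hμ hC hκ hab (fun _ _ => true)
  have q2 := single_sum hd hμ hC hκ hab (fun _ _ => false)
  linarith

lemma total_sum [IsProbabilityMeasure μ] (hd : 3 ≤ d) (hμ : IsG μ C) {β : ℝ} (hC : Good C β)
    (hβ : β ≤ 1) (hκ : IsKer κ) (hab : ∀ l, a l < b l) {g2 : Fin d → ℝ → ℝ} {M : ℝ}
    (h3 : G3 (fun l => gs κ (a l) (b l)) (gs1 κ a b) g2 M) :
    ∑ j, ∑ k, |∫ w, D2 (fun l => gs κ (a l) (b l)) (gs1 κ a b) g2 j k w ∂μ|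
      ≤ 3688 * exp 8 * Real.log d / β := by
  have o1 := off_sum hd hμ hC hκ hab h3
  have o2 := ord1_sum hd hμ hC hκ hab h3
  set E : Fin d → Fin d → ℝ :=
    fun j k => ∫ w, D2 (fun l => gs κ (a l) (b l)) (gs1 κ a b) g2 j k w ∂μ with hE
  set T : Fin d → ℝ := fun j => ∫ w, w j * D1 (fun l => gs κ (a l) (b l)) (gs1 κ a b) j w ∂μ with hT
  have hsplit : ∑ p : Fin d × Fin d with p.1 ≠ p.2, |E p.1 p.2|
      = ∑ j, ∑ k ∈ Finset.univ.erase j, |E j k| := by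
    rw [Finset.sum_filter, ← Finset.univ_product_univ, Finset.sum_product]
    refine Finset.sum_congr rfl fun j _ => ?_
    rw [← Finset.sum_filter]
    refine Finset.sum_congr ?_ fun _ _ => rfl
    ext k; simp [eq_comm]
  have o1' : ∑ j, ∑ k ∈ Finset.univ.erase j, |E j k| ≤ 520 * exp 8 * Real.log d / β := by
    rw [← hsplit]; exact o1
  have st : ∀ j, T j = ∑ k, C k j * E j k := by
    intro j
    have := h3.stein_D1 hμ hC.psd 1 0 j
    simpa using this
  have hdiag : ∀ j, |E j j| ≤ 2 * |T j| + 4 * ∑ k ∈ Finset.univ.erase j, |E j k| := by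
    intro j
    have h1 := st j
    rw [← Finset.add_sum_erase _ _ (Finset.mem_univ j)] at h1
    have h2 : |∑ k ∈ Finset.univ.erase j, C k j * E j k| ≤ 2 * ∑ k ∈ Finset.univ.erase j, |E j k| := by
      refine (Finset.abs_sum_le_sum_abs _ _).trans ?_
      rw [Finset.mul_sum]
      refine Finset.sum_le_sum fun k _ => ?_
      rw [abs_mul]
      gcongr
      exact hC.le2 k j
    have h4 : |C j j * E j j| ≤ |T j| + |∑ k ∈ Finset.univ.erase j, C k j * E j k| := by
      have : C j j * E j j = T j - ∑ k ∈ Finset.univ.erase j, C k j * E j k := by linarith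
      rw [this]; exact abs_sub _ _
    have h5 := hC.diag j
    rw [abs_mul, abs_of_nonneg (by linarith)] at h4
    have h6 := abs_nonneg (E j j)
    nlinarith
  have hfin : ∑ j, ∑ k, |E j k| ≤ ∑ j, (2 * |T j| + 5 * ∑ k ∈ Finset.univ.erase j, |E j k|) := by
    refine Finset.sum_le_sum fun j _ => ?_
    rw [← Finset.add_sum_erase _ _ (Finset.mem_univ j)]
    linarith [hdiag j]
  rw [Finset.sum_add_distrib, ← Finset.mul_sum, ← Finset.mul_sum] at hfin
  refine hfin.trans ?_
  have hL := one_le_log hd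
  have h7 : exp 8 * Real.log d ≤ exp 8 * Real.log d / β := by
    rw [le_div_iff₀ hC.pos]
    have : 0 ≤ exp 8 * Real.log d := by positivity
    nlinarith
  have h8 : 3688 * exp 8 * Real.log d / β = 3688 * (exp 8 * Real.log d / β) := by ring
  have h9 : 520 * exp 8 * Real.log d / β = 520 * (exp 8 * Real.log d / β) := by ring
  rw [h8]
  rw [h9] at o1'
  linarith
end
end GC

namespace GC
variable {d : ℕ} {μ1 μ2 : Measure (Fin d → ℝ)} {S1 S : Matrix (Fin d) (Fin d) ℝ}
variable {g g1 g2 : Fin d → ℝ → ℝ} {M : ℝ}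

lemma good_mix (hS1 : S1.PosSemidef) (hS : S.PosSemidef) {α : ℝ} (hα : 0 < α) (hα1 : α ≤ 1)
    (hdiag : ∀ j, S j j = 1)
    (hoff : ∀ j k, j ≠ k → α ^ 2 ≤ 1 - S j k ^ 2) {Δ : ℝ} (hΔ : ∀ j k, |S1 j k - S j k| ≤ Δ)
    (hΔα : Δ ≤ α ^ 2 / 8) (u v : ℝ) (huv : u ^ 2 + v ^ 2 = 1) :
    Good (u ^ 2 • S1 + v ^ 2 • S) (α ^ 2 / 2) := by
  have hpsd : (u ^ 2 • S1 + v ^ 2 • S).PosSemidef :=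
    (hS1.smul (sq_nonneg u)).add (hS.smul (sq_nonneg v))
  have hα2 : α ^ 2 ≤ 1 := by nlinarith
  have hSle : ∀ j k, |S j k| ≤ 1 := by
    intro j k
    by_cases h : j = k
    · subst h; rw [hdiag]; simp
    · have := hoff j k h
      rw [abs_le]; constructor <;> nlinarith [sq_nonneg α]
  have hdist : ∀ j k, |(u ^ 2 • S1 + v ^ 2 • S) j k - S j k| ≤ Δ := by
    intro j k
    have e : (u ^ 2 • S1 + v ^ 2 • S) j k - S j k = u ^ 2 * (S1 j k - S j k) := by
      simp only [Matrix.add_apply, Matrix.smul_apply, smul_eq_mul]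
      rw [show v ^ 2 = 1 - u ^ 2 by linarith]; ring
    rw [e, abs_mul, abs_of_nonneg (sq_nonneg u)]
    have h1 : u ^ 2 ≤ 1 := by nlinarith [sq_nonneg v]
    exact (mul_le_of_le_one_left (abs_nonneg _) h1).trans (hΔ j k)
  set C := u ^ 2 • S1 + v ^ 2 • S with hC
  refine ⟨hpsd, ?_, ?_, by positivity, ?_⟩
  · intro j k
    have h1 := hdist j k
    have h2 := hSle j k
    rw [abs_le] at *
    constructor <;> linarith [h1.1, h1.2, h2.1, h2.2]
  · intro j
    have h1 := hdist j j
    rw [hdiag, abs_le] at h1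
    linarith [h1.1]
  · intro j k hjk
    have hsym : C k j = C j k := by
      have := hpsd.isHermitian.apply j k
      simpa using this
    rw [hsym]
    have h1 := hdist j j
    have h2 := hdist k k
    rw [hdiag, abs_le] at h1 h2
    have h3 := hdist j k
    have hD0 : 0 ≤ Δ := le_trans (abs_nonneg _) h3
    have h4 := hSle j k
    have h5 := hoff j k hjk
    have h6 : |C j k| ≤ |S j k| + Δ := by
      have := abs_sub_abs_le_abs_sub (C j k) (S j k)
      linarith
    have h7 : C j k * C j k ≤ (|S j k| + Δ) ^ 2 := by
      rw [← sq, ← sq_abs]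
      exact pow_le_pow_left₀ (abs_nonneg _) h6 2
    have h8 : (1 - Δ) * (1 - Δ) ≤ C j j * C k k :=
      mul_le_mul (by linarith [h1.1]) (by linarith [h2.1]) (by linarith) (by linarith [h1.1])
    have h9 := sq_abs (S j k)
    nlinarith [mul_nonneg hD0 (sub_nonneg.2 h4)]

section
variable [IsProbabilityMeasure μ1] [IsProbabilityMeasure μ2]

lemma int_coord_D1 (h3 : G3 g g1 g2 M) (j : Fin d) {z : (Fin d → ℝ) × (Fin d → ℝ) → ℝ}
    (hz : Integrable z (μ1.prod μ2)) (u v : ℝ) :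
    Integrable (fun p => z p * D1 g g1 j (u • p.1 + v • p.2)) (μ1.prod μ2) := by
  refine hz.mul_bdd (c := M ^ d) ?_ ?_
  · exact ((h3.D1_cont j).comp (by fun_prop)).aestronglyMeasurable
  · filter_upwards with p using h3.D1_bdd j _

lemma int_D2 (h3 : G3 g g1 g2 M) (j k : Fin d) (u v : ℝ) :
    Integrable (fun p => D2 g g1 g2 j k (u • p.1 + v • p.2)) (μ1.prod μ2) :=
  Integrable.of_bound (C := M ^ d) ((h3.D2_cont j k).comp (by fun_prop)).aestronglyMeasurable
    (by filter_upwards with x using h3.D2_bdd j k _)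

lemma stein_fst (h3 : G3 g g1 g2 M) (hμ1 : IsG μ1 S1) (hS1 : S1.PosSemidef) (j : Fin d) (u v : ℝ) :
    ∫ p, p.1 j * D1 g g1 j (u • p.1 + v • p.2) ∂(μ1.prod μ2)
      = u * ∑ k, S1 k j * ∫ p, D2 g g1 g2 j k (u • p.1 + v • p.2) ∂(μ1.prod μ2) := by
  rw [integral_prod_symm _ (int_coord_D1 h3 j ((hμ1.integrable_coord j).comp_fst μ2) u v)]
  simp_rw [h3.stein_D1 hμ1 hS1]
  rw [integral_const_mul, integral_finsetSum]
  · congr 1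
    refine Finset.sum_congr rfl fun k _ => ?_
    rw [integral_const_mul, integral_prod_symm _ (int_D2 h3 j k u v)]
  · intro k _
    exact ((int_D2 h3 j k u v).integral_prod_right).const_mul _

lemma stein_snd (h3 : G3 g g1 g2 M) (hμ2 : IsG μ2 S) (hS : S.PosSemidef) (j : Fin d) (u v : ℝ) :
    ∫ p, p.2 j * D1 g g1 j (u • p.1 + v • p.2) ∂(μ1.prod μ2)
      = v * ∑ k, S k j * ∫ p, D2 g g1 g2 j k (u • p.1 + v • p.2) ∂(μ1.prod μ2) := by
  rw [integral_prod _ (int_coord_D1 h3 j ((hμ2.integrable_coord j).comp_snd μ1) u v)]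
  have hc : ∀ x y : Fin d → ℝ, u • x + v • y = v • y + u • x := fun x y => add_comm _ _
  have hi : ∀ k, ∫ p, D2 g g1 g2 j k (u • p.1 + v • p.2) ∂(μ1.prod μ2)
      = ∫ x, ∫ y, D2 g g1 g2 j k (v • y + u • x) ∂μ2 ∂μ1 := by
    intro k
    rw [integral_prod _ (int_D2 h3 j k u v)]
    simp only [hc]
  simp only [hi]
  simp only [hc]
  simp_rw [h3.stein_D1 hμ2 hS]
  rw [integral_const_mul, integral_finsetSum]
  · congr 1
    refine Finset.sum_congr rfl fun k _ => ?_
    rw [integral_const_mul]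
  · intro k _
    have h4 := ((int_D2 (μ1 := μ1) (μ2 := μ2) h3 j k u v).integral_prod_left).const_mul (S k j)
    simp only [hc] at h4
    exact h4

lemma interp_deriv (h3 : G3 g g1 g2 M) (hμ1 : IsG μ1 S1) (hμ2 : IsG μ2 S)
    (hS1 : S1.PosSemidef) (hS : S.PosSemidef) (θ : ℝ) :
    HasDerivAt (fun θ => ∫ p, PG g (sin θ • p.1 + cos θ • p.2) ∂(μ1.prod μ2))
      (sin θ * cos θ * ∑ j, ∑ k, (S1 k j - S k j) *
        ∫ p, D2 g g1 g2 j k (sin θ • p.1 + cos θ • p.2) ∂(μ1.prod μ2)) θ := by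
  have i1 : ∀ j, Integrable (fun p : (Fin d → ℝ) × (Fin d → ℝ) => p.1 j) (μ1.prod μ2) :=
    fun j => (hμ1.integrable_coord j).comp_fst μ2
  have i2 : ∀ j, Integrable (fun p : (Fin d → ℝ) × (Fin d → ℝ) => p.2 j) (μ1.prod μ2) :=
    fun j => (hμ2.integrable_coord j).comp_snd μ1
  have hM0 : ∀ _j : Fin d, 0 ≤ M := fun j => le_trans (abs_nonneg _) (h3.b0 j 0)
  have hA : HasDerivAt (fun θ => ∫ p, PG g (sin θ • p.1 + cos θ • p.2) ∂(μ1.prod μ2))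
      (∫ p, ∑ j, (cos θ * p.1 j - sin θ * p.2 j) * D1 g g1 j (sin θ • p.1 + cos θ • p.2)
        ∂(μ1.prod μ2)) θ := by
    have hbound : Integrable (fun p : (Fin d → ℝ) × (Fin d → ℝ) =>
        ∑ j, (|p.1 j| + |p.2 j|) * M ^ d) (μ1.prod μ2) :=
      integrable_finsetSum _ fun j _ => ((i1 j).abs.add (i2 j).abs).mul_const _
    refine (hasDerivAt_integral_of_dominated_loc_of_deriv_le
      (bound := fun p => ∑ j, (|p.1 j| + |p.2 j|) * M ^ d)
      (F := fun θ (p : (Fin d → ℝ) × (Fin d → ℝ)) => PG g (sin θ • p.1 + cos θ • p.2))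
      (F' := fun θ (p : (Fin d → ℝ) × (Fin d → ℝ)) => ∑ j, (cos θ * p.1 j - sin θ * p.2 j) *
        D1 g g1 j (sin θ • p.1 + cos θ • p.2))
      (s := Set.univ) Filter.univ_mem ?_ ?_ ?_ ?_ hbound ?_).2
    · filter_upwards with s
      exact ((PG_cont h3.c0).comp (by fun_prop)).aestronglyMeasurable
    · refine Integrable.of_bound (C := M ^ d) ((PG_cont h3.c0).comp (by fun_prop)).aestronglyMeasurable ?_
      filter_upwards with x using PG_bdd h3.b0 _
    · refine Continuous.aestronglyMeasurable ?_
      refine continuous_finsetSum _ fun j _ => Continuous.mul (by fun_prop) ?_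
      exact (h3.D1_cont j).comp (by fun_prop)
    · filter_upwards with p s _
      refine (norm_sum_le _ _).trans (Finset.sum_le_sum fun j _ => ?_)
      rw [Real.norm_eq_abs, abs_mul]
      have e1 : |cos s * p.1 j - sin s * p.2 j| ≤ |p.1 j| + |p.2 j| := by
        refine (abs_sub _ _).trans ?_
        rw [abs_mul, abs_mul]
        exact add_le_add (mul_le_of_le_one_left (abs_nonneg _) (abs_cos_le_one s))
          (mul_le_of_le_one_left (abs_nonneg _) (abs_sin_le_one s))
      have := hM0 j
      gcongr
      exact h3.D1_bdd j _
    · filter_upwards with p s _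
      refine PG_deriv h3.d1 (fun s => sin s • p.1 + cos s • p.2) (fun j => cos s * p.1 j - sin s * p.2 j) s
        fun l => ?_
      simp only [Pi.add_apply, Pi.smul_apply, smul_eq_mul]
      have := ((Real.hasDerivAt_sin s).mul_const (p.1 l)).add ((Real.hasDerivAt_cos s).mul_const (p.2 l))
      rw [neg_mul, ← sub_eq_add_neg] at this
      exact this
  refine hA.congr_deriv ?_
  have i3 : ∀ j, Integrable (fun p : (Fin d → ℝ) × (Fin d → ℝ) => cos θ * p.1 j - sin θ * p.2 j)
      (μ1.prod μ2) := fun j => ((i1 j).const_mul _).sub ((i2 j).const_mul _)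
  rw [integral_finsetSum _ fun j _ => int_coord_D1 h3 j (i3 j) _ _, Finset.mul_sum]
  refine Finset.sum_congr rfl fun j _ => ?_
  have e : ∀ p : (Fin d → ℝ) × (Fin d → ℝ),
      (cos θ * p.1 j - sin θ * p.2 j) * D1 g g1 j (sin θ • p.1 + cos θ • p.2)
      = cos θ * (p.1 j * D1 g g1 j (sin θ • p.1 + cos θ • p.2))
        - sin θ * (p.2 j * D1 g g1 j (sin θ • p.1 + cos θ • p.2)) := fun p => by ring
  simp_rw [e]
  rw [integral_sub ((int_coord_D1 h3 j (i1 j) _ _).const_mul _)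
    ((int_coord_D1 h3 j (i2 j) _ _).const_mul _), integral_const_mul, integral_const_mul,
    stein_fst h3 hμ1 hS1, stein_snd h3 hμ2 hS]
  simp_rw [sub_mul, Finset.sum_sub_distrib]
  ring

lemma compare_smooth (hd : 3 ≤ d) {κ : ℝ → ℝ} {a b : Fin d → ℝ} (hκ : IsKer κ)
    (hab : ∀ l, a l < b l)
    (h3 : G3 (fun l => gs κ (a l) (b l)) (gs1 κ a b) g2 M) (hμ1 : IsG μ1 S1) (hμ2 : IsG μ2 S)
    (hS1 : S1.PosSemidef) (hS : S.PosSemidef) {α : ℝ} (hα : 0 < α) (hα1 : α ≤ 1)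
    (hdiag : ∀ j, S j j = 1)
    (hoff : ∀ j k, j ≠ k → α ^ 2 ≤ 1 - S j k ^ 2) {Δ : ℝ} (hΔ : ∀ j k, |S1 j k - S j k| ≤ Δ)
    (hΔα : Δ ≤ α ^ 2 / 8) :
    |∫ x, PG (fun l => gs κ (a l) (b l)) x ∂μ1 - ∫ x, PG (fun l => gs κ (a l) (b l)) x ∂μ2|
      ≤ 14752 * exp 8 / α ^ 2 * Δ * Real.log d := by
  set g : Fin d → ℝ → ℝ := fun l => gs κ (a l) (b l) with hg
  set f : ℝ → ℝ := fun θ => ∫ p, PG g (sin θ • p.1 + cos θ • p.2) ∂(μ1.prod μ2) with hf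
  have hΔ0 : 0 ≤ Δ := le_trans (abs_nonneg _) (hΔ ⟨0, by omega⟩ ⟨0, by omega⟩)
  have f1 : f (π / 2) = ∫ x, PG g x ∂μ1 := by
    simp only [hf, sin_pi_div_two, cos_pi_div_two, one_smul, zero_smul, add_zero]
    rw [integral_fun_fst (fun x => PG g x)]; simp
  have f0 : f 0 = ∫ x, PG g x ∂μ2 := by
    simp only [hf, sin_zero, cos_zero, one_smul, zero_smul, zero_add]
    rw [integral_fun_snd (fun x => PG g x)]; simp
  have hder := fun θ => interp_deriv h3 hμ1 hμ2 hS1 hS θ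
  have hL := one_le_log hd
  have hb : ∀ θ : ℝ, ‖sin θ * cos θ * ∑ j, ∑ k, (S1 k j - S k j) *
        ∫ p, D2 g (gs1 κ a b) g2 j k (sin θ • p.1 + cos θ • p.2) ∂(μ1.prod μ2)‖
        ≤ Δ * (3688 * exp 8 * Real.log d / (α ^ 2 / 2)) := by
    intro θ
    have hmix := IsG.mix hμ1 hμ2 hS1 hS (sin θ) (cos θ)
    have hgood := good_mix hS1 hS hα hα1 hdiag hoff hΔ hΔα (sin θ) (cos θ) (sin_sq_add_cos_sq θ)
    have hme : Measurable (fun p : (Fin d → ℝ) × (Fin d → ℝ) => sin θ • p.1 + cos θ • p.2) := by fun_prop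
    have : IsProbabilityMeasure ((μ1.prod μ2).map (fun p => sin θ • p.1 + cos θ • p.2)) :=
      Measure.isProbabilityMeasure_map hme.aemeasurable
    have ht := total_sum hd hmix hgood (by nlinarith) hκ hab h3
    have e : ∀ j k, ∫ p, D2 g (gs1 κ a b) g2 j k (sin θ • p.1 + cos θ • p.2) ∂(μ1.prod μ2)
        = ∫ w, D2 g (gs1 κ a b) g2 j k w ∂((μ1.prod μ2).map (fun p => sin θ • p.1 + cos θ • p.2)) := by
      intro j k
      rw [integral_map hme.aemeasurable (h3.D2_cont j k).aestronglyMeasurable]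
    simp_rw [e]
    rw [Real.norm_eq_abs, abs_mul]
    have hsc : |sin θ * cos θ| ≤ 1 := by
      rw [abs_mul]
      exact mul_le_one₀ (abs_sin_le_one θ) (abs_nonneg _) (abs_cos_le_one θ)
    refine (mul_le_of_le_one_left (abs_nonneg _) hsc).trans ?_
    refine le_trans ?_ (mul_le_mul_of_nonneg_left ht hΔ0)
    rw [Finset.mul_sum]
    refine (Finset.abs_sum_le_sum_abs _ _).trans (Finset.sum_le_sum fun j _ => ?_)
    rw [Finset.mul_sum]
    refine (Finset.abs_sum_le_sum_abs _ _).trans (Finset.sum_le_sum fun k _ => ?_)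
    rw [abs_mul]
    exact mul_le_mul_of_nonneg_right (hΔ k j) (abs_nonneg _)
  have hmv := Convex.norm_image_sub_le_of_norm_hasDerivWithin_le
    (s := Set.univ) (f := f) (x := 0) (y := π / 2)
    (fun θ _ => (hder θ).hasDerivWithinAt) (fun θ _ => hb θ) convex_univ (Set.mem_univ _) (Set.mem_univ _)
  rw [f1, f0, Real.norm_eq_abs, Real.norm_eq_abs, sub_zero, abs_of_pos pi_div_two_pos] at hmv
  refine hmv.trans ?_
  have hpi : π / 2 ≤ 2 := by linarith [pi_le_four]
  calc _ ≤ Δ * (3688 * exp 8 * Real.log d / (α ^ 2 / 2)) * 2 := by gcongr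
    _ = _ := by field_simp; ring
end
end GC

namespace GC
variable {d : ℕ} {μ : Measure (Fin d → ℝ)} {C : Matrix (Fin d) (Fin d) ℝ}

lemma exists_ker {δ : ℝ} (h0 : 0 < δ) (h1 : δ ≤ 1) :
    ∃ κ : ℝ → ℝ, IsKer κ ∧ ∀ u, κ u ≠ 0 → |u| < δ := by
  let φ : ContDiffBump (0:ℝ) := ⟨δ / 2, δ, by linarith, by linarith⟩
  have hs : ∀ u, φ.normed volume u ≠ 0 → |u| < δ := by
    intro u hu
    have : u ∈ Function.support (φ.normed volume) := hu
    rw [φ.support_normed_eq, mem_ball_zero_iff] at this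
    exact this
  exact ⟨φ.normed volume, ⟨φ.contDiff_normed, φ.nonneg_normed, fun u hu => (hs u hu).le.trans h1,
    φ.integrable_normed, φ.integral_normed⟩, hs⟩

lemma exists_G3 {κ : ℝ → ℝ} (hκ : IsKer κ) {a b : Fin d → ℝ} (hab : ∀ l, a l < b l) :
    ∃ g2 M, G3 (fun l => gs κ (a l) (b l)) (gs1 κ a b) g2 M := by
  obtain ⟨M0, hM00, hM0⟩ := hκ.bdd
  have hdiff : Differentiable ℝ κ := hκ.smooth.differentiable (by norm_num)
  have hcd : Continuous (deriv κ) := hκ.smooth.continuous_deriv (by norm_num)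
  have hcs : HasCompactSupport κ := by
    refine HasCompactSupport.intro (isCompact_Icc (a := (-1:ℝ)) (b := 1)) fun u hu => ?_
    by_contra hne
    exact hu (abs_le.1 (hκ.supp u hne))
  obtain ⟨M1, hM1⟩ := hcs.deriv.exists_bound_of_continuous hcd
  have hM10 : 0 ≤ M1 := le_trans (norm_nonneg _) (hM1 0)
  refine ⟨fun l u => - deriv κ (a l - u) - - deriv κ (b l - u), 1 + M0 + 2 * M1,
    fun l u => gs_deriv hκ (hab l).le u, fun l u => ?_, fun l => ?_, fun l u => ?_, fun l u => ?_,
    fun l u => ?_⟩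
  · have h : ∀ c : ℝ, HasDerivAt (fun u => κ (c - u)) (- deriv κ (c - u)) u := by
      intro c
      have h2 : HasDerivAt (fun u => c - u) (-1) u := by
        simpa using (hasDerivAt_id u).const_sub c
      have h3 := (hdiff (c - u)).hasDerivAt.comp u h2
      rw [mul_neg_one] at h3
      exact h3
    exact (h (a l)).sub (h (b l))
  · exact ((hcd.comp (by fun_prop)).neg).sub ((hcd.comp (by fun_prop)).neg)
  · rw [abs_of_nonneg (gs_nonneg hκ _ _ _)]
    linarith [gs_le_one hκ (a l) (b l) u]
  · unfold gs1
    have h1 := hκ.nonneg (a l - u)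
    have h2 := hκ.nonneg (b l - u)
    have h3 := hM0 (a l - u)
    have h4 := hM0 (b l - u)
    rw [abs_le]; constructor <;> linarith
  · have h1 := abs_le.1 (hM1 (a l - u))
    have h2 := abs_le.1 (hM1 (b l - u))
    rw [abs_le]; constructor <;> linarith [h1.1, h1.2, h2.1, h2.2]

lemma gs_one {κ : ℝ → ℝ} (hκ : IsKer κ) {δ : ℝ} (hδ : ∀ u, κ u ≠ 0 → |u| < δ) {a b u : ℝ}
    (h1 : δ ≤ u - a) (h2 : δ ≤ b - u) : gs κ a b u = 1 := by
  have e : ∫ v, κ (v - u) = 1 := by rw [integral_sub_right_eq_self κ u]; exact hκ.one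
  rw [gs, ← e]
  refine setIntegral_eq_integral_of_forall_compl_eq_zero fun v hv => ?_
  by_contra h
  have := abs_lt.1 (hδ _ h)
  exact hv ⟨by linarith [this.1], by linarith [this.2]⟩

lemma gs_zero {κ : ℝ → ℝ} {δ : ℝ} (hδ : ∀ u, κ u ≠ 0 → |u| < δ) {a b u : ℝ}
    (h : δ ≤ a - u ∨ δ ≤ u - b) : gs κ a b u = 0 := by
  refine setIntegral_eq_zero_of_forall_eq_zero fun v hv => ?_
  by_contra h0
  have := abs_lt.1 (hδ _ h0)
  rcases h with h | h
  · linarith [hv.1, this.2]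
  · linarith [hv.2, this.1]

lemma null_coord (hμ : IsG μ C) (j : Fin d) (hj : 0 < C j j) (c : ℝ) : μ {x | x j = c} = 0 := by
  have h := hμ (Pi.single j 1)
  have e : (Pi.single j (1:ℝ) : Fin d → ℝ) ⬝ᵥ C.mulVec (Pi.single j 1) = C j j := by
    rw [mulVec_single_one, single_dotProduct]; simp
  rw [e] at h
  simp only [single_dotProduct, one_mul] at h
  have : NullSingletonClass (gaussianReal 0 (Real.toNNReal (C j j))) :=
    nullSingletonClass_gaussianReal (by simpa using hj)
  have h2 : (μ.map (fun x => x j)) {c} = 0 := by rw [h]; exact measure_singleton c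
  rw [Measure.map_apply (measurable_pi_apply j) (measurableSet_singleton c)] at h2
  exact h2

lemma limit_box [IsProbabilityMeasure μ] (hμ : IsG μ C) (hC : ∀ j, 0 < C j j) {a b : Fin d → ℝ}
    (hab : ∀ l, a l < b l) (κ : ℕ → ℝ → ℝ) (hκ : ∀ n, IsKer (κ n))
    (hδ : ∀ n u, κ n u ≠ 0 → |u| < 1 / ((n:ℝ) + 1)) :
    Filter.Tendsto (fun n => ∫ x, PG (fun l => gs (κ n) (a l) (b l)) x ∂μ) Filter.atTop
      (nhds (μ {x | ∀ j, a j ≤ x j ∧ x j ≤ b j}).toReal) := by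
  classical
  set R : Set (Fin d → ℝ) := {x | ∀ j, a j ≤ x j ∧ x j ≤ b j} with hR
  have hRm : MeasurableSet R := by
    have : R = Set.Icc a b := by
      ext x; simp [hR, Pi.le_def, forall_and]
    rw [this]; exact measurableSet_Icc
  have e : (μ R).toReal = ∫ x, R.indicator (fun _ => (1:ℝ)) x ∂μ := by
    rw [integral_indicator hRm]; simp [Measure.real]
  rw [e]
  refine tendsto_integral_of_dominated_convergence (fun _ => (1:ℝ)) ?_ (integrable_const _) ?_ ?_
  · intro n
    exact (PG_cont fun l => gs_cont (hκ n) (hab l).le).aestronglyMeasurable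
  · intro n
    filter_upwards with x
    have := PG_bdd (G := fun l => gs (κ n) (a l) (b l)) (M := 1) (fun l u => by
      rw [abs_of_nonneg (gs_nonneg (hκ n) _ _ _)]
      exact gs_le_one (hκ n) _ _ _) x
    simpa using this
  · have hae : ∀ᵐ x ∂μ, ∀ j, x j ≠ a j ∧ x j ≠ b j := by
      rw [ae_all_iff]
      intro j
      have h1 : ∀ᵐ x ∂μ, x j ≠ a j := by
        rw [ae_iff]; simpa using null_coord hμ j (hC j) (a j)
      have h2 : ∀ᵐ x ∂μ, x j ≠ b j := by
        rw [ae_iff]; simpa using null_coord hμ j (hC j) (b j)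
      exact h1.and h2
    filter_upwards [hae] with x hx
    have h1 : ∀ l ∈ (Finset.univ : Finset (Fin d)),
        Filter.Tendsto (fun n => gs (κ n) (a l) (b l) (x l)) Filter.atTop
        (nhds (if a l ≤ x l ∧ x l ≤ b l then (1:ℝ) else 0)) := by
      intro l _
      obtain ⟨ha, hb⟩ := hx l
      have hm : 0 < min |x l - a l| |x l - b l| :=
        lt_min (abs_pos.2 (sub_ne_zero.2 ha)) (abs_pos.2 (sub_ne_zero.2 hb))
      obtain ⟨N, hN⟩ := exists_nat_one_div_lt hm
      refine tendsto_const_nhds.congr' ?_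
      filter_upwards [Filter.eventually_ge_atTop N] with n hn
      have hn' : 1 / ((n:ℝ) + 1) < min |x l - a l| |x l - b l| := by
        refine lt_of_le_of_lt ?_ hN
        have : (N:ℝ) ≤ n := by exact_mod_cast hn
        gcongr
      obtain ⟨k1, k2⟩ := lt_min_iff.1 hn'
      split_ifs with hin
      · rw [abs_of_nonneg (by linarith [hin.1])] at k1
        rw [abs_of_nonpos (by linarith [hin.2])] at k2
        exact (gs_one (hκ n) (hδ n) k1.le (by linarith)).symm
      · refine (gs_zero (hδ n) ?_).symm
        by_cases h : a l ≤ x l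
        · right
          have h' : b l < x l := by
            by_contra h'; exact hin ⟨h, not_lt.1 h'⟩
          rw [abs_of_pos (by linarith)] at k2
          exact k2.le
        · left
          rw [abs_of_neg (by linarith)] at k1
          linarith
    have h2 := tendsto_finsetProd Finset.univ h1
    have h3 : R.indicator (fun _ => (1:ℝ)) x
        = ∏ l : Fin d, (if a l ≤ x l ∧ x l ≤ b l then (1:ℝ) else 0) := by
      by_cases hxR : x ∈ R
      · rw [Set.indicator_of_mem hxR]
        exact (Finset.prod_eq_one fun l _ => if_pos (hxR l)).symm
      · rw [Set.indicator_of_notMem hxR]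
        have : ∃ j, ¬ (a j ≤ x j ∧ x j ≤ b j) := by
          by_contra hne; push Not at hne; exact hxR hne
        obtain ⟨j, hj⟩ := this
        exact (Finset.prod_eq_zero (Finset.mem_univ j) (if_neg hj)).symm
    rw [h3]
    exact h2

end GC

/-- Gaussian-to-Gaussian comparison. -/
theorem stmt2 :
    ∃ C : ℝ, 0 < C ∧
      ∀ d : ℕ, 3 ≤ d →
      ∀ S1 S : Matrix (Fin d) (Fin d) ℝ, S1.PosSemidef → S.PosSemidef →
      ∀ α : ℝ, 0 < α →
        (∀ j, S j j = 1) →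
        (∀ j k : Fin d, j ≠ k → α ^ 2 ≤ 1 - S j k ^ 2) →
      ∀ μ1 μ2 : Measure (Fin d → ℝ), IsProbabilityMeasure μ1 → IsProbabilityMeasure μ2 →
        -- `μ1` is the law of a centered Gaussian vector with covariance `S1`
        (∀ t : Fin d → ℝ,
          μ1.map (fun x => t ⬝ᵥ x) = gaussianReal 0 (Real.toNNReal (t ⬝ᵥ S1.mulVec t))) →
        -- `μ2` is the law of a centered Gaussian vector with covariance `S`
        (∀ t : Fin d → ℝ,
          μ2.map (fun x => t ⬝ᵥ x) = gaussianReal 0 (Real.toNNReal (t ⬝ᵥ S.mulVec t))) →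
      ∀ a b : Fin d → ℝ,
        letI Δ : ℝ := ⨆ j, ⨆ k, |S1 j k - S j k|
        |(μ1 {x | ∀ j, a j ≤ x j ∧ x j ≤ b j}).toReal -
            (μ2 {x | ∀ j, a j ≤ x j ∧ x j ≤ b j}).toReal| ≤
          C / α ^ 2 * Δ * Real.log d * max |Real.log Δ| 1 := by
  have hE : 1 ≤ exp 8 := Real.one_le_exp (by norm_num)
  refine ⟨14752 * exp 8, by positivity, ?_⟩
  intro d hd S1 S hS1 hS α hα hdiag hoff μ1 μ2 hp1 hp2 hμ1 hμ2 a b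
  have hΔ : ∀ j k, |S1 j k - S j k| ≤ ⨆ j, ⨆ k, |S1 j k - S j k| := fun j k =>
    (le_ciSup (f := fun k => |S1 j k - S j k|) (Set.finite_range _).bddAbove k).trans
      (le_ciSup (f := fun j => ⨆ k, |S1 j k - S j k|) (Set.finite_range _).bddAbove j)
  generalize (⨆ j, ⨆ k, |S1 j k - S j k|) = Δ at hΔ ⊢
  have hα1 : α ≤ 1 := by
    have := hoff ⟨0, by omega⟩ ⟨1, by omega⟩ (by simp)
    nlinarith [sq_nonneg (S ⟨0, by omega⟩ ⟨1, by omega⟩)]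
  have hΔ0 : 0 ≤ Δ := le_trans (abs_nonneg _) (hΔ ⟨0, by omega⟩ ⟨0, by omega⟩)
  have hL := GC.one_le_log hd
  have hmax : (1:ℝ) ≤ max |Real.log Δ| 1 := le_max_right _ _
  set R : Set (Fin d → ℝ) := {x | ∀ j, a j ≤ x j ∧ x j ≤ b j} with hR
  have hα2 : 0 < α ^ 2 := by positivity
  suffices h : |(μ1 R).toReal - (μ2 R).toReal| ≤ 14752 * exp 8 / α ^ 2 * Δ * Real.log d by
    refine h.trans (le_mul_of_one_le_right (by positivity) hmax)
  rcases lt_or_ge (α ^ 2 / 8) Δ with hbig | hsmall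
  · have h1 : |(μ1 R).toReal - (μ2 R).toReal| ≤ 1 := by
      have p1 : (μ1 R).toReal ≤ 1 := ENNReal.toReal_le_of_le_ofReal zero_le_one (by simpa using prob_le_one)
      have p2 : (μ2 R).toReal ≤ 1 := ENNReal.toReal_le_of_le_ofReal zero_le_one (by simpa using prob_le_one)
      have q1 : 0 ≤ (μ1 R).toReal := ENNReal.toReal_nonneg
      have q2 : 0 ≤ (μ2 R).toReal := ENNReal.toReal_nonneg
      rw [abs_le]; constructor <;> linarith
    refine h1.trans ?_
    have h2 : 14752 * exp 8 / α ^ 2 * (α ^ 2 / 8) ≤ 14752 * exp 8 / α ^ 2 * Δ := by gcongr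
    have h3 : 14752 * exp 8 / α ^ 2 * (α ^ 2 / 8) = 1844 * exp 8 := by field_simp; norm_num
    rw [h3] at h2
    have h4 : 1 ≤ 14752 * exp 8 / α ^ 2 * Δ := by linarith
    exact h4.trans (le_mul_of_one_le_right (by linarith) hL)
  have hd1 : ∀ j, 0 < S1 j j := by
    intro j
    have h1 := abs_le.1 (hΔ j j)
    rw [hdiag j] at h1
    nlinarith [h1.1]
  have hd2 : ∀ j, 0 < S j j := fun j => by rw [hdiag]; exact one_pos
  have hg1 : GC.IsG μ1 S1 := hμ1
  have hg2 : GC.IsG μ2 S := hμ2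
  by_cases hab : ∀ l, a l < b l
  · have hk : ∀ n : ℕ, ∃ κ : ℝ → ℝ, GC.IsKer κ ∧ ∀ u, κ u ≠ 0 → |u| < 1 / ((n:ℝ) + 1) := fun n =>
      GC.exists_ker (by positivity) (by
        rw [div_le_one (by positivity)]
        have : (0:ℝ) ≤ n := by positivity
        linarith)
    choose κ hκ hδ using hk
    have l1 := GC.limit_box hg1 hd1 hab κ hκ hδ
    have l2 := GC.limit_box hg2 hd2 hab κ hκ hδ
    refine le_of_tendsto (l1.sub l2).abs ?_
    filter_upwards with n
    obtain ⟨g2, M, h3⟩ := GC.exists_G3 (hκ n) hab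
    exact GC.compare_smooth hd (hκ n) hab h3 hg1 hg2 hS1 hS hα hα1 hdiag hoff hΔ hsmall
  · push Not at hab
    obtain ⟨j, hj⟩ := hab
    have hsub : R ⊆ {x | x j = a j} := fun x hx => by
      have := hx j
      exact le_antisymm (this.2.trans hj) this.1
    rw [measure_mono_null hsub (GC.null_coord hg1 j (hd1 j) _),
      measure_mono_null hsub (GC.null_coord hg2 j (hd2 j) _)]
    simp only [ENNReal.toReal_zero, sub_self, abs_zero]
    positivity
end

section
/- Let d ≥ 3, let Z be a standard Gaussian random vector in ℝ^d (Z ~ N(0, I_d)), let v_1, …, v_d be unit vectors in ℝ^d and b_1, …, b_d ∈ ℝ. Then for every ε > 0, P(Z·v_j ≤ b_j + ε for all 1 ≤ j ≤ d) − P(Z·v_j ≤ b_j for all 1 ≤ j ≤ d) ≤ ε (√(2 log d) + 2). -/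
open MeasureTheory ProbabilityTheory Matrix Real

/-- the standard Gaussian measure `N(0, I_d)` on `ℝ^d` -/
noncomputable def stdGaussianPi (d : ℕ) : Measure (Fin d → ℝ) :=
  Measure.pi fun _ => gaussianReal 0 1

open scoped ENNReal

namespace Nazarov

noncomputable abbrev φ (x : ℝ) : ℝ := gaussianPDFReal 0 1 x

lemma phi_eq (x : ℝ) : φ x = (√(2 * π))⁻¹ * Real.exp (-x ^ 2 / 2) := by
  simp [φ, gaussianPDFReal]

lemma const_le : (√(2 * π))⁻¹ ≤ 1 / 2 := by
  rw [inv_le_comm₀ (by positivity) (by norm_num)]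
  apply Real.le_sqrt_of_sq_le
  have := Real.pi_gt_three
  norm_num; linarith

lemma hasDeriv_phi (x : ℝ) : HasDerivAt φ (-x * φ x) x := by
  have h : φ = fun x => (√(2 * π))⁻¹ * Real.exp (-x ^ 2 / 2) := funext phi_eq
  rw [phi_eq x, h]
  have h1 : HasDerivAt (fun x : ℝ => -x ^ 2 / 2) (-x) x := by
    have := ((hasDerivAt_pow 2 x).neg).div_const 2
    refine this.congr_deriv ?_
    push_cast
    ring
  refine ((h1.exp).const_mul ((√(2 * π))⁻¹)).congr_deriv ?_
  ring

lemma tendsto_phi : Filter.Tendsto (fun x => φ x / (x + 1)) Filter.atTop (nhds 0) := by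
  have h2 : Filter.Tendsto (fun x : ℝ => (1 / 2 : ℝ) * (x + 1)⁻¹) Filter.atTop (nhds 0) := by
    have := (tendsto_inv_atTop_zero.comp
      (Filter.tendsto_atTop_add_const_right Filter.atTop (1 : ℝ) Filter.tendsto_id)).const_mul
      (1 / 2 : ℝ)
    simpa using this
  refine squeeze_zero' ?_ ?_ h2
  · filter_upwards [Filter.eventually_ge_atTop 0] with x hx
    have := gaussianPDFReal_nonneg 0 1 x
    positivity
  · filter_upwards [Filter.eventually_ge_atTop 0] with x hx
    rw [div_eq_mul_inv]
    gcongr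
    rw [phi_eq]
    calc (√(2 * π))⁻¹ * Real.exp (-x ^ 2 / 2) ≤ (1 / 2) * 1 := by
          gcongr
          · exact const_le
          · rw [Real.exp_le_one_iff]; nlinarith [sq_nonneg x]
      _ = 1 / 2 := by norm_num

/-- Mills ratio bound. -/
lemma mills {x : ℝ} (hx : 0 ≤ x) : φ x ≤ (x + 1) * (gaussianReal 0 1 (Set.Ici x)).toReal := by
  have hd : ∀ t ∈ Set.Ici x, HasDerivAt (fun x => φ x / (x + 1))
      (-(φ t * ((t ^ 2 + t + 1) / (t + 1) ^ 2))) t := by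
    intro t ht
    have ht0 : 0 ≤ t := hx.trans ht
    have hne : t + 1 ≠ 0 := by positivity
    refine ((hasDeriv_phi t).div ((hasDerivAt_id' t).add_const 1) hne).congr_deriv ?_
    field_simp
    ring
  have hneg : ∀ t ∈ Set.Ioi x, -(φ t * ((t ^ 2 + t + 1) / (t + 1) ^ 2)) ≤ 0 := by
    intro t ht
    have ht0 : 0 ≤ t := hx.trans (le_of_lt ht)
    have := gaussianPDFReal_nonneg 0 1 t
    rw [neg_nonpos]; positivity
  have hint := integrableOn_Ioi_deriv_of_nonpos' hd hneg tendsto_phi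
  have hI := integral_Ioi_of_hasDerivAt_of_nonpos' hd hneg tendsto_phi
  rw [integral_neg] at hI
  have hI' : φ x / (x + 1) = ∫ t in Set.Ioi x, φ t * ((t ^ 2 + t + 1) / (t + 1) ^ 2) := by linarith
  have hle : φ x / (x + 1) ≤ ∫ t in Set.Ioi x, φ t := by
    rw [hI']
    refine setIntegral_mono_on ?_ (integrable_gaussianPDFReal 0 1).integrableOn
      measurableSet_Ioi ?_
    · simpa using hint.neg
    · intro t ht
      have ht0 : 0 ≤ t := hx.trans (le_of_lt ht)
      apply mul_le_of_le_one_right (gaussianPDFReal_nonneg 0 1 t)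
      rw [div_le_one (by positivity)]
      nlinarith
  have hQ : (gaussianReal 0 1 (Set.Ici x)).toReal = ∫ t in Set.Ioi x, φ t := by
    rw [gaussianReal_apply_eq_integral 0 one_ne_zero, ENNReal.toReal_ofReal,
      integral_Ici_eq_integral_Ioi]
    exact integral_nonneg fun t => gaussianPDFReal_nonneg 0 1 t
  rw [hQ]
  rw [div_le_iff₀ (by positivity)] at hle
  linarith

lemma phi_anti {x y : ℝ} (hx : 0 ≤ x) (hxy : x ≤ y) : φ y ≤ φ x := by
  rw [phi_eq, phi_eq]
  gcongr

lemma phi_le_zero (x : ℝ) : φ x ≤ φ 0 := by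
  rw [phi_eq, phi_eq]
  have : -x ^ 2 / 2 ≤ -0 ^ 2 / 2 := by nlinarith [sq_nonneg x]
  gcongr

lemma mills' {x K : ℝ} (hx : x + 1 ≤ K) (hK : 1 ≤ K) :
    φ x ≤ K * (gaussianReal 0 1 (Set.Ici x)).toReal := by
  rcases le_total 0 x with h | h
  · exact (mills h).trans (by gcongr)
  · have h0 := mills (le_refl 0)
    have h1 : (gaussianReal 0 1 (Set.Ici 0)).toReal ≤ (gaussianReal 0 1 (Set.Ici x)).toReal :=
      ENNReal.toReal_mono (measure_ne_top _ _) (measure_mono (Set.Ici_subset_Ici.2 h))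
    have h2 := phi_le_zero x
    nlinarith [ENNReal.toReal_nonneg (a := gaussianReal 0 1 (Set.Ici x))]

lemma meas_le {A : Set ℝ} (hA : MeasurableSet A) {b h C : ℝ} (hAb : A ⊆ Set.Ioc b (b + h))
    (hC : ∀ x ∈ A, φ x ≤ C) :
    gaussianReal 0 1 A ≤ ENNReal.ofReal C * ENNReal.ofReal h := by
  rw [gaussianReal_apply 0 one_ne_zero]
  calc ∫⁻ x in A, gaussianPDF 0 1 x ≤ ∫⁻ x in A, ENNReal.ofReal C :=
        setLIntegral_mono measurable_const fun x hx => ENNReal.ofReal_le_ofReal (hC x hx)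
    _ = ENNReal.ofReal C * volume A := by simp
    _ ≤ ENNReal.ofReal C * volume (Set.Ioc b (b + h)) := by gcongr
    _ = _ := by simp

/-- One-dimensional estimate. -/
lemma oneDim {d : ℕ} (hd : 3 ≤ d) {h : ℝ} (hh : 0 < h) (hh' : h ≤ 1 / 2) (b : ℝ) (S : Set ℝ)
    (hS : MeasurableSet S) (hup : IsUpperSet S) :
    gaussianReal 0 1 (S ∩ Set.Ioc b (b + h)) ≤
      ENNReal.ofReal (h * (√(2 * Real.log d) + 3 / 2)) * gaussianReal 0 1 S
        + ENNReal.ofReal (h / (2 * d)) := by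
  have hm : MeasurableSet (S ∩ Set.Ioc b (b + h)) := hS.inter measurableSet_Ioc
  have hL : 0 ≤ √(2 * Real.log d) := Real.sqrt_nonneg _
  rcases le_or_gt b (√(2 * Real.log d)) with hb | hb
  · refine le_trans ?_ le_self_add
    refine (meas_le (C := (√(2 * Real.log d) + 3 / 2) * (gaussianReal 0 1 S).toReal) hm
      Set.inter_subset_right ?_).trans ?_
    · rintro x ⟨hxS, hx⟩
      refine (mills' (K := √(2 * Real.log d) + 3 / 2) ?_ ?_).trans ?_
      · linarith [hx.2]
      · linarith
      · gcongr
        · exact measure_ne_top _ _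
        · exact fun y hy => hup hy hxS
    · rw [ENNReal.ofReal_mul (by positivity), ENNReal.ofReal_mul hh.le,
        ENNReal.ofReal_toReal (measure_ne_top _ _)]
      apply le_of_eq
      ring
  · refine le_trans ?_ le_add_self
    refine (meas_le (C := 1 / (2 * d)) hm Set.inter_subset_right ?_).trans ?_
    · rintro x ⟨_, hx⟩
      have hlx : √(2 * Real.log d) ≤ x := hb.le.trans hx.1.le
      refine (phi_anti hL hlx).trans ?_
      have hd0 : (0 : ℝ) < d := by positivity
      have hd1 : (1 : ℝ) ≤ d := by exact_mod_cast (by omega : 1 ≤ d)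
      rw [phi_eq, Real.sq_sqrt (by have := Real.log_nonneg hd1; positivity)]
      have : -(2 * Real.log d) / 2 = -Real.log d := by ring
      rw [this, Real.exp_neg, Real.exp_log hd0]
      calc (√(2 * π))⁻¹ * (d : ℝ)⁻¹ ≤ 1 / 2 * (d : ℝ)⁻¹ := by gcongr; exact const_le
        _ = _ := by field_simp
    · rw [← ENNReal.ofReal_mul (by positivity)]
      apply le_of_eq
      congr 1
      ring

section resample
variable {E : Type*} [NormedAddCommGroup E] [InnerProductSpace ℝ E] [FiniteDimensional ℝ E]
  [MeasurableSpace E] [BorelSpace E]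

lemma resample (w : E) (hw : ‖w‖ = 1) :
    ((stdGaussian E).prod (gaussianReal 0 1)).map
      (fun p : E × ℝ => p.1 + (p.2 - inner ℝ w p.1) • w) = stdGaussian E := by
  have hmeas : Measurable (fun p : E × ℝ => p.1 + (p.2 - inner ℝ w p.1) • w) :=
    Continuous.measurable (by fun_prop)
  haveI := Measure.isProbabilityMeasure_map (μ := (stdGaussian E).prod (gaussianReal 0 1))
    hmeas.aemeasurable
  apply Measure.ext_of_charFun
  ext u
  rw [charFun_stdGaussian, charFun_apply, integral_map hmeas.aemeasurable
    (Continuous.aestronglyMeasurable (by fun_prop))]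
  have key : ∀ p : E × ℝ, Complex.exp ((inner ℝ (p.1 + (p.2 - inner ℝ w p.1) • w) u : ℝ) * Complex.I)
      = Complex.exp ((inner ℝ p.1 (u - (inner ℝ w u : ℝ) • w) : ℝ) * Complex.I) *
        Complex.exp ((inner ℝ w u : ℝ) * (p.2 : ℂ) * Complex.I) := by
    intro p
    rw [← Complex.exp_add]
    congr 1
    simp only [inner_add_left, inner_smul_left, inner_sub_right, inner_smul_right,
      real_inner_comm w p.1]
    push_cast
    simp
    ring
  simp_rw [key]
  rw [integral_prod_mul (fun z : E => Complex.exp ((inner ℝ z (u - (inner ℝ w u : ℝ) • w) : ℝ) * Complex.I))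
    (fun t : ℝ => Complex.exp ((inner ℝ w u : ℝ) * (t : ℂ) * Complex.I))]
  rw [← charFun_apply, charFun_stdGaussian, ← charFun_apply_real, charFun_gaussianReal,
    ← Complex.exp_add]
  congr 1
  have hn : ‖u - (inner ℝ w u : ℝ) • w‖ ^ 2 = ‖u‖ ^ 2 - (inner ℝ w u : ℝ) ^ 2 := by
    rw [norm_sub_sq_real, inner_smul_right, norm_smul, hw, real_inner_comm w u]
    simp
    ring
  have hn' : ((‖u - (inner ℝ w u : ℝ) • w‖ : ℝ) : ℂ) ^ 2
      = (‖u‖ : ℂ) ^ 2 - ((inner ℝ w u : ℝ) : ℂ) ^ 2 := by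
    exact_mod_cast hn
  rw [hn']
  simp
  ring

lemma slice (w : E) (hw : ‖w‖ = 1) {A R : Set E} (hA : MeasurableSet A) (hR : MeasurableSet R)
    (c δ : ℝ≥0∞)
    (h : ∀ z : E, gaussianReal 0 1 {t : ℝ | z + (t - inner ℝ w z) • w ∈ A} ≤
      c * gaussianReal 0 1 {t : ℝ | z + (t - inner ℝ w z) • w ∈ R} + δ) :
    stdGaussian E A ≤ c * stdGaussian E R + δ := by
  have hmeas : Measurable (fun p : E × ℝ => p.1 + (p.2 - inner ℝ w p.1) • w) :=
    Continuous.measurable (by fun_prop)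
  have key : ∀ B : Set E, MeasurableSet B → stdGaussian E B =
      ∫⁻ z, gaussianReal 0 1 {t : ℝ | z + (t - inner ℝ w z) • w ∈ B} ∂(stdGaussian E) := by
    intro B hB
    conv_lhs => rw [← resample w hw]
    rw [Measure.map_apply hmeas hB, Measure.prod_apply (hmeas hB)]
    rfl
  have hmR : Measurable fun z : E =>
      gaussianReal 0 1 {t : ℝ | z + (t - inner ℝ w z) • w ∈ R} :=
    measurable_measure_prodMk_left (hmeas hR)
  rw [key A hA, key R hR, ← lintegral_const_mul c hmR]
  refine (lintegral_mono h).trans ?_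
  rw [lintegral_add_right _ measurable_const]
  simp

lemma main {d : ℕ} (hd : 3 ≤ d) (v : Fin d → E) (hv : ∀ j, ‖v j‖ = 1) (b : Fin d → ℝ) {h : ℝ}
    (hh : 0 < h) (hh' : h ≤ 1 / 2) :
    stdGaussian E {z | ∀ j, inner ℝ (v j) z ≤ b j + h} ≤
      stdGaussian E {z | ∀ j, inner ℝ (v j) z ≤ b j}
        + ENNReal.ofReal (h * (√(2 * Real.log d) + 2)) := by
  set R : Fin d → Set E := fun j => {z | ∀ k, inner ℝ (v k) z - b k ≤ inner ℝ (v j) z - b j ∧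
    (k < j → inner ℝ (v k) z - b k < inner ℝ (v j) z - b j)} with hR
  have hRm : ∀ j, MeasurableSet (R j) := by
    intro j
    have : R j = ⋂ k, ({z | inner ℝ (v k) z - b k ≤ inner ℝ (v j) z - b j} ∩
      {z | k < j → inner ℝ (v k) z - b k < inner ℝ (v j) z - b j}) := by
      ext z; simp [hR]
    rw [this]
    refine MeasurableSet.iInter fun k => MeasurableSet.inter ?_ ?_
    · exact (isClosed_le (by fun_prop) (by fun_prop)).measurableSet
    · by_cases hk : k < j
      · simp only [hk, true_imp_iff]
        exact (isOpen_lt (by fun_prop) (by fun_prop)).measurableSet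
      · simp [hk]
  set A : Fin d → Set E := fun j => R j ∩ {z | inner ℝ (v j) z ∈ Set.Ioc (b j) (b j + h)} with hA
  have hAm : ∀ j, MeasurableSet (A j) := fun j => (hRm j).inter
    (measurableSet_Ioc.preimage (Continuous.measurable (by fun_prop)))
  have hdisj : Pairwise (Function.onFun Disjoint R) := by
    intro i j hij
    rw [Function.onFun, Set.disjoint_left]
    intro z hi hj
    rcases lt_or_gt_of_ne hij with hlt | hlt
    · exact absurd ((hj i).2 hlt) (not_lt.2 (hi j).1)
    · exact absurd ((hi j).2 hlt) (not_lt.2 (hj i).1)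
  have hcov : {z : E | ∀ j, inner ℝ (v j) z ≤ b j + h} ⊆
      {z | ∀ j, inner ℝ (v j) z ≤ b j} ∪ ⋃ j, A j := by
    intro z hz
    by_cases hz0 : ∀ j, inner ℝ (v j) z ≤ b j
    · exact Or.inl hz0
    right
    push Not at hz0
    obtain ⟨j0, hj0⟩ := hz0
    haveI : Nonempty (Fin d) := ⟨j0⟩
    obtain ⟨j1, hj1⟩ := Finite.exists_max (fun j => inner ℝ (v j) z - b j)
    obtain ⟨j, hj, hmin⟩ := WellFounded.has_min (wellFounded_lt (α := Fin d))
      {j | ∀ k, inner ℝ (v k) z - b k ≤ inner ℝ (v j) z - b j} ⟨j1, hj1⟩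
    refine Set.mem_iUnion.2 ⟨j, fun k => ⟨hj k, fun hk => ?_⟩, ?_, hz j⟩
    · by_contra hcon
      exact hmin k (fun l => (hj l).trans (not_lt.1 hcon)) hk
    · have := hj j0
      linarith
  have hone : ∀ j, stdGaussian E (A j) ≤
      ENNReal.ofReal (h * (√(2 * Real.log d) + 3 / 2)) * stdGaussian E (R j)
        + ENNReal.ofReal (h / (2 * d)) := by
    intro j
    refine slice (v j) (hv j) (hAm j) (hRm j) _ _ fun z => ?_
    have hcont : Continuous fun t : ℝ => z + (t - inner ℝ (v j) z) • v j := by fun_prop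
    have hS : MeasurableSet {t : ℝ | z + (t - inner ℝ (v j) z) • v j ∈ R j} :=
      (hRm j).preimage hcont.measurable
    have hself : ∀ t : ℝ, inner ℝ (v j) (z + (t - inner ℝ (v j) z) • v j) = t := by
      intro t
      rw [inner_add_right, inner_smul_right, real_inner_self_eq_norm_sq, hv j]
      ring
    have hup : IsUpperSet {t : ℝ | z + (t - inner ℝ (v j) z) • v j ∈ R j} := by
      intro s t hst hs k
      have hs := hs k
      simp only [hself] at hs ⊢
      have hkj : inner ℝ (v k) (v j) ≤ (1 : ℝ) := by
        have := real_inner_le_norm (v k) (v j)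
        rwa [hv, hv, one_mul] at this
      have hdiff : inner ℝ (v k) (z + (t - inner ℝ (v j) z) • v j) ≤
          inner ℝ (v k) (z + (s - inner ℝ (v j) z) • v j) + (t - s) := by
        simp only [inner_add_right, inner_smul_right]
        nlinarith
      refine ⟨by linarith [hs.1], fun hk => by linarith [hs.2 hk]⟩
    have := oneDim hd hh hh' (b j) _ hS hup
    refine le_trans (le_of_eq ?_) this
    congr 1
    ext t
    simp only [hA, Set.mem_inter_iff, Set.mem_ofPred_eq, hself]
  have hsumR : ∑ j, stdGaussian E (R j) ≤ 1 := by
    rw [← tsum_fintype (L := .unconditional _), ← measure_iUnion hdisj hRm]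
    exact prob_le_one
  refine (measure_mono hcov).trans ((measure_union_le _ _).trans ?_)
  gcongr
  refine (measure_iUnion_fintype_le _ _).trans ((Finset.sum_le_sum fun j _ => hone j).trans ?_)
  rw [Finset.sum_add_distrib, ← Finset.mul_sum]
  have hd0 : (0 : ℝ) < d := by positivity
  have hconst : ∑ _j : Fin d, ENNReal.ofReal (h / (2 * d)) = ENNReal.ofReal (h / 2) := by
    rw [← ENNReal.ofReal_sum_of_nonneg (fun _ _ => by positivity)]
    congr 1
    simp
    field_simp
  rw [hconst]
  calc _ ≤ ENNReal.ofReal (h * (√(2 * Real.log d) + 3 / 2)) * 1 + ENNReal.ofReal (h / 2) := by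
        gcongr
    _ = _ := by
        rw [mul_one, ← ENNReal.ofReal_add (by positivity) (by positivity)]
        congr 1; ring

end resample

end Nazarov

/-- Nazarov's inequality for convex polytopes. -/
theorem stmt4 :
    ∀ d : ℕ, 3 ≤ d →
    ∀ v : Fin d → (Fin d → ℝ), (∀ j, ∑ i, v j i ^ 2 = 1) →
    ∀ b : Fin d → ℝ, ∀ ε : ℝ, 0 < ε →
      (stdGaussianPi d {z | ∀ j, z ⬝ᵥ v j ≤ b j + ε}).toReal -
          (stdGaussianPi d {z | ∀ j, z ⬝ᵥ v j ≤ b j}).toReal ≤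
        ε * (Real.sqrt (2 * Real.log d) + 2) := by
  intro d hd v hv b ε hε
  have key : ∀ c : Fin d → ℝ, stdGaussianPi d {z | ∀ j, z ⬝ᵥ v j ≤ c j} =
      stdGaussian (EuclideanSpace ℝ (Fin d))
        {z | ∀ j, inner ℝ (WithLp.toLp 2 (v j)) z ≤ c j} := by
    intro c
    rw [← map_pi_eq_stdGaussian, Measure.map_apply (by fun_prop)]
    · rfl
    · rw [Set.ofPred_forall]
      exact MeasurableSet.iInter fun j =>
        (isClosed_le (by fun_prop) (by fun_prop)).measurableSet
  have hnorm : ∀ j, ‖(WithLp.toLp 2 (v j) : EuclideanSpace ℝ (Fin d))‖ = 1 := by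
    intro j
    rw [EuclideanSpace.norm_eq]
    simp [hv j]
  rw [key b, key fun j => b j + ε]
  have hL : 0 ≤ √(2 * Real.log d) := Real.sqrt_nonneg _
  rcases le_or_gt ε (1 / 2) with h | h
  · have hm := Nazarov.main hd _ hnorm b hε h
    have := ENNReal.toReal_mono (by finiteness) hm
    rw [ENNReal.toReal_add (by finiteness) (by finiteness), ENNReal.toReal_ofReal (by positivity)]
      at this
    linarith
  · have h1 : (stdGaussian (EuclideanSpace ℝ (Fin d))
        {z | ∀ j, inner ℝ (WithLp.toLp 2 (v j)) z ≤ b j + ε}).toReal ≤ 1 :=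
      measureReal_le_one
    have h2 : 0 ≤ (stdGaussian (EuclideanSpace ℝ (Fin d))
        {z | ∀ j, inner ℝ (WithLp.toLp 2 (v j)) z ≤ b j}).toReal := ENNReal.toReal_nonneg
    nlinarith
end

section
/- Let d ≥ 3 and let G be a centered Gaussian vector in ℝ^d with min_{1 ≤ j ≤ d} E[G_j²] ≥ σ̲² for some σ̲ > 0. Then for any b ∈ ℝ^d and ε > 0, P(G_j ≤ b_j + ε for all 1 ≤ j ≤ d) − P(G_j ≤ b_j for all 1 ≤ j ≤ d) ≤ (ε/σ̲)(√(2 log d) + 2). -/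
open MeasureTheory ProbabilityTheory Matrix Real

/-- Standard Gaussian density. -/
noncomputable def nzPhi (x : ℝ) : ℝ := gaussianPDFReal 0 1 x

lemma nzPhi_eq (x : ℝ) : nzPhi x = (√(2 * π))⁻¹ * rexp (-x ^ 2 / 2) := by
  simp [nzPhi, gaussianPDFReal]

lemma nzPhi_nonneg (x : ℝ) : 0 ≤ nzPhi x := gaussianPDFReal_nonneg 0 1 x

lemma nzPhi_cont : Continuous nzPhi := by
  have : nzPhi = fun x => (√(2 * π))⁻¹ * rexp (-x ^ 2 / 2) := funext nzPhi_eq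
  rw [this]; fun_prop

lemma nzPhi_deriv (x : ℝ) : HasDerivAt nzPhi (-x * nzPhi x) x := by
  have h : nzPhi = fun x => (√(2 * π))⁻¹ * rexp (-x ^ 2 / 2) := funext nzPhi_eq
  have h1 : HasDerivAt (fun x : ℝ => -x ^ 2 / 2) (-x) x := by
    have := ((hasDerivAt_pow 2 x).neg).div_const 2
    refine this.congr_deriv ?_
    simp; ring
  have h2 := (h1.exp).const_mul (√(2 * π))⁻¹
  rw [nzPhi_eq, h]
  refine h2.congr_deriv ?_
  ring

lemma nz_real_eq (s : Set ℝ) : (gaussianReal 0 1).real s = ∫ x in s, nzPhi x := by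
  rw [measureReal_def, gaussianReal_apply_eq_integral 0 one_ne_zero, ENNReal.toReal_ofReal]
  · rfl
  · exact integral_nonneg fun x => nzPhi_nonneg x

lemma nz_Ioc {a b : ℝ} (h : a ≤ b) :
    (gaussianReal 0 1).real (Set.Ioc a b) = ∫ x in a..b, nzPhi x := by
  rw [nz_real_eq, intervalIntegral.integral_of_le h]

lemma nz_Ioc_le {a b C : ℝ} (h : a ≤ b) (hC : ∀ x ∈ Set.Icc a b, nzPhi x ≤ C) :
    (gaussianReal 0 1).real (Set.Ioc a b) ≤ (b - a) * C := by
  rw [nz_Ioc h]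
  have := intervalIntegral.integral_mono_on h (nzPhi_cont.intervalIntegrable a b)
    (continuous_const.intervalIntegrable a b : IntervalIntegrable (fun _ => C) volume a b) hC
  simpa using this

/-- Mills ratio lower bound. -/
lemma nz_mills {y c : ℝ} (hc : 0 ≤ c) (hy : y ≤ c) :
    nzPhi y / (c + 1) ≤ (gaussianReal 0 1).real (Set.Ioi y) := by
  have key : ∀ T, y ≤ T → nzPhi y / (c + 1) - nzPhi T / (T + (c - y + 1)) ≤
      (gaussianReal 0 1).real (Set.Ioi y) := by
    intro T hT
    have hder : ∀ x, y ≤ x → HasDerivAt (fun x => -(nzPhi x / (x + (c - y + 1))))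
        (-((-x * nzPhi x * (x + (c - y + 1)) - nzPhi x * 1) / (x + (c - y + 1)) ^ 2)) x := by
      intro x hx
      exact ((nzPhi_deriv x).div ((hasDerivAt_id x).add_const _) (by simp; linarith)).neg
    have := intervalIntegral.sub_le_integral_of_hasDeriv_right_of_le hT
      (g := fun x => -(nzPhi x / (x + (c - y + 1))))
      (g' := fun x => -((-x * nzPhi x * (x + (c - y + 1)) - nzPhi x * 1) / (x + (c - y + 1)) ^ 2))
      (φ := nzPhi) (fun x hx => (hder x hx.1).continuousAt.continuousWithinAt)
      (fun x hx => (hder x hx.1.le).hasDerivWithinAt)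
      (nzPhi_cont.integrableOn_Icc) (by
        intro x hx
        have hx1 := hx.1
        have hs : 0 < x + (c - y + 1) := by linarith
        rw [← neg_div, div_le_iff₀ (by positivity)]
        have hp := nzPhi_nonneg x
        have : x * (x + (c - y + 1)) + 1 ≤ (x + (c - y + 1)) ^ 2 := by nlinarith
        nlinarith)
    rw [← nz_Ioc hT] at this
    have h2 : (gaussianReal 0 1).real (Set.Ioc y T) ≤ (gaussianReal 0 1).real (Set.Ioi y) :=
      measureReal_mono Set.Ioc_subset_Ioi_self
    have e : y + (c - y + 1) = c + 1 := by ring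
    simp only [e] at this
    linarith
  have hlim : Filter.Tendsto (fun T => nzPhi y / (c + 1) - nzPhi T / (T + (c - y + 1)))
      Filter.atTop (nhds (nzPhi y / (c + 1) - 0)) := by
    refine Filter.Tendsto.sub tendsto_const_nhds ?_
    have hden : Filter.Tendsto (fun T : ℝ => (√(2 * π))⁻¹ / (T + (c - y + 1))) Filter.atTop
        (nhds 0) :=
      Filter.Tendsto.div_atTop tendsto_const_nhds
        (Filter.tendsto_atTop_add_const_right _ _ Filter.tendsto_id)
    refine squeeze_zero' ?_ ?_ hden
    · filter_upwards [Filter.eventually_ge_atTop y] with T hT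
      exact div_nonneg (nzPhi_nonneg _) (by linarith)
    · filter_upwards [Filter.eventually_ge_atTop y] with T hT
      have : 0 ≤ T + (c - y + 1) := by linarith
      gcongr
      rw [nzPhi_eq]
      have : rexp (-T ^ 2 / 2) ≤ 1 := by
        rw [Real.exp_le_one_iff]; nlinarith [sq_nonneg T]
      exact mul_le_of_le_one_right (by positivity) this
  rw [sub_zero] at hlim
  refine le_of_tendsto hlim ?_
  filter_upwards [Filter.eventually_ge_atTop y] with T hT using key T hT

lemma nz_near {a b δ : ℝ} (ha : 0 ≤ a) (hδ : 0 < δ) (hb : b ≤ a) :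
    (gaussianReal 0 1).real (Set.Ioc b (b + δ)) ≤
      δ * (rexp ((a + δ) * δ) * (a + δ + 1)) * (gaussianReal 0 1).real (Set.Ioi (b + δ)) := by
  have h1 := nz_mills (y := b + δ) (c := a + δ) (by positivity) (by linarith)
  have h2 := nz_Ioc_le (a := b) (b := b + δ) (C := nzPhi (b + δ) * rexp ((a + δ) * δ))
    (by linarith) (by
      intro x hx
      rw [nzPhi_eq, nzPhi_eq, mul_assoc, ← Real.exp_add]
      gcongr
      have h3 := hx.1
      have h4 := hx.2
      nlinarith [mul_nonneg (sub_nonneg.2 h4) (sub_nonneg.2 hb),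
        mul_nonneg (sub_nonneg.2 h3) (by positivity : 0 ≤ a + δ), sq_nonneg (b + δ - x)])
  rw [div_le_iff₀ (by positivity)] at h1
  calc _ ≤ _ := h2
    _ = δ * rexp ((a + δ) * δ) * nzPhi (b + δ) := by ring
    _ ≤ δ * rexp ((a + δ) * δ) * ((gaussianReal 0 1).real (Set.Ioi (b + δ)) * (a + δ + 1)) := by
        gcongr
    _ = _ := by ring

lemma nz_far {a b δ : ℝ} (ha : 0 ≤ a) (hδ : 0 < δ) (hb : a ≤ b) :
    (gaussianReal 0 1).real (Set.Ioc b (b + δ)) ≤ δ * (rexp (-a ^ 2 / 2) / 2) := by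
  have h2 := nz_Ioc_le (a := b) (b := b + δ) (C := rexp (-a ^ 2 / 2) / 2)
    (by linarith) (by
      intro x hx
      rw [nzPhi_eq, mul_comm, div_eq_mul_inv (rexp _) 2]
      have h3 := hx.1
      have : (2 : ℝ) ≤ √(2 * π) := by
        apply Real.le_sqrt_of_sq_le
        nlinarith [Real.pi_gt_three]
      have h5 : -x ^ 2 / 2 ≤ -a ^ 2 / 2 := by nlinarith
      gcongr)
  simpa using h2

section
variable {Ω : Type*} [MeasurableSpace Ω] {P : Measure Ω} {d : ℕ} {X : Fin d → Ω → ℝ}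

lemma nz_term (hX : HasGaussianLaw (fun ω i => X i ω) P) (hm : ∀ i, Measurable (X i))
    (h1 : ∀ i, P.map (X i) = gaussianReal 0 1) (b : Fin d → ℝ) {a δ : ℝ} (ha : 0 ≤ a) (hδ : 0 < δ)
    (j : Fin d) (hb : b j ≤ a) :
    P.real ({ω | ∀ i, (i < j → X i ω - b i < X j ω - b j) ∧ X i ω - b i ≤ X j ω - b j} ∩
      X j ⁻¹' Set.Ioc (b j) (b j + δ)) ≤ δ * (rexp ((a + δ) * δ) * (a + δ + 1)) *
    P.real ({ω | ∀ i, (i < j → X i ω - b i < X j ω - b j) ∧ X i ω - b i ≤ X j ω - b j} ∩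
      X j ⁻¹' Set.Ioi (b j + δ)) := by
  have hP := hX.isProbabilityMeasure
  have hL : ∀ i, MemLp (X i) 2 P := fun i => (hX.eval i).memLp_two
  have hvar : ∀ i, Var[X i; P] = 1 := by
    intro i
    have := variance_id_map (μ := P) (X := X i) (hm i).aemeasurable
    rw [← this, h1, variance_id_gaussianReal]; simp
  set ρ : Fin d → ℝ := fun i => cov[X j, X i; P] with hρ
  have hρ1 : ∀ i, ρ i ≤ 1 := by
    intro i
    have := variance_sub (hL j) (hL i)
    have h0 := variance_nonneg (X j - X i) P
    rw [hvar, hvar] at this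
    simp only [hρ]
    linarith
  set V : Fin d → Ω → ℝ := fun i ω => X i ω - ρ i * X j ω with hV
  have hind : IndepFun (X j) (fun ω i => V i ω) P := by
    have hG : HasGaussianLaw (fun ω => ((fun _ : Unit => X j ω), fun i => V i ω)) P := by
      let L : (Fin d → ℝ) →L[ℝ] ((Unit → ℝ) × (Fin d → ℝ)) :=
        (ContinuousLinearMap.pi fun _ => ContinuousLinearMap.proj j).prod
          (ContinuousLinearMap.pi fun i =>
            ContinuousLinearMap.proj i - ρ i • ContinuousLinearMap.proj j)
      have := hX.map_fun L
      exact this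
    have := hG.indepFun_of_covariance_eval (X := fun _ : Unit => X j) (Y := V) (by
      intro _ i
      simp only [hV]
      rw [covariance_fun_sub_right (hL j) (hL i) ((hL j).const_mul _), covariance_const_mul_right,
        covariance_self (hm j).aemeasurable, hvar]
      simp [hρ])
    exact this.comp (φ := fun f : Unit → ℝ => f ()) (ψ := id) (measurable_pi_apply ()) measurable_id
  set y := b j + δ with hy
  set S : Set (Fin d → ℝ) := {v | ∀ i, (i < j → v i + b j - b i < (1 - ρ i) * y) ∧
    v i + b j - b i ≤ (1 - ρ i) * y} with hS
  have hSm : MeasurableSet S := by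
    rw [hS]
    simp only [Set.ofPred_forall, Set.ofPred_and]
    refine MeasurableSet.iInter fun i => MeasurableSet.inter
      (MeasurableSet.iInter fun _ => measurableSet_lt (by fun_prop) (by fun_prop))
      (measurableSet_le (by fun_prop) (by fun_prop))
  have hprod : ∀ I : Set ℝ, MeasurableSet I → P.real (X j ⁻¹' I ∩ (fun ω i => V i ω) ⁻¹' S) =
      (gaussianReal 0 1).real I * P.real ((fun ω i => V i ω) ⁻¹' S) := by
    intro I hI
    simp only [measureReal_def]
    rw [hind.measure_inter_preimage_eq_mul I S hI hSm, ENNReal.toReal_mul, ← h1 j,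
      Measure.map_apply (hm j) hI]
  calc _ ≤ P.real (X j ⁻¹' Set.Ioc (b j) y ∩ (fun ω i => V i ω) ⁻¹' S) := by
        refine measureReal_mono ?_
        rintro ω ⟨hB, hI⟩
        refine ⟨hI, fun i => ?_⟩
        have hmon : (1 - ρ i) * X j ω ≤ (1 - ρ i) * y :=
          mul_le_mul_of_nonneg_left hI.2 (by linarith [hρ1 i])
        simp only [hV]
        refine ⟨fun hij => ?_, ?_⟩
        · linarith [(hB i).1 hij]
        · linarith [(hB i).2]
    _ = (gaussianReal 0 1).real (Set.Ioc (b j) y) * P.real ((fun ω i => V i ω) ⁻¹' S) :=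
        hprod _ measurableSet_Ioc
    _ ≤ δ * (rexp ((a + δ) * δ) * (a + δ + 1)) * (gaussianReal 0 1).real (Set.Ioi y) *
        P.real ((fun ω i => V i ω) ⁻¹' S) := by
        gcongr
        exact nz_near ha hδ hb
    _ = δ * (rexp ((a + δ) * δ) * (a + δ + 1)) *
        P.real (X j ⁻¹' Set.Ioi y ∩ (fun ω i => V i ω) ⁻¹' S) := by
        rw [hprod _ measurableSet_Ioi]; ring
    _ ≤ _ := by
        refine mul_le_mul_of_nonneg_left ?_ (by positivity)
        refine measureReal_mono ?_
        rintro ω ⟨hI, hB⟩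
        refine ⟨fun i => ?_, hI⟩
        have hmon : (1 - ρ i) * y ≤ (1 - ρ i) * X j ω :=
          mul_le_mul_of_nonneg_left (le_of_lt hI) (by linarith [hρ1 i])
        have hB' := hB i
        simp only [hV] at hB'
        refine ⟨fun hij => ?_, ?_⟩
        · linarith [hB'.1 hij]
        · linarith [hB'.2]

lemma nz_step (hd : 0 < d) (hX : HasGaussianLaw (fun ω i => X i ω) P) (hm : ∀ i, Measurable (X i))
    (h1 : ∀ i, P.map (X i) = gaussianReal 0 1) (b : Fin d → ℝ) {a δ : ℝ} (ha : 0 ≤ a) (hδ : 0 < δ)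
    (had : rexp (-a ^ 2 / 2) = (d : ℝ)⁻¹)
    (hK : rexp ((a + δ) * δ) * (a + δ + 1) ≤ a + 3 / 2) :
    P.real {ω | ∀ j, X j ω ≤ b j + δ} - P.real {ω | ∀ j, X j ω ≤ b j} ≤ δ * (a + 2) := by
  have hP := hX.isProbabilityMeasure
  set B : Fin d → Set Ω := fun j =>
    {ω | ∀ i, (i < j → X i ω - b i < X j ω - b j) ∧ X i ω - b i ≤ X j ω - b j} with hB
  have hBm : ∀ j, MeasurableSet (B j) := by
    intro j
    simp only [hB, Set.ofPred_forall, Set.ofPred_and]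
    have := hm
    refine MeasurableSet.iInter fun i => MeasurableSet.inter
      (MeasurableSet.iInter fun _ => measurableSet_lt (by fun_prop) (by fun_prop))
      (measurableSet_le (by fun_prop) (by fun_prop))
  have hBd : Pairwise (Function.onFun Disjoint B) := by
    intro j k hjk
    refine Set.disjoint_left.2 fun ω hj hk => ?_
    rcases lt_or_gt_of_ne hjk with h | h
    · linarith [(hk j).1 h, (hj k).2]
    · linarith [(hj k).1 h, (hk j).2]
  have hBex : ∀ ω, ∃ j, ω ∈ B j := by
    intro ω
    have : Nonempty (Fin d) := ⟨⟨0, hd⟩⟩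
    obtain ⟨j, hj⟩ := Finite.exists_max (fun i => toLex (X i ω - b i, OrderDual.toDual i))
    refine ⟨j, fun i => ?_⟩
    have := Prod.Lex.le_iff.1 (hj i)
    simp at this
    refine ⟨fun hij => ?_, ?_⟩
    · rcases this with h | h
      · exact h
      · exact absurd h.2 (not_le.2 hij)
    · rcases this with h | h
      · exact h.le
      · exact h.1.le
  have hsplit : P.real {ω | ∀ j, X j ω ≤ b j + δ} ≤ P.real {ω | ∀ j, X j ω ≤ b j} +
      ∑ j, P.real (B j ∩ X j ⁻¹' Set.Ioc (b j) (b j + δ)) := by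
    have hsub : {ω | ∀ j, X j ω ≤ b j + δ} ⊆ {ω | ∀ j, X j ω ≤ b j} ∪
        ⋃ j ∈ (Finset.univ : Finset (Fin d)), (B j ∩ X j ⁻¹' Set.Ioc (b j) (b j + δ)) := by
      intro ω hω
      by_cases h : ∀ j, X j ω ≤ b j
      · exact Or.inl h
      · right
        push Not at h
        obtain ⟨i, hi⟩ := h
        obtain ⟨j, hj⟩ := hBex ω
        simp only [Finset.mem_univ, Set.iUnion_true, Set.mem_iUnion]
        refine ⟨j, hj, ?_, hω j⟩
        linarith [(hj i).2]
    refine (measureReal_mono hsub).trans ((measureReal_union_le _ _).trans ?_)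
    gcongr
    exact measureReal_biUnion_finset_le _ _
  have hone : ∑ j, P.real (B j ∩ X j ⁻¹' Set.Ioi (b j + δ)) ≤ 1 := by
    rw [← measureReal_biUnion_finset]
    · exact measureReal_le_one
    · intro j _ k _ hjk
      exact (hBd hjk).mono Set.inter_subset_left Set.inter_subset_left
    · intro j _
      exact (hBm j).inter (hm j measurableSet_Ioi)
  have hterm : ∀ j, P.real (B j ∩ X j ⁻¹' Set.Ioc (b j) (b j + δ)) ≤
      δ * (a + 3 / 2) * P.real (B j ∩ X j ⁻¹' Set.Ioi (b j + δ)) + δ * ((d : ℝ)⁻¹ / 2) := by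
    intro j
    rcases le_total (b j) a with h | h
    · have h2 := nz_term hX hm h1 b ha hδ j h
      have h3 : δ * (rexp ((a + δ) * δ) * (a + δ + 1)) *
          P.real (B j ∩ X j ⁻¹' Set.Ioi (b j + δ)) ≤
          δ * (a + 3 / 2) * P.real (B j ∩ X j ⁻¹' Set.Ioi (b j + δ)) := by gcongr
      have h4 : 0 ≤ δ * ((d : ℝ)⁻¹ / 2) := by positivity
      exact (h2.trans h3).trans (le_add_of_nonneg_right h4)
    · have h2 := nz_far ha hδ h
      rw [had, ← h1 j, map_measureReal_apply (hm j) measurableSet_Ioc] at h2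
      have h3 : P.real (B j ∩ X j ⁻¹' Set.Ioc (b j) (b j + δ)) ≤
        P.real (X j ⁻¹' Set.Ioc (b j) (b j + δ)) := measureReal_mono Set.inter_subset_right
      have h4 : 0 ≤ δ * (a + 3 / 2) * P.real (B j ∩ X j ⁻¹' Set.Ioi (b j + δ)) := by positivity
      linarith
  have hsum : ∑ j, P.real (B j ∩ X j ⁻¹' Set.Ioc (b j) (b j + δ)) ≤
      δ * (a + 3 / 2) * 1 + δ / 2 := by
    refine (Finset.sum_le_sum fun j _ => hterm j).trans ?_
    rw [Finset.sum_add_distrib, ← Finset.mul_sum]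
    have hd' : (d : ℝ) ≠ 0 := by positivity
    have : ∑ _j : Fin d, δ * ((d : ℝ)⁻¹ / 2) = δ / 2 := by
      simp; field_simp
    rw [this]
    gcongr
  linarith

lemma nz_main (hd : 0 < d) (hX : HasGaussianLaw (fun ω i => X i ω) P) (hm : ∀ i, Measurable (X i))
    (h1 : ∀ i, P.map (X i) = gaussianReal 0 1) (b : Fin d → ℝ) {ε : ℝ} (hε : 0 < ε) :
    P.real {ω | ∀ j, X j ω ≤ b j + ε} - P.real {ω | ∀ j, X j ω ≤ b j} ≤
      ε * (√(2 * Real.log d) + 2) := by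
  set a := √(2 * Real.log d) with ha
  have ha0 : 0 ≤ a := Real.sqrt_nonneg _
  have hd1 : (1 : ℝ) ≤ d := by exact_mod_cast hd
  have had : rexp (-a ^ 2 / 2) = (d : ℝ)⁻¹ := by
    rw [ha, Real.sq_sqrt (by have := Real.log_nonneg hd1; positivity)]
    rw [show -(2 * Real.log d) / 2 = -Real.log d by ring, Real.exp_neg, Real.exp_log (by positivity)]
  have hev : ∀ᶠ n : ℕ in Filter.atTop,
      rexp ((a + ε / n) * (ε / n)) * (a + ε / n + 1) < a + 3 / 2 := by
    have hlim : Filter.Tendsto (fun n : ℕ => ε / (n : ℝ)) Filter.atTop (nhds 0) :=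
      tendsto_const_div_atTop_nhds_zero_nat ε
    have hc : Continuous (fun δ : ℝ => rexp ((a + δ) * δ) * (a + δ + 1)) := by fun_prop
    have := (hc.tendsto 0).comp hlim
    refine this.eventually_lt_const ?_
    simp; norm_num
  obtain ⟨n, hn, hn0⟩ := (hev.and (Filter.eventually_gt_atTop 0)).exists
  have hn0' : (0 : ℝ) < n := by exact_mod_cast hn0
  have hind : ∀ k : ℕ, P.real {ω | ∀ j, X j ω ≤ b j + k * (ε / n)} -
      P.real {ω | ∀ j, X j ω ≤ b j} ≤ k * (ε / n * (a + 2)) := by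
    intro k
    induction k with
    | zero => simp
    | succ k ih =>
      have := nz_step hd hX hm h1 (fun j => b j + k * (ε / n)) ha0 (by positivity) had hn.le
      have e : ∀ j, b j + ((k + 1 : ℕ) : ℝ) * (ε / n) = b j + k * (ε / n) + ε / n := by
        intro j; push_cast; ring
      simp only [e]
      push_cast
      linarith
  have := hind n
  have e : (n : ℝ) * (ε / n) = ε := by field_simp
  rwa [← mul_assoc, e] at this

end

theorem stmt5 :
    ∀ d : ℕ, 3 ≤ d →
    ∀ S : Matrix (Fin d) (Fin d) ℝ, S.PosSemidef →
    ∀ μ : Measure (Fin d → ℝ), IsProbabilityMeasure μ →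
      -- `μ` is the law of a centered Gaussian vector `G` with covariance `S`,
      -- so that `E[G_j ^ 2] = S j j`
      (∀ t : Fin d → ℝ,
        μ.map (fun x => t ⬝ᵥ x) = gaussianReal 0 (Real.toNNReal (t ⬝ᵥ S.mulVec t))) →
    ∀ σ : ℝ, 0 < σ → (∀ j, σ ^ 2 ≤ S j j) →
    ∀ b : Fin d → ℝ, ∀ ε : ℝ, 0 < ε →
      (μ {x | ∀ j, x j ≤ b j + ε}).toReal - (μ {x | ∀ j, x j ≤ b j}).toReal ≤
        ε / σ * (Real.sqrt (2 * Real.log d) + 2) := by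
  intro d hd S hS μ hμ hlaw σ hσ hσS b ε hε
  have hG : IsGaussian μ := by
    refine isGaussian_of_isGaussian_map fun L => ?_
    have : (L : (Fin d → ℝ) → ℝ) = fun x => (fun i => L (Pi.single i 1)) ⬝ᵥ x := by
      ext x
      have hx := L.toLinearMap.pi_apply_eq_sum_univ x
      simp only [ContinuousLinearMap.coe_coe, smul_eq_mul] at hx
      rw [hx, dotProduct]
      refine Finset.sum_congr rfl fun i _ => ?_
      rw [mul_comm]
      congr 2
      ext k
      simp [Pi.single_apply, eq_comm]
    rw [this, hlaw]
    infer_instance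
  have hSpos : ∀ j, 0 < S j j := fun j => lt_of_lt_of_le (by positivity) (hσS j)
  have hs : ∀ j, 0 < √(S j j) := fun j => Real.sqrt_pos.2 (hSpos j)
  have hsσ : ∀ j, σ ≤ √(S j j) := fun j => Real.le_sqrt_of_sq_le (hσS j)
  set X : Fin d → (Fin d → ℝ) → ℝ := fun j x => (√(S j j))⁻¹ * x j with hXdef
  have hX : HasGaussianLaw (fun ω i => X i ω) μ := by
    let L : (Fin d → ℝ) →L[ℝ] (Fin d → ℝ) :=
      ContinuousLinearMap.pi fun i => (√(S i i))⁻¹ • ContinuousLinearMap.proj i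
    have := (IsGaussian.hasGaussianLaw_id (μ := μ)).map_fun L
    exact this
  have hm : ∀ i, Measurable (X i) := by
    intro i; simp only [hXdef]; fun_prop
  have h1 : ∀ i, μ.map (X i) = gaussianReal 0 1 := by
    intro i
    have h := hlaw (Pi.single i (√(S i i))⁻¹)
    simp only [single_dotProduct, mulVec_single] at h
    simp only [hXdef]
    rw [h]
    congr 1
    have : (√(S i i))⁻¹ * ((MulOpposite.op (√(S i i))⁻¹ • S.col i) i) = 1 := by
      simp
      have h2 := Real.mul_self_sqrt (hSpos i).le
      have h3 := (hs i).ne'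
      field_simp
      nlinarith
    rw [this]; simp
  have key := nz_main (by omega) hX hm h1 (fun j => (√(S j j))⁻¹ * b j) (ε := ε / σ) (by positivity)
  refine le_trans ?_ key
  simp only [measureReal_def]
  have hset : {x : Fin d → ℝ | ∀ j, X j x ≤ (√(S j j))⁻¹ * b j} = {x | ∀ j, x j ≤ b j} := by
    ext x
    refine forall_congr' fun j => ?_
    exact mul_le_mul_iff_right₀ (inv_pos.2 (hs j))
  rw [hset]
  refine sub_le_sub_right (ENNReal.toReal_mono (measure_ne_top _ _) (measure_mono ?_)) _
  · intro x h j
    have h2 : (√(S j j))⁻¹ * x j ≤ (√(S j j))⁻¹ * (b j + ε) :=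
      mul_le_mul_of_nonneg_left (h j) (inv_pos.2 (hs j)).le
    have h3 : (√(S j j))⁻¹ * ε ≤ ε / σ := by
      rw [div_eq_mul_inv, mul_comm]
      have := hsσ j
      gcongr
    simp only [hXdef]
    linarith
end

section
/- There exists an absolute constant C > 0 such that the following holds. Let d ≥ 3, let v_1, …, v_d be distinct unit vectors in ℝ^d, b_1, …, b_d ∈ ℝ, and A = {x ∈ ℝ^d : x·v_j ≤ b_j for j = 1,…,d}. Then for every u ∈ ℝ^d, |∫_A u·∇φ_d(z) dz| ≤ C (log d)^{1/2} max_{1 ≤ j ≤ d} |u·v_j|. -/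
open MeasureTheory Matrix Real

/-- the standard Gaussian density on `ℝ^d` -/
noncomputable def gaussPDF (d : ℕ) (z : Fin d → ℝ) : ℝ :=
  (2 * π) ^ (-(d : ℝ) / 2) * Real.exp (-(∑ i, z i ^ 2) / 2)

lemma gaussPDF_pos (d : ℕ) (z : Fin d → ℝ) : 0 < gaussPDF d z := by
  unfold gaussPDF; positivity

lemma gaussPDF_cont (d : ℕ) : Continuous (gaussPDF d) := by
  unfold gaussPDF; fun_prop

lemma gaussPDF_prod (d : ℕ) (z : Fin d → ℝ) :
    gaussPDF d z = ∏ i, ((2 * π) ^ (-(1 : ℝ) / 2) * Real.exp (-(1/2) * z i ^ 2)) := by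
  unfold gaussPDF
  rw [Finset.prod_mul_distrib, ← Real.exp_sum, ← Finset.mul_sum]
  simp only [Finset.prod_const, Finset.card_univ, Fintype.card_fin]
  rw [← Real.rpow_natCast, ← Real.rpow_mul (by positivity)]
  congr 2 <;> ring

lemma gaussPDF_integrable (d : ℕ) : Integrable (gaussPDF d) := by
  have : gaussPDF d = fun z => ∏ i, ((2 * π) ^ (-(1 : ℝ) / 2) * Real.exp (-(1/2) * z i ^ 2)) :=
    funext (gaussPDF_prod d)
  rw [this]
  exact Integrable.fintype_prod (f := fun _ x => (2 * π) ^ (-(1 : ℝ) / 2) * Real.exp (-(1/2) * x ^ 2))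
    (fun i => (integrable_exp_neg_mul_sq (by norm_num)).const_mul _)

lemma gaussPDF_integral (d : ℕ) : ∫ z, gaussPDF d z = 1 := by
  simp_rw [gaussPDF_prod d]
  rw [integral_fintype_prod_volume_eq_prod
    (f := fun _ x => (2 * π) ^ (-(1 : ℝ) / 2) * Real.exp (-(1/2) * x ^ 2))]
  rw [integral_const_mul, integral_gaussian]
  apply Finset.prod_eq_one
  intro i _
  rw [Real.sqrt_eq_rpow, show π / (1/2) = 2 * π by ring, ← Real.rpow_add (by positivity)]
  norm_num

lemma gaussPDF_add (d : ℕ) (z w : Fin d → ℝ) :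
    gaussPDF d (z + w) = Real.exp (-(z ⬝ᵥ w) - (∑ i, w i ^ 2) / 2) * gaussPDF d z := by
  unfold gaussPDF
  rw [mul_left_comm, ← Real.exp_add]
  congr 2
  simp only [dotProduct, Pi.add_apply, add_sq, Finset.sum_add_distrib]
  rw [show ∑ i, 2 * z i * w i = 2 * ∑ i, z i * w i by
    rw [Finset.mul_sum]; simp only [mul_assoc]]
  ring

lemma exp_eq_shift (d : ℕ) (z w : Fin d → ℝ) :
    Real.exp (z ⬝ᵥ w) * gaussPDF d z = Real.exp ((∑ i, w i ^ 2) / 2) * gaussPDF d (z + -w) := by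
  rw [gaussPDF_add, ← mul_assoc, ← Real.exp_add]
  congr 2
  simp

lemma exp_integrable (d : ℕ) (w : Fin d → ℝ) :
    Integrable (fun z => Real.exp (z ⬝ᵥ w) * gaussPDF d z) := by
  simp_rw [exp_eq_shift]
  exact ((gaussPDF_integrable d).comp_add_right (-w)).const_mul _

lemma exp_integral (d : ℕ) (w : Fin d → ℝ) :
    ∫ z, Real.exp (z ⬝ᵥ w) * gaussPDF d z = Real.exp ((∑ i, w i ^ 2) / 2) := by
  simp_rw [exp_eq_shift]
  rw [integral_const_mul, integral_add_right_eq_self (gaussPDF d) (-w), gaussPDF_integral, mul_one]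

lemma dot_cont (d : ℕ) (w : Fin d → ℝ) : Continuous (fun z : Fin d → ℝ => z ⬝ᵥ w) := by
  unfold dotProduct; fun_prop

lemma dot_integrable (d : ℕ) (w : Fin d → ℝ) :
    Integrable (fun z => (z ⬝ᵥ w) * gaussPDF d z) := by
  refine Integrable.mono' ((exp_integrable d w).add (exp_integrable d (-w)))
    (((dot_cont d w).mul (gaussPDF_cont d)).aestronglyMeasurable) (ae_of_all _ fun z => ?_)
  have h := gaussPDF_pos d z
  simp only [Pi.add_apply, dotProduct_neg]
  rw [norm_mul, Real.norm_of_nonneg h.le, ← add_mul]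
  refine mul_le_mul_of_nonneg_right ?_ h.le
  rw [Real.norm_eq_abs, abs_le]
  have h1 := Real.add_one_le_exp (z ⬝ᵥ w)
  have h2 := Real.add_one_le_exp (-(z ⬝ᵥ w))
  have h3 := Real.exp_pos (z ⬝ᵥ w)
  have h4 := Real.exp_pos (-(z ⬝ᵥ w))
  constructor <;> linarith

lemma gauss_lower (d : ℕ) (z w : Fin d → ℝ) :
    gaussPDF d z - (z ⬝ᵥ w) * gaussPDF d z - (∑ i, w i ^ 2) / 2 * gaussPDF d z
      ≤ gaussPDF d (z + w) := by
  rw [gaussPDF_add]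
  have h := gaussPDF_pos d z
  have h1 := Real.add_one_le_exp (-(z ⬝ᵥ w) - (∑ i, w i ^ 2) / 2)
  nlinarith

lemma gauss_fderiv (d : ℕ) (z u : Fin d → ℝ) :
    fderiv ℝ (gaussPDF d) z u = -((z ⬝ᵥ u) * gaussPDF d z) := by
  have h : ∀ i : Fin d, HasFDerivAt (fun z : Fin d → ℝ => z i ^ 2)
      ((2 * z i) • (ContinuousLinearMap.proj i : (Fin d → ℝ) →L[ℝ] ℝ)) z := by
    intro i
    simpa using (hasFDerivAt_apply (𝕜 := ℝ) i z).pow 2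
  have h2 := (((((HasFDerivAt.fun_sum (u := Finset.univ) fun i _ => h i).neg).mul_const
    (1/2 : ℝ)).exp).const_mul ((2 * π) ^ (-(d : ℝ) / 2)))
  have h3 : gaussPDF d = fun z : Fin d → ℝ => (2 * π) ^ (-(d : ℝ) / 2) *
      Real.exp (-(∑ i, z i ^ 2) * (1/2)) := by
    funext z; unfold gaussPDF; rw [div_eq_mul_one_div (-(∑ i, z i ^ 2))]
  have h4 := h2.fderiv
  rw [h3]
  refine (congrArg (fun L => L u) h4).trans ?_
  simp [dotProduct, mul_assoc, ← Finset.mul_sum]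
  ring

/-- pieces: index `j` is the first maximizer, the maximum exceeds `e` -/
def piece (d : ℕ) (v : Fin d → (Fin d → ℝ)) (b : Fin d → ℝ) (e : ℝ) (j : Fin d) :
    Set (Fin d → ℝ) :=
  {x | e < x ⬝ᵥ v j - b j ∧ (∀ i, x ⬝ᵥ v i - b i ≤ x ⬝ᵥ v j - b j) ∧
    ∀ i, i < j → x ⬝ᵥ v i - b i < x ⬝ᵥ v j - b j}

def poly (d : ℕ) (v : Fin d → (Fin d → ℝ)) (b : Fin d → ℝ) (e : ℝ) : Set (Fin d → ℝ) :=
  {x | ∀ j, x ⬝ᵥ v j ≤ b j + e}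

lemma poly_meas (d v b e) : MeasurableSet (poly d v b e) := by
  unfold poly
  rw [Set.ofPred_forall]
  exact MeasurableSet.iInter fun j =>
    measurableSet_le (dot_cont d (v j)).measurable measurable_const

lemma piece_meas (d v b e j) : MeasurableSet (piece d v b e j) := by
  have hm : ∀ i, Measurable (fun x : Fin d → ℝ => x ⬝ᵥ v i - b i) := fun i =>
    (dot_cont d (v i)).measurable.sub_const _
  unfold piece
  refine (measurableSet_lt measurable_const (hm j)).inter (MeasurableSet.inter ?_ ?_)
  · show MeasurableSet {x | ∀ i, x ⬝ᵥ v i - b i ≤ x ⬝ᵥ v j - b j}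
    rw [Set.ofPred_forall]
    exact MeasurableSet.iInter fun i => measurableSet_le (hm i) (hm j)
  · show MeasurableSet {x | ∀ i, i < j → x ⬝ᵥ v i - b i < x ⬝ᵥ v j - b j}
    rw [Set.ofPred_forall]
    refine MeasurableSet.iInter fun i => ?_
    rw [Set.ofPred_forall]
    exact MeasurableSet.iInter fun _ => measurableSet_lt (hm i) (hm j)

lemma piece_disj (d v b e) : Pairwise (Function.onFun Disjoint (piece d v b e)) := by
  intro i j hij
  refine Set.disjoint_left.2 fun x hx hy => ?_
  rcases lt_or_gt_of_ne hij with h | h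
  · exact absurd (hy.2.2 i h) (not_lt.2 (hx.2.1 j))
  · exact absurd (hx.2.2 j h) (not_lt.2 (hy.2.1 i))

lemma piece_union (d v b e) : ⋃ j, piece d v b e j = (poly d v b e)ᶜ := by
  ext x
  simp only [Set.mem_iUnion, Set.mem_compl_iff, poly, Set.mem_ofPred_eq, not_forall, not_le]
  constructor
  · rintro ⟨j, hj⟩
    exact ⟨j, by linarith [hj.1]⟩
  · rintro ⟨k, hk⟩
    classical
    obtain ⟨m, -, hm⟩ := Finset.exists_max_image Finset.univ (fun i => x ⬝ᵥ v i - b i)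
      ⟨k, Finset.mem_univ k⟩
    let S := Finset.univ.filter fun j => ∀ i, x ⬝ᵥ v i - b i ≤ x ⬝ᵥ v j - b j
    have hS : S.Nonempty := ⟨m, by simpa [S] using hm⟩
    have h1 : ∀ i, x ⬝ᵥ v i - b i ≤ x ⬝ᵥ v (S.min' hS) - b (S.min' hS) :=
      (Finset.mem_filter.1 (S.min'_mem hS)).2
    refine ⟨S.min' hS, ?_, h1, ?_⟩
    · linarith [h1 k]
    · intro i hi
      by_contra hc
      have : i ∈ S := Finset.mem_filter.2 ⟨Finset.mem_univ _, fun l => (h1 l).trans (not_lt.1 hc)⟩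
      exact absurd (S.min'_le i this) (not_le.2 hi)

lemma dot_le_one (d : ℕ) (x y : Fin d → ℝ) (hx : ∑ i, x i ^ 2 = 1) (hy : ∑ i, y i ^ 2 = 1) :
    x ⬝ᵥ y ≤ 1 := by
  have : 2 * (x ⬝ᵥ y) ≤ ∑ i, x i ^ 2 + ∑ i, y i ^ 2 := by
    rw [dotProduct, Finset.mul_sum, ← Finset.sum_add_distrib]
    exact Finset.sum_le_sum fun i _ => by nlinarith [sq_nonneg (x i - y i)]
  linarith

lemma piece_shift (d : ℕ) (v b) (hv : ∀ j, ∑ i, v j i ^ 2 = 1) (e : ℝ) (he : 0 ≤ e) (j : Fin d)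
    (x : Fin d → ℝ) (hx : x ∈ piece d v b 0 j) : x + e • v j ∈ piece d v b e j := by
  have h1 : v j ⬝ᵥ v j = 1 := by rw [← hv j]; simp [dotProduct, sq]
  have h2 : ∀ i, e * (v j ⬝ᵥ v i) ≤ e := fun i =>
    mul_le_of_le_one_right he (dot_le_one d _ _ (hv j) (hv i))
  obtain ⟨a1, a2, a3⟩ := hx
  simp only [piece, Set.mem_ofPred_eq, add_dotProduct, smul_dotProduct, smul_eq_mul, h1]
  exact ⟨by linarith, fun i => by linarith [a2 i, h2 i], fun i hi => by linarith [a3 i hi, h2 i]⟩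

lemma piece_int (d : ℕ) (v b) (hv : ∀ j, ∑ i, v j i ^ 2 = 1) (e : ℝ) (he : 0 ≤ e) (j : Fin d) :
    ∫ x in piece d v b 0 j, gaussPDF d (x + e • v j) ≤ ∫ x in piece d v b e j, gaussPDF d x := by
  rw [← integral_indicator (piece_meas ..), ← integral_indicator (piece_meas ..),
    ← integral_add_right_eq_self ((piece d v b e j).indicator _) (e • v j)]
  refine integral_mono
    (((gaussPDF_integrable d).comp_add_right _).indicator (piece_meas ..))
    (((gaussPDF_integrable d).indicator (piece_meas ..)).comp_add_right _) fun x => ?_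
  by_cases hx : x ∈ piece d v b 0 j
  · rw [Set.indicator_of_mem hx, Set.indicator_of_mem (piece_shift d v b hv e he j x hx)]
  · rw [Set.indicator_of_notMem hx]
    exact Set.indicator_nonneg (fun y _ => (gaussPDF_pos d y).le) _

/-- Nazarov's inequality with an abstract envelope `G`. -/
lemma nazarov (d : ℕ) (v b) (hv : ∀ j, ∑ i, v j i ^ 2 = 1) (e : ℝ) (he : 0 ≤ e)
    (G : (Fin d → ℝ) → ℝ) (hG0 : ∀ x, 0 ≤ G x) (hG : ∀ x j, x ⬝ᵥ v j ≤ G x)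
    (hGi : Integrable fun x => G x * gaussPDF d x) :
    ∫ x in poly d v b e, gaussPDF d x ≤
      (∫ x in poly d v b 0, gaussPDF d x) + e ^ 2 / 2 + e * ∫ x, G x * gaussPDF d x := by
  have hφ := gaussPDF_integrable d
  let F : (Fin d → ℝ) → ℝ := fun x => gaussPDF d x - e * (G x * gaussPDF d x)
    - e ^ 2 / 2 * gaussPDF d x
  have hF : Integrable F := (hφ.sub (hGi.const_mul e)).sub (hφ.const_mul _)
  have key : ∫ x in (poly d v b 0)ᶜ, F x ≤ ∫ x in (poly d v b e)ᶜ, gaussPDF d x := by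
    rw [← piece_union, ← piece_union,
      integral_iUnion_fintype (fun j => piece_meas d v b 0 j) (piece_disj d v b 0)
        (fun j => hF.integrableOn),
      integral_iUnion_fintype (fun j => piece_meas d v b e j) (piece_disj d v b e)
        (fun j => hφ.integrableOn)]
    refine Finset.sum_le_sum fun j _ => le_trans ?_ (piece_int d v b hv e he j)
    refine integral_mono hF.integrableOn (hφ.comp_add_right _).integrableOn fun x => ?_
    refine le_trans ?_ (gauss_lower d x (e • v j))
    have hp := gaussPDF_pos d x
    have h1 : ∑ i, (e • v j) i ^ 2 = e ^ 2 := by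
      simp only [Pi.smul_apply, smul_eq_mul, mul_pow, ← Finset.mul_sum, hv j, mul_one]
    rw [h1, dotProduct_smul, smul_eq_mul]
    have h2 : e * (x ⬝ᵥ v j) * gaussPDF d x ≤ e * (G x * gaussPDF d x) := by
      rw [mul_assoc]
      exact mul_le_mul_of_nonneg_left (mul_le_mul_of_nonneg_right (hG x j) hp.le) he
    simp only [F]
    linarith
  have hc0 := integral_add_compl (poly_meas d v b 0) hφ
  have hce := integral_add_compl (poly_meas d v b e) hφ
  have hFe : ∫ x in (poly d v b 0)ᶜ, F x = (∫ x in (poly d v b 0)ᶜ, gaussPDF d x)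
      - e * (∫ x in (poly d v b 0)ᶜ, G x * gaussPDF d x)
      - e ^ 2 / 2 * ∫ x in (poly d v b 0)ᶜ, gaussPDF d x := by
    simp only [F]
    rw [integral_sub (f := fun x => gaussPDF d x - e * (G x * gaussPDF d x))
      (hφ.sub (hGi.const_mul e)).integrableOn (hφ.const_mul _).integrableOn,
      integral_sub hφ.integrableOn (hGi.const_mul e).integrableOn,
      integral_const_mul, integral_const_mul]
  have h1 : ∫ x in (poly d v b 0)ᶜ, G x * gaussPDF d x ≤ ∫ x, G x * gaussPDF d x :=
    setIntegral_le_integral hGi (ae_of_all _ fun x => mul_nonneg (hG0 x) (gaussPDF_pos d x).le)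
  have h2 : ∫ x in (poly d v b 0)ᶜ, gaussPDF d x ≤ ∫ x, gaussPDF d x :=
    setIntegral_le_integral hφ (ae_of_all _ fun x => (gaussPDF_pos d x).le)
  rw [gaussPDF_integral] at hc0 hce h2
  have h3 := mul_le_mul_of_nonneg_left h1 he
  have h4 := mul_le_mul_of_nonneg_left h2 (show 0 ≤ e ^ 2 / 2 by positivity)
  linarith

lemma one_side (d : ℕ) (v b) (hv : ∀ j, ∑ i, v j i ^ 2 = 1)
    (G : (Fin d → ℝ) → ℝ) (hG0 : ∀ x, 0 ≤ G x) (hG : ∀ x j, x ⬝ᵥ v j ≤ G x)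
    (hGi : Integrable fun x => G x * gaussPDF d x) (u : Fin d → ℝ) (m : ℝ) (hm : 0 ≤ m)
    (hu : ∀ j, u ⬝ᵥ v j ≤ m) :
    -(∫ x in poly d v b 0, (x ⬝ᵥ u) * gaussPDF d x) ≤ m * ∫ x, G x * gaussPDF d x := by
  have hφ := gaussPDF_integrable d
  have hd := dot_integrable d u
  set I := ∫ x in poly d v b 0, (x ⬝ᵥ u) * gaussPDF d x with hI
  set K := ∫ x, G x * gaussPDF d x with hK
  set U := ∑ i, u i ^ 2 with hU
  have hU0 : 0 ≤ U := Finset.sum_nonneg fun i _ => sq_nonneg _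
  have step : ∀ t : ℝ, 0 < t → -I ≤ m * K + t * (m ^ 2 / 2 + U / 2) := by
    intro t ht
    have h1 : ∫ x in poly d v b 0, gaussPDF d (x + t • u) ≤
        ∫ x in poly d v b (t * m), gaussPDF d x := by
      rw [← integral_indicator (poly_meas ..), ← integral_indicator (poly_meas ..),
        ← integral_add_right_eq_self ((poly d v b (t * m)).indicator _) (t • u)]
      refine integral_mono
        (((gaussPDF_integrable d).comp_add_right _).indicator (poly_meas ..))
        (((gaussPDF_integrable d).indicator (poly_meas ..)).comp_add_right _) fun x => ?_
      by_cases hx : x ∈ poly d v b 0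
      · have hx' : x + t • u ∈ poly d v b (t * m) := by
          intro j
          have := hx j
          have h2 := mul_le_mul_of_nonneg_left (hu j) ht.le
          rw [add_dotProduct, smul_dotProduct, smul_eq_mul]
          linarith
        rw [Set.indicator_of_mem hx, Set.indicator_of_mem hx']
      · rw [Set.indicator_of_notMem hx]
        exact Set.indicator_nonneg (fun y _ => (gaussPDF_pos d y).le) _
    have h2 := nazarov d v b hv (t * m) (by positivity) G hG0 hG hGi
    have h3 : ∫ x in poly d v b 0, (gaussPDF d x - t * ((x ⬝ᵥ u) * gaussPDF d x)
        - t ^ 2 * U / 2 * gaussPDF d x) ≤ ∫ x in poly d v b 0, gaussPDF d (x + t • u) := by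
      refine integral_mono ((hφ.sub (hd.const_mul t)).sub (hφ.const_mul _)).integrableOn
        (hφ.comp_add_right _).integrableOn fun x => ?_
      refine le_trans (le_of_eq ?_) (gauss_lower d x (t • u))
      have : ∑ i, (t • u) i ^ 2 = t ^ 2 * U := by
        simp only [Pi.smul_apply, smul_eq_mul, mul_pow, ← Finset.mul_sum, hU]
      rw [this, dotProduct_smul, smul_eq_mul]
      ring
    rw [integral_sub (f := fun x => gaussPDF d x - t * ((x ⬝ᵥ u) * gaussPDF d x))
      (hφ.sub (hd.const_mul t)).integrableOn (hφ.const_mul _).integrableOn,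
      integral_sub hφ.integrableOn (hd.const_mul t).integrableOn,
      integral_const_mul, integral_const_mul] at h3
    have h4 : ∫ x in poly d v b 0, gaussPDF d x ≤ ∫ x, gaussPDF d x :=
      setIntegral_le_integral hφ (ae_of_all _ fun x => (gaussPDF_pos d x).le)
    rw [gaussPDF_integral] at h4
    have h5 := mul_le_mul_of_nonneg_left h4 (show 0 ≤ t ^ 2 * U / 2 by positivity)
    have h6 : t * -I ≤ t * (m * K + t * (m ^ 2 / 2 + U / 2)) := by
      rw [← hI] at h3
      nlinarith
    exact le_of_mul_le_mul_left h6 ht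
  refine le_of_forall_pos_le_add fun ε hε => ?_
  have hq : 0 < m ^ 2 / 2 + U / 2 + 1 := by positivity
  have h := step (ε / (m ^ 2 / 2 + U / 2 + 1)) (by positivity)
  have h' : ε / (m ^ 2 / 2 + U / 2 + 1) * (m ^ 2 / 2 + U / 2) ≤ ε := by
    rw [div_mul_eq_mul_div, div_le_iff₀ hq]
    nlinarith
  linarith

/-- exponential envelope for the maximum -/
lemma envelope (d : ℕ) (hd : 3 ≤ d) (v : Fin d → (Fin d → ℝ)) (hv : ∀ j, ∑ i, v j i ^ 2 = 1) :
    ∃ G : (Fin d → ℝ) → ℝ, (∀ x, 0 ≤ G x) ∧ (∀ x j, x ⬝ᵥ v j ≤ G x) ∧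
      (Integrable fun x => G x * gaussPDF d x) ∧
      ∫ x, G x * gaussPDF d x ≤ 3 * Real.sqrt (Real.log d) := by
  have hd0 : (0 : ℝ) < d := by exact_mod_cast (by omega : 0 < d)
  have hl : 1 ≤ Real.log d := by
    rw [Real.le_log_iff_exp_le hd0]
    have : (3 : ℝ) ≤ d := by exact_mod_cast hd
    linarith [Real.exp_one_lt_d9]
  set l := Real.sqrt (Real.log d) with hlam
  have hl2 : l ^ 2 = Real.log d := Real.sq_sqrt (by linarith)
  have hl1 : 1 ≤ l := Real.one_le_sqrt.2 hl
  have hl0 : 0 < l := by linarith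
  set L := l ^ 2 / 2 + Real.log d with hL
  have hL0 : 0 ≤ L := by rw [hL, ← hl2]; positivity
  have hint : ∀ i, Integrable fun x => Real.exp (-L) * (Real.exp (x ⬝ᵥ (l • v i)) * gaussPDF d x) :=
    fun i => (exp_integrable d _).const_mul _
  have hrew : ∀ x, (1 / l * (L + ∑ i, Real.exp (x ⬝ᵥ (l • v i) - L))) * gaussPDF d x
      = 1 / l * (L * gaussPDF d x
        + ∑ i, Real.exp (-L) * (Real.exp (x ⬝ᵥ (l • v i)) * gaussPDF d x)) := by
    intro x
    rw [mul_assoc, add_mul, Finset.sum_mul]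
    congr 3
    funext i
    rw [sub_eq_add_neg, Real.exp_add]; ring
  refine ⟨fun x => 1 / l * (L + ∑ i, Real.exp (x ⬝ᵥ (l • v i) - L)), fun x => ?_, fun x j => ?_,
    ?_, ?_⟩
  · positivity
  · have h1 := Finset.single_le_sum (f := fun i => Real.exp (x ⬝ᵥ (l • v i) - L))
      (fun i _ => (Real.exp_pos _).le) (Finset.mem_univ j)
    have h2 := Real.add_one_le_exp (x ⬝ᵥ (l • v j) - L)
    beta_reduce
    rw [one_div, ← div_eq_inv_mul, le_div_iff₀ hl0]
    have h3 : x ⬝ᵥ (l • v j) = l * (x ⬝ᵥ v j) := by rw [dotProduct_smul, smul_eq_mul]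
    linarith
  · simp_rw [hrew]
    exact (((gaussPDF_integrable d).const_mul L).add
      (integrable_finsetSum _ fun i _ => hint i)).const_mul _
  · simp_rw [hrew]
    rw [integral_const_mul, integral_add ((gaussPDF_integrable d).const_mul L)
      (integrable_finsetSum _ fun i _ => hint i), integral_finsetSum _ fun i _ => hint i,
      integral_const_mul, gaussPDF_integral]
    have hE : ∀ i, ∫ x, Real.exp (-L) * (Real.exp (x ⬝ᵥ (l • v i)) * gaussPDF d x)
        = (d : ℝ)⁻¹ := by
      intro i
      have h1 : ∑ k, (l • v i) k ^ 2 = l ^ 2 := by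
        simp only [Pi.smul_apply, smul_eq_mul, mul_pow, ← Finset.mul_sum, hv i, mul_one]
      rw [integral_const_mul, exp_integral, h1, ← Real.exp_add,
        show -L + l ^ 2 / 2 = -Real.log d by rw [hL]; ring, Real.exp_neg, Real.exp_log hd0]
    simp_rw [hE]
    simp only [Finset.sum_const, Finset.card_univ, Fintype.card_fin, nsmul_eq_mul]
    rw [mul_inv_cancel₀ hd0.ne', one_div, ← div_eq_inv_mul, div_le_iff₀ hl0, hL, ← hl2]
    nlinarith

/-- first-derivative bound; `fderiv ℝ (gaussPDF d) z u = u · ∇φ_d(z)`. -/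
theorem stmt6 :
    ∃ C : ℝ, 0 < C ∧
      ∀ d : ℕ, 3 ≤ d →
      ∀ v : Fin d → (Fin d → ℝ), Function.Injective v → (∀ j, ∑ i, v j i ^ 2 = 1) →
      ∀ b : Fin d → ℝ, ∀ u : Fin d → ℝ,
        |∫ z in {x : Fin d → ℝ | ∀ j, x ⬝ᵥ v j ≤ b j}, fderiv ℝ (gaussPDF d) z u| ≤
          C * Real.sqrt (Real.log d) * ⨆ j, |u ⬝ᵥ v j| := by
  refine ⟨3, by norm_num, fun d hd v _ hv b u => ?_⟩
  obtain ⟨G, hG0, hG, hGi, hGb⟩ := envelope d hd v hv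
  have hset : {x : Fin d → ℝ | ∀ j, x ⬝ᵥ v j ≤ b j} = poly d v b 0 := by
    simp [poly]
  rw [hset]
  simp_rw [gauss_fderiv]
  have hle : ∀ j, |u ⬝ᵥ v j| ≤ ⨆ j, |u ⬝ᵥ v j| := fun j =>
    le_ciSup (f := fun j => |u ⬝ᵥ v j|) (Set.finite_range _).bddAbove j
  set m := ⨆ j, |u ⬝ᵥ v j| with hm
  have hm0 : 0 ≤ m := Real.iSup_nonneg fun j => abs_nonneg _
  have h1 := one_side d v b hv G hG0 hG hGi u m hm0 fun j => (le_abs_self _).trans (hle j)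
  have h2 := one_side d v b hv G hG0 hG hGi (-u) m hm0 fun j => by
    rw [neg_dotProduct]; exact (neg_le_abs _).trans (hle j)
  simp only [dotProduct_neg, neg_mul, integral_neg, neg_neg] at h2
  have h3 := mul_le_mul_of_nonneg_left hGb hm0
  rw [integral_neg, abs_neg, abs_le]
  constructor <;> linarith
end
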